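/- Let a, b, c, d be rational integers with a ≠ 0 such that the cubic polynomial a·X³ + b·X² + c·X + d has three distinct complex zeroes, and set H = max{|a|, |b|, |c|, |d|}. Then all rational integers x, y with y² = a·x³ + b·x² + c·x + d satisfy max{|x|, |y|} < exp((10⁶·H)^1000000). -/

import Mathlib

open Polynomial in
/-- The top coefficient of a product is the product of the top coefficients. -/
lemma coeff_prod_sum_of_natDegree_le {R ι : Type*} [CommSemiring R] (s : Finset ι)
    (f : ι → R[X]) (d : ι → ℕ) (h : ∀ i ∈ s, (f i).natDegree ≤ d i) :
    (∏ i ∈ s, f i).coeff (∑ i ∈ s, d i) = ∏ i ∈ s, (f i).coeff (d i) := by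
  classical
  induction s using Finset.induction_on with
  | empty => simp
  | insert a s ha ih =>
    rw [Finset.prod_insert ha, Finset.sum_insert ha, Finset.prod_insert ha,
      coeff_mul_add_eq_of_natDegree_le (h a (Finset.mem_insert_self a s)), ih]
    · exact fun i hi => h i (Finset.mem_insert_of_mem hi)
    · refine (natDegree_prod_le s f).trans (Finset.sum_le_sum fun i hi => ?_)
      exact h i (Finset.mem_insert_of_mem hi)

open Polynomial in
lemma coeff_det_sum_of_natDegree_le {R n : Type*} [CommRing R] [Fintype n] [DecidableEq n]
    (M : Matrix n n R[X]) (d : n → ℕ) (h : ∀ i j, (M i j).natDegree ≤ d i) :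
    M.det.coeff (∑ i, d i) = (Matrix.of fun i j => (M i j).coeff (d i)).det := by
  rw [← Matrix.det_transpose M, ← Matrix.det_transpose (Matrix.of _), Matrix.det_apply,
    Matrix.det_apply, finsetSum_coeff]
  refine Finset.sum_congr rfl fun σ _ => ?_
  rw [coeff_smul]
  exact congrArg _ (coeff_prod_sum_of_natDegree_le Finset.univ (fun i => M i (σ i)) d
    fun i _ => h i _)

open Polynomial in
lemma natDegree_det_le_sum {R n : Type*} [CommRing R] [Fintype n] [DecidableEq n]
    (M : Matrix n n R[X]) (d : n → ℕ) (h : ∀ i j, (M i j).natDegree ≤ d i) :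
    M.det.natDegree ≤ ∑ i, d i := by
  rw [← Matrix.det_transpose M, Matrix.det_apply]
  refine natDegree_sum_le_of_forall_le _ _ fun σ _ => ?_
  refine (natDegree_smul_le _ _).trans ((natDegree_prod_le _ _).trans ?_)
  exact Finset.sum_le_sum fun i _ => h i _

open Polynomial in
/-- Zero estimate for polynomials in `z` and `α ^ s * β ^ t` at the points `z = s - r t`. -/
lemma exponential_polynomial_zero_estimate {F : Type*} [Field F] [CharZero F] {α β : F}
    (hα : α ≠ 0) (hβ : β ≠ 0) (hinj : Function.Injective fun i : ℕ => α ^ i)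
    {K L S T r : ℕ} (hSr : S ≤ r) (hcount : L * K < S * T) (p : ℕ → F[X])
    (hdeg : ∀ l, l < L → (p l).natDegree ≤ K)
    (hvan : ∀ s < S + L, ∀ t < T, ∑ l ∈ Finset.range L,
      (p l).eval ((s : F) - r * t) * (α ^ s * β ^ t) ^ l = 0) :
    ∀ l < L, p l = 0 := by
  classical
  by_contra! hne
  obtain ⟨l₀, hl₀, hpl₀⟩ := hne
  set I : Finset ℕ := (Finset.range L).filter fun l => p l ≠ 0 with hI
  set m := I.card with hm
  have hmL : m ≤ L := by
    simpa using Finset.card_filter_le (Finset.range L) (fun l => p l ≠ 0)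
  set ind : Fin m → ℕ := fun i => I.orderEmbOfFin rfl i with hind
  have hindI : ∀ i, ind i ∈ I := fun i => Finset.orderEmbOfFin_mem I rfl i
  have hindinj : Function.Injective ind := (I.orderEmbOfFin rfl).injective
  have hindL : ∀ i, ind i < L ∧ p (ind i) ≠ 0 := fun i => by
    have := hindI i
    simpa [hI] using this
  have hmpos : 0 < m := Finset.card_pos.mpr ⟨l₀, by simp [hI, hl₀, hpl₀]⟩
  set M : Matrix (Fin m) (Fin m) F[X] := Matrix.of fun i j =>
    taylor ((j : ℕ) : F) (p (ind i)) * C ((α ^ ind i) ^ (j : ℕ)) with hM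
  set d : Fin m → ℕ := fun i => (p (ind i)).natDegree with hd
  have hMdeg : ∀ i j, (M i j).natDegree ≤ d i := fun i j => by
    simp only [hM, Matrix.of_apply]
    exact (natDegree_mul_C_le _ _).trans (by rw [natDegree_taylor])
  have hdet : M.det ≠ 0 := by
    intro h0
    have h1 := coeff_det_sum_of_natDegree_le M d hMdeg
    rw [h0, coeff_zero] at h1
    have h2 : (Matrix.of fun i j => (M i j).coeff (d i)) =
        Matrix.of fun i j => (p (ind i)).leadingCoeff *
          Matrix.vandermonde (fun i => α ^ ind i) i j := by
      ext i j
      simp only [hM, hd, Matrix.of_apply, coeff_mul_C, Matrix.vandermonde_apply,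
        coeff_taylor_natDegree]
    rw [h2, Matrix.det_mul_column] at h1
    have h3 : (Matrix.vandermonde fun i => α ^ ind i).det ≠ 0 :=
      Matrix.det_vandermonde_ne_zero_iff.mpr fun i j hij => hindinj (hinj hij)
    have h4 : ∏ i, (p (ind i)).leadingCoeff ≠ 0 :=
      Finset.prod_ne_zero_iff.mpr fun i _ => leadingCoeff_ne_zero.mpr (hindL i).2
    exact mul_ne_zero h4 h3 h1.symm
  refine hdet (eq_zero_of_natDegree_lt_card_of_eval_eq_zero
    (f := fun st : Fin S × Fin T => ((st.1 : ℕ) : F) - r * ((st.2 : ℕ) : F)) _ ?_ ?_ ?_)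
  · rintro ⟨s, t⟩ ⟨s', t'⟩ h
    simp only at h
    have h' : ((s : ℕ) : ℤ) - r * ((t : ℕ) : ℤ) = ((s' : ℕ) : ℤ) - r * ((t' : ℕ) : ℤ) := by
      exact_mod_cast h
    have hs := s.2
    have hs' := s'.2
    have htt : ((t : ℕ) : ℤ) = (t' : ℕ) := by
      rcases lt_trichotomy ((t : ℕ) : ℤ) ((t' : ℕ) : ℤ) with hlt | heq | hlt
      · nlinarith [mul_le_mul_of_nonneg_left (Int.add_one_le_iff.mpr hlt) (Int.natCast_nonneg r)]
      · exact heq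
      · nlinarith [mul_le_mul_of_nonneg_left (Int.add_one_le_iff.mpr hlt) (Int.natCast_nonneg r)]
    rw [htt] at h'
    have hss : (s : ℕ) = (s' : ℕ) := by omega
    ext
    · exact hss
    · exact_mod_cast htt
  · rintro ⟨s, t⟩
    set z : F := ((s : ℕ) : F) - r * ((t : ℕ) : F) with hz
    change eval z M.det = 0
    rw [← coe_evalRingHom, RingHom.map_det]
    rw [← Matrix.exists_vecMul_eq_zero_iff]
    refine ⟨fun i => (α ^ (s : ℕ) * β ^ (t : ℕ)) ^ ind i, ?_, ?_⟩
    · intro h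
      have := congrFun h ⟨0, hmpos⟩
      simp only [Pi.zero_apply] at this
      exact pow_ne_zero _ (mul_ne_zero (pow_ne_zero _ hα) (pow_ne_zero _ hβ)) this
    · ext j
      have hv := hvan (s + j) (by have := s.2; have := j.2; omega) t t.2
      have hsum : ∑ l ∈ Finset.range L, (p l).eval (((s + j : ℕ) : F) - r * ((t : ℕ) : F)) *
          (α ^ ((s : ℕ) + j) * β ^ (t : ℕ)) ^ l =
          ∑ i : Fin m, (p (ind i)).eval (((s + j : ℕ) : F) - r * ((t : ℕ) : F)) *
          (α ^ ((s : ℕ) + j) * β ^ (t : ℕ)) ^ ind i := by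
        have himg : Finset.univ.image ind = I := by
          ext l
          simp only [Finset.mem_image, Finset.mem_univ, true_and]
          constructor
          · rintro ⟨i, rfl⟩; exact hindI i
          · intro hl
            have : l ∈ Set.range (I.orderEmbOfFin rfl) := by
              rw [Finset.range_orderEmbOfFin]; exact hl
            exact this
        rw [← Finset.sum_image (f := fun l => (p l).eval (((s + j : ℕ) : F) - r * ((t : ℕ) : F)) *
          (α ^ ((s : ℕ) + j) * β ^ (t : ℕ)) ^ l) (g := ind) (s := Finset.univ)
            (fun i _ j _ h => hindinj h), himg, hI, Finset.sum_filter]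
        refine Finset.sum_congr rfl fun l _ => ?_
        split_ifs with h
        · rfl
        · simp only [ne_eq, not_not] at h
          simp [h]
      rw [hsum] at hv
      simp only [Matrix.vecMul, dotProduct, Pi.zero_apply]
      rw [← hv]
      refine Finset.sum_congr rfl fun i _ => ?_
      simp only [hM, RingHom.mapMatrix_apply, Matrix.map_apply, Matrix.of_apply,
        coe_evalRingHom, eval_mul, eval_C, taylor_eval, hz]
      push_cast
      rw [show ((s : ℕ) : F) - r * ((t : ℕ) : F) + ((j : ℕ) : F)
        = ((s : ℕ) : F) + ((j : ℕ) : F) - r * ((t : ℕ) : F) by ring]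
      ring
  · rw [Fintype.card_prod, Fintype.card_fin, Fintype.card_fin]
    refine lt_of_le_of_lt (natDegree_det_le_sum M d hMdeg) (lt_of_le_of_lt ?_ hcount)
    calc ∑ i, d i ≤ ∑ _i : Fin m, K := Finset.sum_le_sum fun i _ => hdeg _ (hindL i).1
      _ = m * K := by simp
      _ ≤ L * K := Nat.mul_le_mul_right _ hmL

/-- An entire function vanishing on a finite set is divisible by the corresponding polynomial. -/
lemma exists_entire_eq_prod_mul (Z : Finset ℂ) : ∀ F : ℂ → ℂ, Differentiable ℂ F →
    (∀ a ∈ Z, F a = 0) → ∃ G : ℂ → ℂ, Differentiable ℂ G ∧ ∀ z, F z = (∏ a ∈ Z, (z - a)) * G z := by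
  classical
  induction Z using Finset.induction_on with
  | empty => exact fun F hF _ => ⟨F, hF, fun z => by simp⟩
  | insert a Z ha ih =>
    intro F hF hz
    have hFa : F a = 0 := hz a (Finset.mem_insert_self a Z)
    have hd : ∀ z, (z - a) * dslope F a z = F z := fun z => by
      have := sub_smul_dslope F a z
      rw [hFa, sub_zero, smul_eq_mul] at this
      exact this
    have hdiff : Differentiable ℂ (dslope F a) := by
      rw [← differentiableOn_univ, Complex.differentiableOn_dslope Filter.univ_mem,
        differentiableOn_univ]
      exact hF
    obtain ⟨G, hG, hGz⟩ := ih (dslope F a) hdiff fun b hb => by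
      have h1 := hd b
      rw [hz b (Finset.mem_insert_of_mem hb)] at h1
      refine (mul_eq_zero.mp h1).resolve_left (sub_ne_zero.mpr ?_)
      rintro rfl
      exact ha hb
    refine ⟨G, hG, fun z => ?_⟩
    rw [Finset.prod_insert ha, mul_assoc, ← hGz, hd]

/-- Schwarz lemma for an entire function with prescribed zeros in a disc. -/
lemma norm_le_of_zeros {Z : Finset ℂ} {F : ℂ → ℂ} (hF : Differentiable ℂ F)
    (hZ : ∀ a ∈ Z, F a = 0) {R M : ℝ} (hR : 0 < R) (hZR : ∀ a ∈ Z, ‖a‖ ≤ R)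
    (hM : ∀ z, ‖z‖ = 9 * R → ‖F z‖ ≤ M) {w : ℂ} (hw : ‖w‖ ≤ R) :
    ‖F w‖ ≤ M * (1 / 4) ^ Z.card := by
  obtain ⟨G, hG, hGz⟩ := exists_entire_eq_prod_mul Z F hF hZ
  have hpos : 0 < (8 * R) ^ Z.card := by positivity
  have hGb : ‖G w‖ ≤ M / (8 * R) ^ Z.card := by
    refine Complex.norm_le_of_forall_mem_frontier_norm_le (U := Metric.ball 0 (9 * R))
      Metric.isBounded_ball hG.diffContOnCl ?_ ?_
    · intro z hz
      rw [frontier_ball _ (by positivity), mem_sphere_zero_iff_norm] at hz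
      rw [le_div_iff₀ hpos]
      refine le_trans ?_ (hM z hz)
      rw [hGz z, norm_mul, mul_comm, norm_prod]
      refine mul_le_mul_of_nonneg_right ?_ (norm_nonneg _)
      rw [← Finset.prod_const]
      refine Finset.prod_le_prod (fun _ _ => by positivity) fun a ha => ?_
      have := norm_sub_norm_le z a
      have := hZR a ha
      linarith
    · refine subset_closure ?_
      rw [mem_ball_zero_iff]
      linarith
  rw [hGz w, norm_mul, norm_prod]
  have h1 : ∏ a ∈ Z, ‖w - a‖ ≤ (2 * R) ^ Z.card := by
    rw [← Finset.prod_const]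
    refine Finset.prod_le_prod (fun _ _ => norm_nonneg _) fun a ha => ?_
    have := norm_sub_le w a
    have := hZR a ha
    linarith
  calc (∏ a ∈ Z, ‖w - a‖) * ‖G w‖ ≤ (2 * R) ^ Z.card * (M / (8 * R) ^ Z.card) :=
        mul_le_mul h1 hGb (norm_nonneg _) (by positivity)
    _ = M * (1 / 4) ^ Z.card := by
        rw [show (8 : ℝ) * R = 4 * (2 * R) by ring, mul_pow 4 (2 * R), div_pow, one_pow]
        field_simp

/-- Schwarz lemma for an entire function which is small on a finite separated set. -/
lemma norm_le_of_small_values {Z : Finset ℂ} {F : ℂ → ℂ} (hF : Differentiable ℂ F)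
    {R M ε : ℝ} (hR : 1 ≤ R) (hε : 0 ≤ ε) (hZε : ∀ a ∈ Z, ‖F a‖ ≤ ε) (hZR : ∀ a ∈ Z, ‖a‖ ≤ R)
    (hsep : ∀ a ∈ Z, ∀ b ∈ Z, a ≠ b → 1 ≤ ‖a - b‖)
    (hM : ∀ z, ‖z‖ = 9 * R → ‖F z‖ ≤ M) {w : ℂ} (hw : ‖w‖ ≤ R) :
    ‖F w‖ ≤ (M + Z.card * ε * (10 * R) ^ Z.card) * (1 / 4) ^ Z.card
      + Z.card * ε * (10 * R) ^ Z.card := by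
  classical
  set P := Lagrange.interpolate Z id F with hP
  have hPa : ∀ a ∈ Z, P.eval a = F a := fun a ha =>
    Lagrange.eval_interpolate_at_node F (Set.injOn_id _) ha
  have hPb : ∀ z : ℂ, ‖z‖ ≤ 9 * R → ‖P.eval z‖ ≤ Z.card * ε * (10 * R) ^ Z.card := by
    intro z hz
    rw [hP, Lagrange.interpolate_apply, Polynomial.eval_finsetSum]
    refine (norm_sum_le _ _).trans ?_
    rw [mul_assoc, ← nsmul_eq_mul]
    refine Finset.sum_le_card_nsmul _ _ _ fun a ha => ?_
    rw [Polynomial.eval_mul, Polynomial.eval_C, norm_mul]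
    refine mul_le_mul (hZε a ha) ?_ (norm_nonneg _) hε
    rw [Lagrange.basis, Polynomial.eval_prod, norm_prod]
    calc ∏ j ∈ Z.erase a, ‖Polynomial.eval z (Lagrange.basisDivisor (id a) (id j))‖
        ≤ ∏ j ∈ Z.erase a, (10 * R) := by
          refine Finset.prod_le_prod (fun _ _ => norm_nonneg _) fun j hj => ?_
          have hj' := Finset.mem_of_mem_erase hj
          have h1 := hsep a ha j hj' (Finset.ne_of_mem_erase hj).symm
          simp only [Lagrange.basisDivisor, id, Polynomial.eval_mul, Polynomial.eval_C,
            Polynomial.eval_sub, Polynomial.eval_X, norm_mul, norm_inv]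
          have h2 := norm_sub_le z j
          have h3 := hZR j hj'
          have h4 : ‖a - j‖⁻¹ ≤ 1 := inv_le_one_of_one_le₀ h1
          calc ‖a - j‖⁻¹ * ‖z - j‖ ≤ 1 * (10 * R) :=
                mul_le_mul h4 (by linarith) (norm_nonneg _) zero_le_one
            _ = 10 * R := one_mul _
      _ = (10 * R) ^ (Z.erase a).card := by rw [Finset.prod_const]
      _ ≤ (10 * R) ^ Z.card :=
          pow_le_pow_right₀ (by linarith) (Finset.card_le_card (Finset.erase_subset a Z))
  set E := (Z.card * ε * (10 * R) ^ Z.card : ℝ) with hE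
  have hE0 : 0 ≤ E := by positivity
  have h := norm_le_of_zeros (F := fun z => F z - P.eval z) (M := M + E)
    (hF.sub P.differentiable) (fun a ha => by simp [hPa a ha]) (by linarith) hZR
    (fun z hz => (norm_sub_le _ _).trans (add_le_add (hM z hz) (hPb z hz.le))) hw
  have h2 : ‖F w‖ ≤ ‖F w - P.eval w‖ + ‖P.eval w‖ := by
    simpa using norm_add_le (F w - P.eval w) (P.eval w)
  have h3 := hPb w (by linarith)
  linarith

/-- A Siegel lemma for linear equations over a ring satisfying a product inequality. -/
lemma exists_small_int_solution {A ι J E : Type*} [CommRing A] [Fintype ι] [Nonempty ι]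
    [Fintype J] [Nonempty J] [Fintype E] [Nonempty E] (σ : ι → A →+* ℂ)
    (hA : ∀ x : A, x ≠ 0 → 1 ≤ ∏ i, ‖σ i x‖) (a : E → J → A) (B : ℕ) (hB : 1 ≤ B)
    (ha : ∀ i e j, ‖σ i (a e j)‖ ≤ B)
    (hcard : 4 * Fintype.card ι * Fintype.card E ≤ Fintype.card J) :
    ∃ p : J → ℤ, p ≠ 0 ∧ (∀ j, |p j| ≤ 8 * Fintype.card J * B) ∧
      ∀ e, ∑ j, (p j : A) * a e j = 0 := by
  classical
  set N := Fintype.card J with hN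
  have hNpos : 0 < N := Fintype.card_pos
  set P := 8 * N * B with hP
  have hPpos : 0 < P := by positivity
  set X := 2 * N * P * B with hX
  let val : (J → Fin P) → ι → E → ℂ := fun p i e => ∑ j, ((p j : ℕ) : ℂ) * σ i (a e j)
  have hval : ∀ p i e, ‖val p i e‖ ≤ N * P * B := by
    intro p i e
    refine (norm_sum_le _ _).trans ?_
    have : ∀ j ∈ Finset.univ, ‖((p j : ℕ) : ℂ) * σ i (a e j)‖ ≤ (P * B : ℝ) := by
      intro j _
      rw [norm_mul, Complex.norm_natCast]
      refine mul_le_mul ?_ (ha i e j) (norm_nonneg _) (by positivity)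
      exact_mod_cast (p j).2.le
    refine (Finset.sum_le_card_nsmul _ _ _ this).trans_eq ?_
    rw [nsmul_eq_mul, Finset.card_univ]
    ring
  let key : (J → Fin P) → (ι × E) × Bool → ℤ := fun p x =>
    if x.2 then ⌊2 * (val p x.1.1 x.1.2).re⌋ else ⌊2 * (val p x.1.1 x.1.2).im⌋
  have hfl : ∀ y : ℝ, |y| ≤ N * P * B → ⌊2 * y⌋ ∈ Finset.Icc (-(X : ℤ)) X := by
    intro y hy
    rw [abs_le] at hy
    rw [Finset.mem_Icc]
    constructor
    · rw [Int.le_floor, hX]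
      push_cast
      nlinarith [hy.1]
    · rw [← Int.cast_le (R := ℝ)]
      refine (Int.floor_le _).trans ?_
      rw [hX]
      push_cast
      nlinarith [hy.2]
  have hmaps : ∀ p ∈ (Finset.univ : Finset (J → Fin P)),
      key p ∈ Fintype.piFinset fun _ : (ι × E) × Bool => Finset.Icc (-(X : ℤ)) X := by
    intro p _
    rw [Fintype.mem_piFinset]
    rintro ⟨⟨i, e⟩, b⟩
    simp only [key]
    split_ifs
    · exact hfl _ ((Complex.abs_re_le_norm _).trans (hval p i e))
    · exact hfl _ ((Complex.abs_im_le_norm _).trans (hval p i e))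
  have hcount : (Fintype.piFinset fun _ : (ι × E) × Bool => Finset.Icc (-(X : ℤ)) X).card <
      (Finset.univ : Finset (J → Fin P)).card := by
    rw [Fintype.card_piFinset, Finset.prod_const, Int.card_Icc, Finset.card_univ, Finset.card_univ,
      Fintype.card_prod, Fintype.card_prod, Fintype.card_bool, Fintype.card_fun, Fintype.card_fin]
    have h1 : ((X : ℤ) + 1 - -X).toNat = 2 * X + 1 := by omega
    rw [h1]
    have h2 : 2 * X + 1 < P ^ 2 := by
      have : P ^ 2 = 2 * X + 4 * N * P * B := by rw [hX, hP]; ring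
      rw [this]
      have : 0 < N * P * B := by positivity
      nlinarith
    have hι : 0 < Fintype.card ι := Fintype.card_pos
    have hE : 0 < Fintype.card E := Fintype.card_pos
    calc (2 * X + 1) ^ (Fintype.card ι * Fintype.card E * 2)
        < (P ^ 2) ^ (Fintype.card ι * Fintype.card E * 2) :=
          Nat.pow_lt_pow_left h2 (by positivity)
      _ = P ^ (4 * Fintype.card ι * Fintype.card E) := by rw [← pow_mul]; ring_nf
      _ ≤ P ^ N := Nat.pow_le_pow_right hPpos hcard
  obtain ⟨p, -, q, -, hpq, hkey⟩ := Finset.exists_ne_map_eq_of_card_lt_of_maps_to hcount hmaps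
  refine ⟨fun j => ((p j : ℕ) : ℤ) - ((q j : ℕ) : ℤ), ?_, ?_, ?_⟩
  · intro h
    refine hpq (funext fun j => Fin.ext ?_)
    have := congrFun h j
    simp only [Pi.zero_apply] at this
    omega
  · intro j
    have h1 := (p j).2
    have h2 := (q j).2
    have h3 : ((8 * N * B : ℕ) : ℤ) = 8 * (N : ℤ) * B := by push_cast; ring
    beta_reduce
    rw [← h3, abs_le]
    constructor <;> omega
  · intro e
    by_contra hne
    have h1 := hA _ hne
    have hfloor : ∀ x y : ℝ, ⌊2 * x⌋ = ⌊2 * y⌋ → |x - y| < 1 / 2 := by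
      intro x y h
      have := Int.abs_sub_lt_one_of_floor_eq_floor h
      rw [← mul_sub, abs_mul, abs_two] at this
      linarith
    have h2 : ∀ i, ‖σ i (∑ j, (((((p j : ℕ) : ℤ) - ((q j : ℕ) : ℤ) : ℤ)) : A) * a e j)‖ < 1 := by
      intro i
      have hσ : σ i (∑ j, (((((p j : ℕ) : ℤ) - ((q j : ℕ) : ℤ) : ℤ)) : A) * a e j) =
          val p i e - val q i e := by
        simp only [val, map_sum, map_mul, map_intCast]
        rw [← Finset.sum_sub_distrib]
        refine Finset.sum_congr rfl fun j _ => ?_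
        push_cast
        ring
      rw [hσ]
      have hre := congrFun hkey ((i, e), true)
      have him := congrFun hkey ((i, e), false)
      simp only [key, if_true, Bool.false_eq_true, if_false] at hre him
      have h3 := hfloor _ _ hre
      have h4 := hfloor _ _ him
      refine (Complex.norm_le_abs_re_add_abs_im _).trans_lt ?_
      rw [Complex.sub_re, Complex.sub_im]
      linarith
    obtain ⟨i₀⟩ := ‹Nonempty ι›
    have h3 : ∏ i, ‖σ i (∑ j, (((((p j : ℕ) : ℤ) - ((q j : ℕ) : ℤ) : ℤ)) : A) * a e j)‖ < 1 := by
      rw [← Finset.mul_prod_erase _ _ (Finset.mem_univ i₀)]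
      refine mul_lt_one_of_nonneg_of_lt_one_left (norm_nonneg _) (h2 i₀) ?_
      exact Finset.prod_le_one (fun _ _ => norm_nonneg _) fun i _ => (h2 i).le
    linarith

lemma exp_le_three_pow {x : ℝ} {m : ℕ} (h : x ≤ m) : Real.exp x ≤ 3 ^ m := by
  have h1 : Real.exp 1 ≤ 3 := (Real.exp_one_lt_d9.trans (by norm_num)).le
  calc Real.exp x ≤ Real.exp m := Real.exp_le_exp.mpr h
    _ = Real.exp 1 ^ m := by rw [← Real.exp_nat_mul, mul_one]
    _ ≤ 3 ^ m := pow_le_pow_left₀ (Real.exp_pos 1).le h1 m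

lemma norm_sum_int_mul_le {J : Type*} [Fintype J] (p : J → ℤ) (c : J → ℂ) {P C : ℝ}
    (hP : ∀ j, |(p j : ℝ)| ≤ P) (hC : ∀ j, ‖c j‖ ≤ C) (hP0 : 0 ≤ P) :
    ‖∑ j, (p j : ℂ) * c j‖ ≤ Fintype.card J * P * C := by
  refine (norm_sum_le _ _).trans ?_
  have : ∀ j ∈ Finset.univ, ‖(p j : ℂ) * c j‖ ≤ P * C := by
    intro j _
    rw [norm_mul, Complex.norm_intCast]
    exact mul_le_mul (hP j) (hC j) (norm_nonneg _) hP0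
  refine (Finset.sum_le_card_nsmul _ _ _ this).trans_eq ?_
  rw [nsmul_eq_mul, Finset.card_univ, mul_assoc]

lemma norm_monomial_le {A : Type*} [CommRing A] (σ : A →+* ℂ) {α μ ν : A} {h₁ h₂ : ℕ}
    (hα : ‖σ α‖ ≤ 3 ^ h₁) (hμ : ‖σ μ‖ ≤ 3 ^ h₂) (hν : ‖σ ν‖ ≤ 3 ^ h₂)
    {K L S T r R s t k l : ℕ} (hs : s ≤ S) (ht : t ≤ T) (hk : k ≤ K) (hl : l < L)
    (hR : S + r * T ≤ R) (hR1 : 1 ≤ R) :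
    ‖σ ((((s : ℤ) - r * t : ℤ) : A) ^ k * (α ^ (l * s) * μ ^ (l * t) * ν ^ ((L - 1 - l) * t)))‖ ≤
      (R : ℝ) ^ K * 3 ^ (h₁ * L * S + h₂ * L * T) := by
  have h3 : (1 : ℝ) ≤ 3 := by norm_num
  have hz : ‖σ (((s : ℤ) - r * t : ℤ) : A)‖ ≤ R := by
    rw [map_intCast, Complex.norm_intCast, ← Int.cast_abs]
    have h1 : (r * t : ℤ) ≤ r * T := by
      exact_mod_cast Nat.mul_le_mul_left r ht
    have h2 : (S : ℤ) + r * T ≤ R := by exact_mod_cast hR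
    have h4 : (s : ℤ) ≤ S := by exact_mod_cast hs
    have h5 : (0 : ℤ) ≤ r * t := by positivity
    have : |(s : ℤ) - r * t| ≤ R := by
      rw [abs_le]
      constructor <;> linarith [Int.natCast_nonneg s, Int.natCast_nonneg S]
    exact_mod_cast this
  rw [map_mul, map_mul, map_mul, map_pow, map_pow, map_pow, map_pow, norm_mul, norm_mul, norm_mul,
    norm_pow, norm_pow, norm_pow, norm_pow]
  have e1 : ‖σ (((s : ℤ) - r * t : ℤ) : A)‖ ^ k ≤ (R : ℝ) ^ K :=
    (pow_le_pow_left₀ (norm_nonneg _) hz k).trans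
      (pow_le_pow_right₀ (by exact_mod_cast hR1) hk)
  have e2 : ‖σ α‖ ^ (l * s) ≤ 3 ^ (h₁ * L * S) := by
    refine (pow_le_pow_left₀ (norm_nonneg _) hα _).trans ?_
    rw [← pow_mul, mul_assoc]
    exact pow_le_pow_right₀ h3 (Nat.mul_le_mul_left _ (Nat.mul_le_mul hl.le hs))
  have e3 : ‖σ μ‖ ^ (l * t) * ‖σ ν‖ ^ ((L - 1 - l) * t) ≤ 3 ^ (h₂ * L * T) := by
    refine (mul_le_mul (pow_le_pow_left₀ (norm_nonneg _) hμ _)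
      (pow_le_pow_left₀ (norm_nonneg _) hν _) (by positivity) (by positivity)).trans ?_
    rw [← pow_mul, ← pow_mul, ← pow_add]
    refine pow_le_pow_right₀ h3 ?_
    rw [← mul_add, ← add_mul, mul_assoc]
    exact Nat.mul_le_mul_left _ (Nat.mul_le_mul (by omega) ht)
  rw [pow_add]
  refine mul_le_mul e1 ?_ (by positivity) (by positivity)
  rw [mul_assoc]
  exact mul_le_mul e2 e3 (by positivity) (by positivity)

lemma norm_exp_sub_one_le_two_mul {w : ℂ} (hw : ‖w‖ ≤ 1) : ‖Complex.exp w - 1‖ ≤ 2 * ‖w‖ :=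
  Complex.norm_exp_sub_one_le hw

/-- Evaluation of a monomial in `α, μ, ν` when `μ / ν` is close to a power of `α`. -/
lemma map_monomial_eq {A : Type*} [CommRing A] (σ : A →+* ℂ) {α μ ν : A} {lam θ : ℂ} {r : ℕ}
    (hα : σ α = Complex.exp lam) (hμ : σ μ = σ ν * Complex.exp (-(r * lam) + θ))
    {L s t k l : ℕ} (hl : l < L) :
    σ ((((s : ℤ) - r * t : ℤ) : A) ^ k * (α ^ (l * s) * μ ^ (l * t) * ν ^ ((L - 1 - l) * t))) =
      σ ν ^ ((L - 1) * t) * ((((s : ℤ) - r * t : ℤ) : ℂ) ^ k *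
        (Complex.exp (l * (lam * ((s : ℤ) - r * t : ℤ))) * Complex.exp (l * t * θ))) := by
  have hν : σ ν ^ ((L - 1) * t) = σ ν ^ (l * t) * σ ν ^ ((L - 1 - l) * t) := by
    rw [← pow_add, ← add_mul]
    congr 2
    omega
  have hexp : Complex.exp (l * (lam * ((s : ℤ) - r * t : ℤ))) * Complex.exp (l * t * θ) =
      Complex.exp lam ^ (l * s) * Complex.exp (-(r * lam) + θ) ^ (l * t) := by
    rw [← Complex.exp_nat_mul, ← Complex.exp_nat_mul, ← Complex.exp_add, ← Complex.exp_add]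
    congr 1
    push_cast
    ring
  simp only [map_mul, map_pow, map_intCast]
  rw [hν, hexp, hα, hμ, mul_pow]
  ring

lemma sub_mul_injOn {S T r : ℕ} (hS : S ≤ r) :
    Set.InjOn (fun x : ℕ × ℕ => (((x.1 : ℤ) - r * x.2 : ℤ))) (Finset.range S ×ˢ Finset.range T) := by
  rintro ⟨s, t⟩ hst ⟨s', t'⟩ hst' h
  simp only [Finset.coe_range, Set.mem_prod, Set.mem_Iio] at hst hst' h
  have htt : (t : ℤ) = t' := by
    rcases lt_trichotomy (t : ℤ) (t' : ℤ) with hlt | heq | hlt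
    · nlinarith [mul_le_mul_of_nonneg_left (Int.add_one_le_iff.mpr hlt) (Int.natCast_nonneg r)]
    · exact heq
    · nlinarith [mul_le_mul_of_nonneg_left (Int.add_one_le_iff.mpr hlt) (Int.natCast_nonneg r)]
  rw [htt] at h
  ext
  · simp only; omega
  · simp only; omega

/-- Extrapolation: an exponential polynomial which almost vanishes on a grid is small on a
larger disc. -/
lemma exp_poly_extrapolate {J : Type*} [Fintype J] (p : J → ℤ) (k l : J → ℕ) {K L R ρ : ℕ}
    (hk : ∀ j, k j ≤ K) (hl : ∀ j, l j ≤ L) (hR1 : 1 ≤ R) (hRρ : 10 * R ≤ 3 ^ ρ)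
    {lam : ℂ} {P : ℝ} (hP : ∀ j, |(p j : ℝ)| ≤ P) (hP0 : 0 ≤ P) {v m : ℕ}
    (hv : L * ‖lam‖ * R ≤ v) (hm : Fintype.card J * P * 3 ^ (ρ * K) ≤ 3 ^ m)
    {Z : Finset ℂ} {n : ℕ} (hn : Z.card = n) (hnρ : n ≤ 3 ^ (2 * ρ)) (hZR : ∀ a ∈ Z, ‖a‖ ≤ R)
    (hsep : ∀ a ∈ Z, ∀ b ∈ Z, a ≠ b → 1 ≤ ‖a - b‖) {ε : ℝ} (hε : 0 ≤ ε)
    (hε1 : ε * 3 ^ (2 * ρ + ρ * n + n) ≤ 1)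
    (hZε : ∀ a ∈ Z, ‖∑ j, (p j : ℂ) * (a ^ k j * Complex.exp (l j * (lam * a)))‖ ≤ ε)
    {w : ℂ} (hw : ‖w‖ ≤ R) :
    ‖∑ j, (p j : ℂ) * (w ^ k j * Complex.exp (l j * (lam * w)))‖ * 3 ^ n ≤ 3 ^ (m + 9 * v) + 2 := by
  set F : ℂ → ℂ := fun z => ∑ j, (p j : ℂ) * (z ^ k j * Complex.exp (l j * (lam * z))) with hF
  have hR1' : (1 : ℝ) ≤ R := by exact_mod_cast hR1
  have hRρ' : (10 * R : ℝ) ≤ 3 ^ ρ := by exact_mod_cast hRρ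
  have hFd : Differentiable ℂ F := by
    simp only [hF]
    fun_prop
  have hM : ∀ z : ℂ, ‖z‖ = 9 * R → ‖F z‖ ≤ 3 ^ (m + 9 * v) := by
    intro z hz
    refine (norm_sum_int_mul_le p _ (C := 3 ^ (ρ * K) * 3 ^ (9 * v)) hP (fun j => ?_) hP0).trans ?_
    · rw [norm_mul, norm_pow]
      refine mul_le_mul ?_ ?_ (norm_nonneg _) (by positivity)
      · calc ‖z‖ ^ k j ≤ ((3 : ℝ) ^ ρ) ^ k j :=
              pow_le_pow_left₀ (norm_nonneg _) (by rw [hz]; linarith) _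
          _ ≤ ((3 : ℝ) ^ ρ) ^ K := pow_le_pow_right₀ (one_le_pow₀ (by norm_num)) (hk j)
          _ = 3 ^ (ρ * K) := by rw [pow_mul]
      · refine (Complex.norm_exp_le_exp_norm _).trans (exp_le_three_pow ?_)
        rw [norm_mul, norm_mul, Complex.norm_natCast, hz]
        have : (l j : ℝ) ≤ L := by exact_mod_cast hl j
        push_cast
        calc (l j : ℝ) * (‖lam‖ * (9 * R)) ≤ L * (‖lam‖ * (9 * R)) :=
              mul_le_mul_of_nonneg_right this (by positivity)
          _ = 9 * (L * ‖lam‖ * R) := by ring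
          _ ≤ 9 * v := by linarith
    · rw [pow_add, ← mul_assoc]
      exact mul_le_mul_of_nonneg_right hm (by positivity)
  have h := norm_le_of_small_values hFd hR1' hε hZε hZR hsep hM hw
  rw [hn] at h
  set Y : ℝ := n * ε * (10 * R) ^ n with hY
  have hY0 : 0 ≤ Y := by positivity
  have hY1 : Y * 3 ^ n ≤ 1 := by
    refine le_trans ?_ hε1
    have e1 : ((10 : ℝ) * R) ^ n ≤ 3 ^ (ρ * n) := by
      rw [pow_mul]
      exact pow_le_pow_left₀ (by positivity) hRρ' n
    have e2 : (n : ℝ) ≤ 3 ^ (2 * ρ) := by exact_mod_cast hnρ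
    calc Y * 3 ^ n = ε * (n * (10 * R) ^ n * 3 ^ n) := by rw [hY]; ring
      _ ≤ ε * (3 ^ (2 * ρ) * 3 ^ (ρ * n) * 3 ^ n) := by gcongr
      _ = ε * 3 ^ (2 * ρ + ρ * n + n) := by rw [pow_add, pow_add]
  have h3n : (1 : ℝ) ≤ 3 ^ n := one_le_pow₀ (by norm_num)
  have hq : ((1 : ℝ) / 4) ^ n * 3 ^ n ≤ 1 := by
    rw [← mul_pow]
    exact pow_le_one₀ (by norm_num) (by norm_num)
  have hY1' : Y ≤ 1 := le_trans (le_mul_of_one_le_right hY0 h3n) hY1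
  have hM0 : (0 : ℝ) ≤ 3 ^ (m + 9 * v) + Y := by positivity
  calc ‖F w‖ * 3 ^ n ≤ ((3 ^ (m + 9 * v) + Y) * (1 / 4) ^ n + Y) * 3 ^ n :=
        mul_le_mul_of_nonneg_right h (by positivity)
    _ = (3 ^ (m + 9 * v) + Y) * ((1 / 4) ^ n * 3 ^ n) + Y * 3 ^ n := by ring
    _ ≤ (3 ^ (m + 9 * v) + Y) * 1 + 1 := by gcongr
    _ ≤ 3 ^ (m + 9 * v) + 2 := by linarith

set_option maxHeartbeats 2000000 in
/-- The two-logarithm estimate, in the form of a contradiction: `α ^ r * (μ / ν)` cannot be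
extremely close to `1` when the conjugates of `α`, `μ`, `ν` are bounded. -/
theorem two_logarithms_contradiction {A ι : Type*} [CommRing A] [Fintype ι]
    (hD : Fintype.card ι ≤ 24) (σ : ι → A →+* ℂ) (i₀ : ι)
    (hA : ∀ x : A, x ≠ 0 → 1 ≤ ∏ i, ‖σ i x‖) {α μ ν : A} {lam θ : ℂ} {h₁ h₂ L r ρ : ℕ}
    (hh₁ : 1 ≤ h₁) (hh₂ : 1 ≤ h₂) (hρ1 : 1 ≤ ρ)
    (hα : ∀ i, ‖σ i α‖ ≤ 3 ^ h₁) (hμ : ∀ i, ‖σ i μ‖ ≤ 3 ^ h₂) (hν : ∀ i, ‖σ i ν‖ ≤ 3 ^ h₂)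
    (hinj : Function.Injective fun m : ℕ => σ i₀ α ^ m)
    (hexp : σ i₀ α = Complex.exp lam)
    (hμν : σ i₀ μ = σ i₀ ν * Complex.exp (-(r * lam) + θ)) (hν0 : σ i₀ ν ≠ 0)
    (hlam₁ : ‖lam‖ ≤ h₁) (hlam₂ : r * ‖lam‖ ≤ 4 * h₂)
    (hL : 20000 * ρ ≤ L) (hr : 40000 * L * h₂ ≤ r)
    (hρ : 10 * (44000 * L * h₂ + r * (44000 * L * h₁)) ≤ 3 ^ ρ)
    (hθ : ‖θ‖ * 3 ^ ((ρ + 3) * (16000000 * L ^ 2 * h₁ * h₂)) ≤ 1) : False := by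
  classical
  set S₀ := 4000 * L * h₂ with hS₀
  set T₀ := 4000 * L * h₁ with hT₀
  set S := 44000 * L * h₂ with hS
  set T := 44000 * L * h₁ with hT
  set W := 4000 * L ^ 2 * h₁ * h₂ with hW
  set n := S₀ * T₀ with hn
  set K := 96 * 16000000 * L * h₁ * h₂ with hK
  set R := S + r * T with hR
  set u := 3 * (ρ * K) + 24 * W with hu
  clear_value u R K n W T S T₀ S₀
  have hLpos : 0 < L := by omega
  have hLh₂ : 1 ≤ L * h₂ := Nat.mul_pos hLpos hh₂
  have hLh₁ : 1 ≤ L * h₁ := Nat.mul_pos hLpos hh₁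
  have hrpos : 1 ≤ r := by
    have : 40000 * L * h₂ = 40000 * (L * h₂) := by ring
    omega
  have hnW : n = 4000 * W := by rw [hn, hS₀, hT₀, hW]; ring
  have hn' : n = 16000000 * L ^ 2 * h₁ * h₂ := by rw [hnW, hW]; ring
  have hWpos : 1 ≤ W := by
    rw [hW, show 4000 * L ^ 2 * h₁ * h₂ = 4000 * ((L * h₁) * (L * h₂)) by ring]
    have := Nat.mul_pos hLh₁ hLh₂
    omega
  have hnpos : 1 ≤ n := by omega
  have hLK : L * K = 96 * n := by rw [hn', hK]; ring
  have hK96 : 96 ≤ K := by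
    have := Nat.mul_pos hLh₁ hh₂
    rw [hK, show 96 * 16000000 * L * h₁ * h₂ = 96 * (16000000 * (L * h₁ * h₂)) by ring]
    omega
  have hSR : S ≤ R := by rw [hR]; omega
  have hTR : T ≤ R := by
    have : T ≤ r * T := Nat.le_mul_of_pos_left T hrpos
    omega
  have hS1 : S = 11 * S₀ := by rw [hS, hS₀]; ring
  have hT1 : T = 11 * T₀ := by rw [hT, hT₀]; ring
  have hLS : L ≤ S₀ := by
    rw [hS₀, show 4000 * L * h₂ = 4000 * (L * h₂) by ring]
    have := Nat.le_mul_of_pos_right L hh₂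
    omega
  have hR1 : 1 ≤ R := by omega
  have hSTR : S * T ≤ R ^ 2 := by rw [pow_two]; exact Nat.mul_le_mul hSR hTR
  have hST : S * T = 121 * n := by rw [hS1, hT1, hn]; ring
  have hR2 : 100 * R ^ 2 ≤ 3 ^ (2 * ρ) := by
    rw [mul_comm 2, pow_mul, show 100 * R ^ 2 = (10 * R) ^ 2 by ring]
    exact Nat.pow_le_pow_left hρ 2
  have h8N : 8 * (L * K) ≤ 3 ^ (2 * ρ) := by omega
  have hnρ : n ≤ 3 ^ (2 * ρ) := by omega
  have h2LT : 2 * (L * T) ≤ 3 ^ (2 * ρ) := by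
    have : L * T ≤ S * T := Nat.mul_le_mul_right T (by omega)
    omega
  have hρK : 96 * ρ ≤ ρ * K := by rw [mul_comm]; exact Nat.mul_le_mul_left ρ hK96
  have hR3 : (R : ℝ) ^ K ≤ 3 ^ (ρ * K) := by
    rw [pow_mul (3 : ℝ) ρ K]
    refine pow_le_pow_left₀ (by positivity) ?_ K
    have : R ≤ 3 ^ ρ := by omega
    exact_mod_cast this
  have h31 : (1 : ℝ) ≤ 3 := by norm_num
  -- the auxiliary polynomial
  have : Nonempty ι := ⟨i₀⟩
  have : Nonempty (Fin L) := ⟨⟨0, hLpos⟩⟩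
  have : Nonempty (Fin K) := ⟨⟨0, by omega⟩⟩
  have : Nonempty (Fin S₀) := ⟨⟨0, by omega⟩⟩
  have : Nonempty (Fin T₀) := ⟨⟨0, by rw [hT₀, mul_assoc]; omega⟩⟩
  let a : ℕ → ℕ → Fin L × Fin K → A := fun s t j =>
    (((s : ℤ) - r * t : ℤ) : A) ^ (j.2 : ℕ) *
      (α ^ ((j.1 : ℕ) * s) * μ ^ ((j.1 : ℕ) * t) * ν ^ ((L - 1 - (j.1 : ℕ)) * t))
  have hcardJ : Fintype.card (Fin L × Fin K) = L * K := by simp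
  obtain ⟨p, hp0, hpb, hpz⟩ := exists_small_int_solution σ hA
    (fun (e : Fin S₀ × Fin T₀) j => a e.1 e.2 j) (3 ^ (ρ * K + 2 * W)) (Nat.one_le_pow _ _ (by norm_num))
    (fun i e j => by
      refine (norm_monomial_le (σ i) (hα i) (hμ i) (hν i) (S := S₀) (T := T₀) (R := R) (K := K)
        e.1.2.le e.2.2.le j.2.2.le j.1.2 ?_ hR1).trans ?_
      · rw [hR]
        exact Nat.add_le_add (by omega) (Nat.mul_le_mul_left r (by omega))
      · push_cast
        have : h₁ * L * S₀ + h₂ * L * T₀ = 2 * W := by rw [hS₀, hT₀, hW]; ring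
        rw [this, pow_add]
        exact mul_le_mul_of_nonneg_right hR3 (by positivity))
    (by
      rw [hcardJ, Fintype.card_prod, Fintype.card_fin, Fintype.card_fin, hLK, ← hn]
      exact Nat.mul_le_mul_right n (by omega))
  rw [hcardJ] at hpb
  set P : ℝ := 3 ^ (2 * ρ + ρ * K + 2 * W) with hP
  have hpP : ∀ j, |(p j : ℝ)| ≤ P := by
    intro j
    have h1 : (|p j| : ℝ) ≤ 8 * ((L * K : ℕ) : ℝ) * ((3 ^ (ρ * K + 2 * W) : ℕ) : ℝ) := by
      exact_mod_cast hpb j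
    refine h1.trans ?_
    have h2 : (8 * ((L * K : ℕ) : ℝ)) ≤ 3 ^ (2 * ρ) := by exact_mod_cast h8N
    rw [hP, add_assoc, pow_add (3 : ℝ) (2 * ρ)]
    push_cast at h2 ⊢
    exact mul_le_mul_of_nonneg_right h2 (by positivity)
  have hNP : (Fintype.card (Fin L × Fin K) : ℝ) * P ≤ 3 ^ (4 * ρ + ρ * K + 2 * W) := by
    rw [hcardJ, hP, show 4 * ρ + ρ * K + 2 * W = 2 * ρ + (2 * ρ + ρ * K + 2 * W) by ring,
      pow_add (3 : ℝ) (2 * ρ) (2 * ρ + ρ * K + 2 * W)]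
    have h2 : ((L * K : ℕ) : ℝ) ≤ 3 ^ (2 * ρ) := by
      have : L * K ≤ 3 ^ (2 * ρ) := by omega
      exact_mod_cast this
    exact mul_le_mul_of_nonneg_right h2 (by positivity)
  have hP0 : 0 ≤ P := by positivity
  let E : ℕ → ℕ → A := fun s t => ∑ j, (p j : A) * a s t j
  have hEb : ∀ i, ∀ s < S, ∀ t < T, ‖σ i (E s t)‖ ≤ 3 ^ u := by
    intro i s hs t ht
    have h1 : σ i (E s t) = ∑ j, (p j : ℂ) * σ i (a s t j) := by
      simp only [E, map_sum, map_mul, map_intCast]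
    rw [h1]
    refine (norm_sum_int_mul_le p _ hpP (fun j => norm_monomial_le (σ i) (hα i) (hμ i) (hν i)
      hs.le ht.le j.2.2.le j.1.2 hR.ge hR1) hP0).trans ?_
    have h2 : h₁ * L * S + h₂ * L * T = 22 * W := by rw [hS, hT, hW]; ring
    rw [h2]
    calc _ ≤ (3 : ℝ) ^ (4 * ρ + ρ * K + 2 * W) * (3 ^ (ρ * K) * 3 ^ (22 * W)) := by gcongr
      _ = 3 ^ (4 * ρ + ρ * K + 2 * W + (ρ * K + 22 * W)) := by rw [← pow_add, ← pow_add]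
      _ ≤ 3 ^ u := pow_le_pow_right₀ h31 (by omega)
  -- the analytic function
  let F : ℂ → ℂ := fun z => ∑ j : Fin L × Fin K, (p j : ℂ) *
    (z ^ (j.2 : ℕ) * Complex.exp ((j.1 : ℕ) * (lam * z)))
  let H : ℕ → ℕ → ℂ := fun s t => ∑ j : Fin L × Fin K, (p j : ℂ) *
    ((((s : ℤ) - r * t : ℤ) : ℂ) ^ (j.2 : ℕ) *
      (Complex.exp ((j.1 : ℕ) * (lam * ((s : ℤ) - r * t : ℤ))) *
        Complex.exp ((j.1 : ℕ) * t * θ)))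
  have hEH : ∀ s t, σ i₀ (E s t) = σ i₀ ν ^ ((L - 1) * t) * H s t := by
    intro s t
    simp only [E, H, map_sum, map_mul, map_intCast, Finset.mul_sum]
    refine Finset.sum_congr rfl fun j _ => ?_
    rw [map_monomial_eq (σ i₀) hexp hμν j.1.2]
    ring
  have hzR : ∀ s < S, ∀ t < T, ‖(((s : ℤ) - r * t : ℤ) : ℂ)‖ ≤ R := by
    intro s hs t ht
    rw [Complex.norm_intCast, ← Int.cast_abs]
    have h1 : (r * t : ℤ) ≤ r * T := by exact_mod_cast Nat.mul_le_mul_left r ht.le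
    have h2 : (R : ℤ) = S + r * T := by rw [hR]; push_cast; ring
    have h5 : (0 : ℤ) ≤ r * t := by positivity
    have : |(s : ℤ) - r * t| ≤ R := by
      rw [abs_le]
      constructor <;> omega
    exact_mod_cast this
  have hLlamR : L * ‖lam‖ * R ≤ (55 * W : ℕ) := by
    have e1 : (R : ℝ) = 44000 * L * h₂ + r * (44000 * L * h₁) := by
      rw [hR, hS, hT]; push_cast; ring
    have e2 : ((55 * W : ℕ) : ℝ) = 220000 * L ^ 2 * h₁ * h₂ := by
      rw [hW]; push_cast; ring
    rw [e1, e2]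
    have e3 : L * ‖lam‖ * (44000 * L * h₂ + r * (44000 * L * h₁)) =
      44000 * L ^ 2 * h₂ * ‖lam‖ + 44000 * L ^ 2 * h₁ * (r * ‖lam‖) := by ring
    rw [e3]
    have e4 : 44000 * (L : ℝ) ^ 2 * h₂ * ‖lam‖ ≤ 44000 * (L : ℝ) ^ 2 * h₂ * h₁ := by gcongr
    have e5 : 44000 * (L : ℝ) ^ 2 * h₁ * (r * ‖lam‖) ≤ 44000 * (L : ℝ) ^ 2 * h₁ * (4 * h₂) := by
      gcongr
    linarith
  have hθ' : ‖θ‖ * 3 ^ ((ρ + 3) * n) ≤ 1 := by rw [hn']; exact hθ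
  have hLTθ : ∀ l < L, ∀ t < T, ‖(l * t * θ : ℂ)‖ ≤ L * T * ‖θ‖ := by
    intro l hl t ht
    rw [norm_mul, norm_mul, Complex.norm_natCast, Complex.norm_natCast]
    gcongr
  have h2LT' : (2 * (L * T) : ℝ) ≤ 3 ^ (2 * ρ) := by exact_mod_cast h2LT
  have hLTθ1 : L * T * ‖θ‖ ≤ 1 := by
    refine le_trans ?_ hθ'
    rw [mul_comm ‖θ‖]
    refine mul_le_mul_of_nonneg_right ?_ (norm_nonneg _)
    have : (3 : ℝ) ^ (2 * ρ) ≤ 3 ^ ((ρ + 3) * n) := by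
      refine pow_le_pow_right₀ h31 ?_
      have : 4000 ≤ n := by omega
      nlinarith
    have h0 : (0 : ℝ) ≤ L * T := by positivity
    linarith
  set ε : ℝ := 3 ^ (u + 55 * W) * ‖θ‖ with hε
  have hHF : ∀ s < S, ∀ t < T, ‖H s t - F ((s : ℤ) - r * t : ℤ)‖ ≤ ε := by
    intro s hs t ht
    have h1 : H s t - F ((s : ℤ) - r * t : ℤ) = ∑ j : Fin L × Fin K, (p j : ℂ) *
        ((((s : ℤ) - r * t : ℤ) : ℂ) ^ (j.2 : ℕ) *
        (Complex.exp ((j.1 : ℕ) * (lam * ((s : ℤ) - r * t : ℤ))) *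
        (Complex.exp ((j.1 : ℕ) * t * θ) - 1))) := by
      simp only [H, F, ← Finset.sum_sub_distrib]
      refine Finset.sum_congr rfl fun j _ => ?_
      ring
    rw [h1]
    refine (norm_sum_int_mul_le p _
      (C := 3 ^ (ρ * K) * (3 ^ (55 * W) * (3 ^ (2 * ρ) * ‖θ‖))) hpP (fun j => ?_) hP0).trans ?_
    · rw [norm_mul, norm_mul, norm_pow]
      have g1 : ‖(((s : ℤ) - r * t : ℤ) : ℂ)‖ ^ (j.2 : ℕ) ≤ 3 ^ (ρ * K) :=
        ((pow_le_pow_left₀ (norm_nonneg _) (hzR s hs t ht) _).trans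
          (pow_le_pow_right₀ (by exact_mod_cast hR1) j.2.2.le)).trans hR3
      have g2 : ‖Complex.exp ((j.1 : ℕ) * (lam * ((s : ℤ) - r * t : ℤ)))‖ ≤ 3 ^ (55 * W) := by
        refine (Complex.norm_exp_le_exp_norm _).trans (exp_le_three_pow (le_trans ?_ hLlamR))
        rw [norm_mul, norm_mul, Complex.norm_natCast, mul_assoc]
        have : ((j.1 : ℕ) : ℝ) ≤ L := by exact_mod_cast j.1.2.le
        have := hzR s hs t ht
        gcongr
      have g3 : ‖Complex.exp ((j.1 : ℕ) * t * θ) - 1‖ ≤ 3 ^ (2 * ρ) * ‖θ‖ := by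
        have g4 := hLTθ j.1 j.1.2 t ht
        refine (norm_exp_sub_one_le_two_mul (g4.trans hLTθ1)).trans ?_
        calc 2 * ‖((j.1 : ℕ) * t * θ : ℂ)‖ ≤ 2 * (L * T * ‖θ‖) := by gcongr
          _ = (2 * (L * T)) * ‖θ‖ := by ring
          _ ≤ 3 ^ (2 * ρ) * ‖θ‖ := by gcongr
      gcongr
    · calc _ ≤ (3 : ℝ) ^ (4 * ρ + ρ * K + 2 * W) *
            (3 ^ (ρ * K) * (3 ^ (55 * W) * (3 ^ (2 * ρ) * ‖θ‖))) := by gcongr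
        _ = 3 ^ (4 * ρ + ρ * K + 2 * W + (ρ * K) + 55 * W + 2 * ρ) * ‖θ‖ := by
            simp only [pow_add]; ring
        _ ≤ ε := by
            rw [hε]
            exact mul_le_mul_of_nonneg_right (pow_le_pow_right₀ h31 (by omega)) (norm_nonneg _)
  have hE0 : ∀ s < S₀, ∀ t < T₀, H s t = 0 := by
    intro s hs t ht
    have h1 := hpz (⟨s, hs⟩, ⟨t, ht⟩)
    have h2 := hEH s t
    simp only [E] at h2
    simp only at h1
    rw [h1, map_zero] at h2
    exact (mul_eq_zero.mp h2.symm).resolve_left (pow_ne_zero _ hν0)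
  have hkey : 24 * u + 508 * W < n := by
    have h1 : ρ * K * 20000 ≤ 96 * n := by
      rw [← hLK]
      calc ρ * K * 20000 = (20000 * ρ) * K := by ring
        _ ≤ L * K := Nat.mul_le_mul_right K hL
    omega
  have hεn : ε * 3 ^ (2 * ρ + ρ * n + n) ≤ 1 := by
    refine le_trans ?_ hθ'
    rw [hε]
    have h1 : (3 : ℝ) ^ (u + 55 * W) * ‖θ‖ * 3 ^ (2 * ρ + ρ * n + n) =
      ‖θ‖ * 3 ^ ((u + 55 * W) + (2 * ρ + ρ * n + n)) := by rw [pow_add]; ring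
    rw [h1]
    refine mul_le_mul_of_nonneg_left (pow_le_pow_right₀ h31 ?_) (norm_nonneg _)
    have : (ρ + 3) * n = ρ * n + 3 * n := by ring
    omega
  have hSr : 10 * S₀ ≤ r := by
    refine le_trans (le_of_eq ?_) hr
    rw [hS₀]; ring
  set Z : Finset ℂ := (Finset.range S₀ ×ˢ Finset.range T₀).image
    fun x : ℕ × ℕ => (((x.1 : ℤ) - r * x.2 : ℤ) : ℂ) with hZ
  have hZcard : Z.card = n := by
    rw [hZ, Finset.card_image_of_injOn, Finset.card_product, Finset.card_range, Finset.card_range,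
      hn]
    intro x hx y hy hxy
    rw [Finset.coe_product] at hx hy
    exact sub_mul_injOn (r := r) (S := S₀) (T := T₀) (by omega) hx hy (Int.cast_injective hxy)
  have hZmem : ∀ z ∈ Z, ∃ s < S₀, ∃ t < T₀, z = ((s : ℤ) - r * t : ℤ) := by
    intro z hz
    simp only [hZ, Finset.mem_image, Finset.mem_product, Finset.mem_range, Prod.exists] at hz
    obtain ⟨s, t, ⟨hs, ht⟩, rfl⟩ := hz
    exact ⟨s, hs, t, ht, rfl⟩
  have hH0 : ∀ s < S, ∀ t < T, H s t = 0 := by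
    intro s hs t ht
    by_contra hne
    have hFsmall := exp_poly_extrapolate p (fun j => (j.2 : ℕ)) (fun j => (j.1 : ℕ))
      (K := K) (L := L) (fun j => j.2.2.le) (fun j => j.1.2.le) hR1 hρ hpP hP0 hLlamR
      (m := u)
      (by
        refine (mul_le_mul_of_nonneg_right hNP (by positivity)).trans ?_
        rw [← pow_add]
        exact pow_le_pow_right₀ h31 (by omega))
      hZcard hnρ
      (fun z hz => by
        obtain ⟨s, hs, t, ht, rfl⟩ := hZmem z hz
        exact hzR s (by omega) t (by omega))
      (fun z hz z' hz' hne => by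
        obtain ⟨s, hs, t, ht, rfl⟩ := hZmem z hz
        obtain ⟨s', hs', t', ht', rfl⟩ := hZmem z' hz'
        rw [← Int.cast_sub, Complex.norm_intCast, ← Int.cast_abs]
        have : (((s : ℤ) - r * t : ℤ)) - (((s' : ℤ) - r * t' : ℤ)) ≠ 0 := by
          intro h
          exact hne (by rw [sub_eq_zero.mp h])
        exact_mod_cast Int.one_le_abs this)
      (ε := ε) (by positivity) hεn
      (fun z hz => by
        obtain ⟨s, hs, t, ht, rfl⟩ := hZmem z hz
        have h1 := hHF s (by omega) t (by omega)
        rw [hE0 s hs t ht, zero_sub, norm_neg] at h1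
        exact h1)
      (hzR s hs t ht)
    have hEne : E s t ≠ 0 := by
      intro h
      have h2 := hEH s t
      rw [h, map_zero] at h2
      exact mul_ne_zero (pow_ne_zero _ hν0) hne h2.symm
    have hLiou : 1 ≤ ‖σ i₀ (E s t)‖ * 3 ^ (23 * u) := by
      refine (hA _ hEne).trans ?_
      rw [← Finset.mul_prod_erase _ _ (Finset.mem_univ i₀)]
      refine mul_le_mul_of_nonneg_left ?_ (norm_nonneg _)
      refine (Finset.prod_le_prod (fun _ _ => norm_nonneg _)
        fun i _ => hEb i s hs t ht).trans ?_
      rw [Finset.prod_const, ← pow_mul]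
      refine pow_le_pow_right₀ h31 ?_
      rw [mul_comm]
      refine Nat.mul_le_mul_right u ?_
      rw [Finset.card_erase_of_mem (Finset.mem_univ _), Finset.card_univ]
      omega
    have hHs : ‖H s t‖ * 3 ^ n ≤ 3 ^ (u + 497 * W) := by
      have h1 := hHF s hs t ht
      have h2 : ‖H s t‖ ≤ ‖F ((s : ℤ) - r * t : ℤ)‖ + ε := by
        have := norm_add_le (H s t - F ((s : ℤ) - r * t : ℤ)) (F ((s : ℤ) - r * t : ℤ))
        rw [sub_add_cancel] at this
        linarith
      have h3 : ε * 3 ^ n ≤ 1 := by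
        refine le_trans ?_ hεn
        exact mul_le_mul_of_nonneg_left (pow_le_pow_right₀ h31 (by omega)) (by positivity)
      have h4 : (1 : ℝ) ≤ 3 ^ (u + 9 * (55 * W)) := one_le_pow₀ h31
      calc ‖H s t‖ * 3 ^ n ≤ (‖F ((s : ℤ) - r * t : ℤ)‖ + ε) * 3 ^ n := by gcongr
        _ = ‖F ((s : ℤ) - r * t : ℤ)‖ * 3 ^ n + ε * 3 ^ n := by ring
        _ ≤ (3 ^ (u + 9 * (55 * W)) + 2) + 1 := add_le_add hFsmall h3
        _ ≤ 3 ^ (u + 9 * (55 * W)) * 3 ^ 2 := by linarith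
        _ = 3 ^ (u + 9 * (55 * W) + 2) := by rw [← pow_add]
        _ ≤ 3 ^ (u + 497 * W) := pow_le_pow_right₀ h31 (by omega)
    have hνb : ‖σ i₀ ν ^ ((L - 1) * t)‖ ≤ 3 ^ (11 * W) := by
      rw [norm_pow]
      refine (pow_le_pow_left₀ (norm_nonneg _) (hν i₀) _).trans ?_
      rw [← pow_mul]
      refine pow_le_pow_right₀ h31 ?_
      calc h₂ * ((L - 1) * t) ≤ h₂ * (L * T) :=
            Nat.mul_le_mul_left _ (Nat.mul_le_mul (Nat.sub_le L 1) ht.le)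
        _ = 11 * W := by rw [hT, hW]; ring
    have hfin : (3 : ℝ) ^ n ≤ 3 ^ (24 * u + 508 * W) := by
      calc (3 : ℝ) ^ n ≤ (‖σ i₀ (E s t)‖ * 3 ^ (23 * u)) * 3 ^ n :=
            le_mul_of_one_le_left (by positivity) hLiou
        _ = ‖σ i₀ ν ^ ((L - 1) * t)‖ * (‖H s t‖ * 3 ^ n) * 3 ^ (23 * u) := by
            rw [hEH, norm_mul]; ring
        _ ≤ 3 ^ (11 * W) * 3 ^ (u + 497 * W) * 3 ^ (23 * u) := by gcongr
        _ = 3 ^ (24 * u + 508 * W) := by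
            rw [← pow_add, ← pow_add]
            congr 1
            ring
    have := (pow_le_pow_iff_right₀ (by norm_num : (1 : ℝ) < 3)).mp hfin
    omega
  -- the zero estimate
  let q : ℕ → Polynomial ℂ := fun l => ∑ k : Fin K,
    Polynomial.C (if h : l < L then ((p (⟨l, h⟩, k) : ℤ) : ℂ) else 0) * Polynomial.X ^ (k : ℕ)
  have hq0 := exponential_polynomial_zero_estimate (α := σ i₀ α)
    (β := Complex.exp (-(r * lam) + θ)) (by rw [hexp]; exact Complex.exp_ne_zero _)
    (Complex.exp_ne_zero _) hinj (K := K) (L := L) (S := 10 * S₀) (T := T) hSr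
    (by
      have : 10 * S₀ * T = 110 * n := by rw [hT1, hn]; ring
      omega) q
    (fun l _ => Polynomial.natDegree_sum_le_of_forall_le _ _ fun k _ =>
      (Polynomial.natDegree_C_mul_X_pow_le _ _).trans k.2.le)
    (fun s hs t ht => by
      have h1 := hH0 s (by omega) t ht
      rw [← h1]
      simp only [H, Fintype.sum_prod_type]
      rw [Finset.sum_range]
      refine Finset.sum_congr rfl fun l _ => ?_
      simp only [q, Polynomial.eval_finsetSum, Finset.sum_mul, l.2, dif_pos, Fin.eta,
        Polynomial.eval_mul, Polynomial.eval_C, Polynomial.eval_pow, Polynomial.eval_X]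
      refine Finset.sum_congr rfl fun k _ => ?_
      rw [hexp, mul_pow, ← Complex.exp_nat_mul, ← Complex.exp_nat_mul, ← pow_mul,
        ← Complex.exp_nat_mul, ← Complex.exp_add, mul_assoc, mul_assoc, ← Complex.exp_add]
      push_cast
      congr 3
      ring)
  apply hp0
  funext j
  obtain ⟨l, k⟩ := j
  have h1 := congrArg (fun f => Polynomial.coeff f (k : ℕ)) (hq0 l l.2)
  simp only [q, Polynomial.finsetSum_coeff, Polynomial.coeff_C_mul, Polynomial.coeff_X_pow,
    Polynomial.coeff_zero, l.2, dif_pos, Fin.eta] at h1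
  rw [Finset.sum_eq_single k] at h1
  · simpa using h1
  · intro b _ hb
    rw [if_neg, mul_zero]
    exact fun h => hb (Fin.ext h.symm)
  · simp

open NumberField in
/-- The Minkowski bound for the ring of integers, with an explicit volume condition. -/
lemma exists_ringOfIntegers_lt_of_discr_lt (K : Type*) [Field K] [NumberField K]
    (f : InfinitePlace K → NNReal)
    (h : (|discr K| : ℝ) < (∏ w, (f w : ℝ) ^ w.mult) ^ 2) :
    ∃ a : 𝓞 K, a ≠ 0 ∧ ∀ w : InfinitePlace K, w a < f w := by
  classical
  apply mixedEmbedding.exists_ne_zero_mem_ringOfIntegers_lt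
  rw [mixedEmbedding.convexBodyLT_volume, mixedEmbedding.minkowskiBound,
    mixedEmbedding.volume_fundamentalDomain_fractionalIdealLatticeBasis,
    mixedEmbedding.volume_fundamentalDomain_latticeBasis, mixedEmbedding.finrank,
    Units.val_one, FractionalIdeal.absNorm_one, Rat.cast_one, ENNReal.ofReal_one, one_mul,
    ← InfinitePlace.card_add_two_mul_card_eq_rank K]
  set c := InfinitePlace.nrComplexPlaces K
  set ρ := InfinitePlace.nrRealPlaces K
  have h2 : ((2 : ENNReal)⁻¹ ^ c * (NNReal.sqrt ‖discr K‖₊ : ENNReal)) * 2 ^ (ρ + 2 * c) =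
      ((2 ^ ρ * 2 ^ c * NNReal.sqrt ‖discr K‖₊ : NNReal) : ENNReal) := by
    have h3 : (2 : ENNReal)⁻¹ ^ c * 2 ^ c = 1 := by
      rw [← mul_pow, ENNReal.inv_mul_cancel (by norm_num) (by norm_num), one_pow]
    push_cast
    calc _ = ((2 : ENNReal)⁻¹ ^ c * 2 ^ c) * (2 ^ ρ * 2 ^ c * (NNReal.sqrt ‖discr K‖₊ : ENNReal)) := by
          rw [pow_add, two_mul c, pow_add]; ring
      _ = _ := by rw [h3, one_mul]
  rw [h2, ← ENNReal.coe_mul, ENNReal.coe_lt_coe, mixedEmbedding.convexBodyLTFactor]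
  have h4 : NNReal.sqrt ‖discr K‖₊ < ∏ w, f w ^ w.mult := by
    rw [← NNReal.sqrt_sq (∏ w, f w ^ w.mult), NNReal.sqrt_lt_sqrt, ← NNReal.coe_lt_coe]
    push_cast
    rwa [Int.norm_eq_abs]
  have h5 : (2 : NNReal) ^ c ≤ NNReal.pi ^ c :=
    pow_le_pow_left' (by exact_mod_cast Real.two_le_pi) c
  calc (2 : NNReal) ^ ρ * 2 ^ c * NNReal.sqrt ‖discr K‖₊ < 2 ^ ρ * 2 ^ c * ∏ w, f w ^ w.mult :=
        mul_lt_mul_of_pos_left h4 (by positivity)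
    _ ≤ 2 ^ ρ * NNReal.pi ^ c * ∏ w, f w ^ w.mult := by gcongr

/-- Two complex numbers in the same cell of a grid are close. -/
lemma norm_sub_le_of_floor_eq {u v : ℂ} {g : ℝ} (hg : 0 < g) (hre : ⌊g * u.re⌋ = ⌊g * v.re⌋)
    (him : ⌊g * u.im⌋ = ⌊g * v.im⌋) : ‖u - v‖ ≤ 2 / g := by
  have h1 := Int.abs_sub_lt_one_of_floor_eq_floor hre
  have h2 := Int.abs_sub_lt_one_of_floor_eq_floor him
  rw [← mul_sub, abs_mul, abs_of_pos hg] at h1 h2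
  have h3 := Complex.norm_le_abs_re_add_abs_im (u - v)
  rw [Complex.sub_re, Complex.sub_im] at h3
  rw [le_div_iff₀ hg]
  nlinarith

open NumberField in
/-- Two algebraic integers with the same norm `m` which are congruent modulo `m` are
associated. -/
lemma associated_of_absNorm_eq_of_dvd {K : Type*} [Field K] [NumberField K] {x y : 𝓞 K}
    (h : (Algebra.norm ℤ x).natAbs = (Algebra.norm ℤ y).natAbs)
    (hxy : ((Algebra.norm ℤ x).natAbs : 𝓞 K) ∣ x - y) : Associated y x := by
  have key : ∀ z : 𝓞 K, z ∣ ((Algebra.norm ℤ z).natAbs : 𝓞 K) := fun z => by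
    rw [← Ideal.mem_span_singleton, ← Ideal.absNorm_span_singleton]
    exact Ideal.absNorm_mem _
  refine associated_of_dvd_dvd ?_ ?_
  · have := (dvd_add_left (dvd_refl y)).mpr (((key y).trans (by rw [h])).trans hxy)
    simpa using this
  · have := ((key x).trans hxy)
    exact (dvd_sub_right (dvd_refl x)).mp this

section

open NumberField

lemma prod_norm_embeddings (K : Type*) [Field K] [NumberField K] (x : 𝓞 K) :
    ∏ φ : K →+* ℂ, ‖φ x‖ = (Algebra.norm ℤ x).natAbs := by
  have h := congrArg (‖·‖) (Algebra.norm_eq_prod_embeddings ℚ ℂ (x : K))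
  simp only [norm_prod] at h
  rw [← Fintype.prod_equiv (RingHom.equivRatAlgHom K ℂ) (fun f => ‖f x‖)
      (fun φ => ‖φ x‖) fun _ => by simp [RingHom.equivRatAlgHom_apply]] at h
  rw [← h, ← Algebra.coe_norm_int, Nat.cast_natAbs]
  simp

lemma one_le_prod_norm_embeddings (K : Type*) [Field K] [NumberField K] {x : 𝓞 K} (hx : x ≠ 0) :
    1 ≤ ∏ φ : K →+* ℂ, ‖φ x‖ := by
  rw [prod_norm_embeddings]
  exact_mod_cast Int.natAbs_pos.mpr (Algebra.norm_ne_zero_iff.mpr hx)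

/-- An algebraic integer whose conjugates are bounded by fractional powers of those of `δ`. -/
lemma exists_ringOfIntegers_le_rpow (K : Type*) [Field K] [NumberField K]
    (hK : Module.finrank ℚ K = 4) {N : ℕ} (hd : |discr K| ≤ N) {δ : 𝓞 K} (hδ0 : δ ≠ 0) {s : ℝ}
    (hs : 0 ≤ s) :
    ∃ x : 𝓞 K, x ≠ 0 ∧ ∀ φ : K →+* ℂ, ‖φ x‖ ≤ (N + 1) * ‖φ δ‖ ^ s := by
  have hw : ∀ w : InfinitePlace K, 0 ≤ (N + 1 : ℝ) * w δ ^ s := fun w => by positivity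
  obtain ⟨x, hx0, hx⟩ := exists_ringOfIntegers_lt_of_discr_lt K (fun w => Real.toNNReal ((N + 1 : ℝ) * w δ ^ s)) (by
    simp only [Real.coe_toNNReal _ (hw _), mul_pow, Finset.prod_mul_distrib, Finset.prod_pow_eq_pow_sum,
      InfinitePlace.sum_mult_eq, hK]
    have h1 : ∏ w : InfinitePlace K, (w δ ^ s) ^ w.mult = |(Algebra.norm ℚ (δ : K) : ℝ)| ^ s := by
      rw [← Rat.cast_abs, ← InfinitePlace.prod_eq_abs_norm,
        ← Real.finsetProd_rpow _ _ fun w _ => by positivity]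
      refine Finset.prod_congr rfl fun w _ => ?_
      rw [← Real.rpow_natCast, ← Real.rpow_natCast, ← Real.rpow_mul (by positivity),
        ← Real.rpow_mul (by positivity), mul_comm]
    have h2 : (1 : ℝ) ≤ |(Algebra.norm ℚ (δ : K) : ℝ)| := by
      rw [← Algebra.coe_norm_int]
      have : Algebra.norm ℤ δ ≠ 0 := Algebra.norm_ne_zero_iff.mpr hδ0
      exact_mod_cast Int.one_le_abs this
    rw [h1]
    have h3 := Real.one_le_rpow h2 hs
    have h4 : (|discr K| : ℝ) ≤ N := by exact_mod_cast hd
    have hN0 : (0 : ℝ) ≤ N := Nat.cast_nonneg N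
    have h5 : (N + 1 : ℝ) ≤ ((N + 1) ^ 4) ^ 2 := by
      rw [← pow_mul]
      exact le_self_pow₀ (by linarith) (by norm_num)
    calc (|discr K| : ℝ) < N + 1 := by linarith
      _ ≤ ((N + 1) ^ 4) ^ 2 * 1 := by linarith
      _ ≤ ((N + 1) ^ 4) ^ 2 * (|(Algebra.norm ℚ (δ : K) : ℝ)| ^ s) ^ 2 := by
          gcongr
          exact one_le_pow₀ h3)
  refine ⟨x, hx0, fun φ => ?_⟩
  have := (hx (InfinitePlace.mk φ)).le
  rwa [Real.coe_toNNReal _ (hw _), InfinitePlace.apply, InfinitePlace.apply] at this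

/-- If the numbers `y i` are at most `M` and their product is at least `1 / N`, then each one is
bounded below. -/
lemma one_le_mul_of_prod {ι : Type*} [Fintype ι] (hι : Fintype.card ι = 4) {y : ι → ℝ} {M N : ℝ}
    (hy0 : ∀ i, 0 ≤ y i) (hyM : ∀ i, y i ≤ M) (hN : 0 ≤ N) (h : 1 ≤ (∏ i, y i) * N) (i : ι) :
    1 ≤ y i * (M ^ 3 * N) := by
  classical
  refine h.trans ?_
  rw [← Finset.mul_prod_erase _ _ (Finset.mem_univ i), mul_assoc]
  refine mul_le_mul_of_nonneg_left (mul_le_mul_of_nonneg_right ?_ hN) (hy0 i)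
  refine (Finset.prod_le_prod (fun j _ => hy0 j) fun j _ => hyM j).trans (le_of_eq ?_)
  rw [Finset.prod_const, Finset.card_erase_of_mem (Finset.mem_univ _), Finset.card_univ, hι]

end

section

open NumberField

lemma natAbs_pigeonhole_card_le {M Q : ℕ} (hM : 1 ≤ M) (hQ : 1 ≤ Q) :
    (M ^ 5 + 1) * (M ^ 5 + 1) ^ 4 * ((2 * (2 * Q * M ^ 4 * M) + 1) ^ 2) ^ 4 ≤
      10 ^ 8 * Q ^ 8 * M ^ 65 := by
  have h1 : 1 ≤ M ^ 5 := Nat.one_le_pow _ _ hM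
  have h2 : 1 ≤ Q * M ^ 5 := Nat.mul_pos hQ h1
  calc (M ^ 5 + 1) * (M ^ 5 + 1) ^ 4 * ((2 * (2 * Q * M ^ 4 * M) + 1) ^ 2) ^ 4
      = (M ^ 5 + 1) ^ 5 * (4 * (Q * M ^ 5) + 1) ^ 8 := by ring
    _ ≤ (2 * M ^ 5) ^ 5 * (5 * (Q * M ^ 5)) ^ 8 := by
        gcongr
        · omega
        · omega
    _ = 12500000 * (Q ^ 8 * M ^ 65) := by ring
    _ ≤ 10 ^ 8 * (Q ^ 8 * M ^ 65) := by gcongr; norm_num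
    _ = _ := by ring

set_option maxHeartbeats 1000000 in
/-- A unit all of whose conjugates are close in absolute value to a fractional power of the
conjugates of `δ`. -/
theorem exists_unit_near_rpow (K : Type*) [Field K] [NumberField K]
    (hK : Module.finrank ℚ K = 4) {N Q B : ℕ} (hQ : 1 ≤ Q) (hd : |discr K| ≤ N) {δ : 𝓞 K}
    (hδ0 : δ ≠ 0) (hδ : (Algebra.norm ℤ δ).natAbs ≤ N)
    (hB : 10 ^ 8 * Q ^ 8 * (N + 1) ^ 65 ≤ B) :
    ∃ b : ℕ, 1 ≤ b ∧ b ≤ 10 ^ 8 * Q ^ 8 * (N + 1) ^ 65 ∧ ∃ ξ : (𝓞 K)ˣ, ∀ φ : K →+* ℂ,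
      ‖φ (ξ : 𝓞 K) - ((‖φ δ‖ ^ ((b : ℝ) / B) : ℝ) : ℂ)‖ * Q ≤ ‖φ δ‖ ^ ((b : ℝ) / B) := by
  classical
  set M := N + 1 with hM
  set N₀ := 10 ^ 8 * Q ^ 8 * M ^ 65 with hN₀
  have hN₀1 : 1 ≤ N₀ := Nat.mul_pos (Nat.mul_pos (by norm_num) (Nat.pow_pos hQ))
    (Nat.pow_pos (by omega))
  clear_value N₀ M
  have hM0 : 0 < M := by omega
  have hQ0 : 0 < Q := hQ
  have hB0 : (0 : ℝ) < B := by exact_mod_cast lt_of_lt_of_le hN₀1 hB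
  have hNδ1 : 1 ≤ (Algebra.norm ℤ δ).natAbs :=
    Int.natAbs_pos.mpr (Algebra.norm_ne_zero_iff.mpr hδ0)
  have hN1 : (1 : ℝ) ≤ N := by exact_mod_cast hNδ1.trans hδ
  have hMR : (M : ℝ) = N + 1 := by rw [hM]; push_cast; ring
  have hcard : Fintype.card (K →+* ℂ) = 4 := by rw [Embeddings.card, hK]
  have hδφ : ∀ φ : K →+* ℂ, 0 < ‖φ δ‖ := fun φ => by
    rw [norm_pos_iff, map_ne_zero]
    exact_mod_cast hδ0
  choose x hx0 hx using fun q : ℕ => exists_ringOfIntegers_le_rpow K hK hd hδ0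
    (s := (q : ℝ) / B) (by positivity)
  let e : ℕ → (K →+* ℂ) → ℝ := fun q φ => ‖φ δ‖ ^ ((q : ℝ) / B)
  have he : ∀ q φ, 0 < e q φ := fun q φ => Real.rpow_pos_of_pos (hδφ φ) _
  let u : ℕ → (K →+* ℂ) → ℂ := fun q φ => φ (x q) / (e q φ : ℂ)
  have hue : ∀ q φ, φ (x q) = u q φ * (e q φ : ℂ) := fun q φ => by
    have : (e q φ : ℂ) ≠ 0 := by exact_mod_cast (he q φ).ne'
    simp only [u]
    field_simp
  have hun : ∀ q φ, ‖u q φ‖ = ‖φ (x q)‖ / e q φ := fun q φ => by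
    simp only [u, norm_div, Complex.norm_real, Real.norm_of_nonneg (he q φ).le]
  have huM : ∀ q φ, ‖u q φ‖ ≤ M := fun q φ => by
    rw [hun, div_le_iff₀ (he q φ), hMR]
    exact hx q φ
  have hprod : ∀ q, (∏ φ, ‖u q φ‖) * ((Algebra.norm ℤ δ).natAbs : ℝ) ^ ((q : ℝ) / B) =
      (Algebra.norm ℤ (x q)).natAbs := fun q => by
    simp only [hun, Finset.prod_div_distrib, prod_norm_embeddings]
    have : ∏ φ, e q φ = ((Algebra.norm ℤ δ).natAbs : ℝ) ^ ((q : ℝ) / B) := by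
      rw [← prod_norm_embeddings, ← Real.finsetProd_rpow _ _ fun φ _ => (hδφ φ).le]
    rw [this]
    have : (0 : ℝ) < ((Algebra.norm ℤ δ).natAbs : ℝ) ^ ((q : ℝ) / B) :=
      Real.rpow_pos_of_pos (by exact_mod_cast hNδ1) _
    field_simp
  have hNδs : ∀ q ≤ N₀, ((Algebra.norm ℤ δ).natAbs : ℝ) ^ ((q : ℝ) / B) ≤ N := fun q hq => by
    have h1 : (1 : ℝ) ≤ (Algebra.norm ℤ δ).natAbs := by exact_mod_cast hNδ1
    have h2 : (q : ℝ) / B ≤ 1 := by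
      rw [div_le_one hB0]
      exact_mod_cast hq.trans hB
    refine (Real.rpow_le_rpow_of_exponent_le h1 h2).trans ?_
    rw [Real.rpow_one]
    exact_mod_cast hδ
  have hxn1 : ∀ q, 1 ≤ (Algebra.norm ℤ (x q)).natAbs := fun q =>
    Int.natAbs_pos.mpr (Algebra.norm_ne_zero_iff.mpr (hx0 q))
  have hP0 : ∀ q, 0 ≤ ∏ φ, ‖u q φ‖ := fun q => Finset.prod_nonneg fun _ _ => norm_nonneg _
  have hxnM : ∀ q ≤ N₀, (Algebra.norm ℤ (x q)).natAbs ≤ M ^ 5 := fun q hq => by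
    have : ((Algebra.norm ℤ (x q)).natAbs : ℝ) ≤ M ^ 5 := by
      rw [← hprod]
      calc _ ≤ (M : ℝ) ^ 4 * N := by
            refine mul_le_mul ?_ (hNδs q hq) (by positivity) (by positivity)
            refine (Finset.prod_le_prod (fun _ _ => norm_nonneg _) fun φ _ => huM q φ).trans ?_
            rw [Finset.prod_const, Finset.card_univ, hcard]
        _ ≤ (M : ℝ) ^ 4 * M := by
            have : (N : ℝ) ≤ M := by linarith
            gcongr
        _ = M ^ 5 := by ring
    exact_mod_cast this
  have hulow : ∀ q ≤ N₀, ∀ φ, 1 ≤ ‖u q φ‖ * M ^ 4 := fun q hq φ => by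
    have := one_le_mul_of_prod hcard (y := fun φ => ‖u q φ‖) (M := M) (N := N)
      (fun _ => norm_nonneg _) (huM q) (by linarith) (by
        refine le_trans ?_ (mul_le_mul_of_nonneg_left (hNδs q hq) (hP0 q))
        rw [hprod]
        exact_mod_cast hxn1 q) φ
    refine this.trans (mul_le_mul_of_nonneg_left ?_ (norm_nonneg _))
    rw [pow_succ (M : ℝ) 3]
    exact mul_le_mul_of_nonneg_left (by linarith) (by positivity)
  -- the pigeonhole principle
  set g := 2 * Q * M ^ 4 with hg
  have hg0 : (0 : ℝ) < g := by
    have : 0 < g := Nat.mul_pos (by omega) (Nat.pow_pos (by omega))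
    exact_mod_cast this
  have hfloor : ∀ t : ℝ, |t| ≤ M → ⌊g * t⌋ ∈ Finset.Icc (-(g * M : ℕ) : ℤ) (g * M : ℕ) := by
    intro t ht
    rw [abs_le] at ht
    rw [Finset.mem_Icc]
    constructor
    · rw [Int.le_floor]
      push_cast
      nlinarith
    · have h1 : ((⌊g * t⌋ : ℤ) : ℝ) ≤ ((g * M : ℕ) : ℤ) := by
        refine (Int.floor_le _).trans ?_
        push_cast
        exact mul_le_mul_of_nonneg_left ht.2 hg0.le
      exact_mod_cast h1
  let I := Module.Free.ChooseBasisIndex ℤ (𝓞 K)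
  have hI : Fintype.card I = 4 := by
    rw [← Module.finrank_eq_card_chooseBasisIndex, RingOfIntegers.rank, hK]
  let m : ℕ → ℕ := fun q => (Algebra.norm ℤ (x q)).natAbs
  let t : Finset (ℕ × (I → ℕ) × ((K →+* ℂ) → ℤ × ℤ)) :=
    Finset.range (M ^ 5 + 1) ×ˢ (Fintype.piFinset fun _ => Finset.range (M ^ 5 + 1)) ×ˢ
      (Fintype.piFinset fun _ => Finset.Icc (-(g * M : ℕ) : ℤ) (g * M : ℕ) ×ˢ
        Finset.Icc (-(g * M : ℕ) : ℤ) (g * M : ℕ))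
  let G : ℕ → ℕ × (I → ℕ) × ((K →+* ℂ) → ℤ × ℤ) := fun q =>
    (m q, fun i => ((RingOfIntegers.basis K).repr (x q) i % m q).natAbs,
      fun φ => (⌊g * (u q φ).re⌋, ⌊g * (u q φ).im⌋))
  have htcard : t.card < (Finset.range (N₀ + 1)).card := by
    have h1 : (Finset.Icc (-(g * M : ℕ) : ℤ) (g * M : ℕ)).card = 2 * (g * M) + 1 := by
      rw [Int.card_Icc]
      omega
    simp only [t, Finset.card_product, Fintype.card_piFinset, Finset.prod_const, Finset.card_univ,
      Finset.card_range, hcard, hI, h1]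
    rw [← mul_assoc, ← pow_two]
    rw [hN₀, hg]
    exact Nat.lt_succ_of_le (natAbs_pigeonhole_card_le (by omega) hQ)
  have hmaps : Set.MapsTo G (Finset.range (N₀ + 1)) t := by
    intro q hq
    have hq' : q ≤ N₀ := by
      rw [Finset.mem_coe, Finset.mem_range] at hq
      omega
    have hmq := hxnM q hq'
    have hm1 := hxn1 q
    simp only [t, G, Finset.coe_product, Set.mem_prod, Finset.mem_coe, Finset.mem_range,
      Fintype.mem_piFinset, Finset.mem_product]
    refine ⟨Nat.lt_succ_of_le hmq, fun i => ?_, fun φ => ⟨hfloor _ ?_, hfloor _ ?_⟩⟩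
    · have hm0 : (0 : ℤ) < m q := by exact_mod_cast hm1
      have h1 := Int.emod_nonneg ((RingOfIntegers.basis K).repr (x q) i) hm0.ne'
      have h2 := Int.emod_lt_of_pos ((RingOfIntegers.basis K).repr (x q) i) hm0
      have : m q ≤ M ^ 5 := hmq
      omega
    · exact (Complex.abs_re_le_norm _).trans (huM q φ)
    · exact (Complex.abs_im_le_norm _).trans (huM q φ)
  obtain ⟨q, q', hq, hq', hlt, hGG⟩ : ∃ q q', q ≤ N₀ ∧ q' ≤ N₀ ∧ q' < q ∧ G q = G q' := by
    obtain ⟨q, hq, q', hq', hne, h⟩ :=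
      Finset.exists_ne_map_eq_of_card_lt_of_maps_to htcard hmaps
    rw [Finset.mem_range, Nat.lt_succ_iff] at hq hq'
    rcases lt_or_gt_of_ne hne with h1 | h1
    · exact ⟨q', q, hq', hq, h1, h.symm⟩
    · exact ⟨q, q', hq, hq', h1, h⟩
  simp only [G, Prod.mk.injEq, funext_iff] at hGG
  obtain ⟨hmm, hcoord, hfl⟩ := hGG
  have hdvd : ((m q : ℕ) : 𝓞 K) ∣ x q - x q' := by
    have h1 : ∀ i, (m q : ℤ) ∣ (RingOfIntegers.basis K).repr (x q) i -
        (RingOfIntegers.basis K).repr (x q') i := by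
      intro i
      have h2 := hcoord i
      have hm0 : (0 : ℤ) < m q := by exact_mod_cast hxn1 q
      rw [← hmm] at h2
      have h3 := Int.emod_nonneg ((RingOfIntegers.basis K).repr (x q) i) hm0.ne'
      have h4 := Int.emod_nonneg ((RingOfIntegers.basis K).repr (x q') i) hm0.ne'
      exact Int.ModEq.dvd (show _ % _ = _ % _ by omega)
    choose c hc using h1
    refine ⟨∑ i, c i • RingOfIntegers.basis K i, ?_⟩
    rw [← (RingOfIntegers.basis K).sum_repr (x q), ← (RingOfIntegers.basis K).sum_repr (x q'),
      ← Finset.sum_sub_distrib, Finset.mul_sum]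
    refine Finset.sum_congr rfl fun i _ => ?_
    rw [← sub_smul, hc i, mul_smul, ← nsmul_eq_mul, natCast_zsmul]
  obtain ⟨ξ, hξ⟩ := associated_of_absNorm_eq_of_dvd hmm hdvd
  refine ⟨q - q', by omega, by omega, ξ, fun φ => ?_⟩
  have hs : ‖φ δ‖ ^ (((q - q' : ℕ) : ℝ) / B) * e q' φ = e q φ := by
    simp only [e]
    rw [← Real.rpow_add (hδφ φ), ← add_div, ← Nat.cast_add, Nat.sub_add_cancel hlt.le]
  set s : ℝ := ‖φ δ‖ ^ (((q - q' : ℕ) : ℝ) / B) with hsdef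
  have hs0 : 0 < s := Real.rpow_pos_of_pos (hδφ φ) _
  have h1 : φ (x q') * φ (ξ : 𝓞 K) = φ (x q) := by
    rw [← map_mul, ← hξ]
    rfl
  have h2 : u q' φ * (φ (ξ : 𝓞 K) - (s : ℂ)) = (u q φ - u q' φ) * s := by
    have h3 : (e q' φ : ℂ) ≠ 0 := by exact_mod_cast (he q' φ).ne'
    rw [hue, hue, ← hs] at h1
    push_cast at h1
    apply mul_right_cancel₀ h3
    linear_combination h1
  have h3 : ‖u q φ - u q' φ‖ ≤ 2 / g :=
    norm_sub_le_of_floor_eq hg0 (hfl φ).1 (hfl φ).2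
  have h4 : 2 / (g : ℝ) * Q * M ^ 4 = 1 := by
    rw [hg]
    have : (M : ℝ) ≠ 0 := by positivity
    have : (Q : ℝ) ≠ 0 := by positivity
    push_cast
    field_simp
  have h5 := hulow q' hq' φ
  have hu0 : 0 < ‖u q' φ‖ := by
    by_contra h
    have : ‖u q' φ‖ = 0 := le_antisymm (not_lt.mp h) (norm_nonneg _)
    rw [this] at h5
    norm_num at h5
  have h6 := congrArg norm h2
  rw [norm_mul, norm_mul, Complex.norm_real, Real.norm_of_nonneg hs0.le] at h6
  have hM4 : (0 : ℝ) < M ^ 4 := by positivity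
  have h7 : ‖u q φ - u q' φ‖ * Q ≤ ‖u q' φ‖ := by
    refine le_of_mul_le_mul_right ?_ hM4
    calc _ ≤ 2 / (g : ℝ) * Q * M ^ 4 := by gcongr
      _ ≤ _ := by rw [h4]; exact h5
  refine le_of_mul_le_mul_left ?_ hu0
  calc _ = (‖u q φ - u q' φ‖ * Q) * s := by rw [← mul_assoc, h6]; ring
    _ ≤ ‖u q' φ‖ * s := by gcongr

end

/-- The derivative at `φ j` of the monic quartic polynomial with roots `φ`. -/
noncomputable def quarticDeriv (φ : Fin 4 → ℂ) (j : Fin 4) : ℂ :=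
  ∏ k ∈ Finset.univ.erase j, (φ j - φ k)

lemma quarticDeriv_zero (φ : Fin 4 → ℂ) :
    quarticDeriv φ 0 = (φ 0 - φ 1) * (φ 0 - φ 2) * (φ 0 - φ 3) := by
  rw [quarticDeriv, show Finset.univ.erase (0 : Fin 4) = {1, 2, 3} by decide]
  simp [Finset.prod_insert, mul_assoc]

lemma quarticDeriv_one (φ : Fin 4 → ℂ) :
    quarticDeriv φ 1 = (φ 1 - φ 0) * (φ 1 - φ 2) * (φ 1 - φ 3) := by
  rw [quarticDeriv, show Finset.univ.erase (1 : Fin 4) = {0, 2, 3} by decide]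
  simp [Finset.prod_insert, mul_assoc]

lemma quarticDeriv_two (φ : Fin 4 → ℂ) :
    quarticDeriv φ 2 = (φ 2 - φ 0) * (φ 2 - φ 1) * (φ 2 - φ 3) := by
  rw [quarticDeriv, show Finset.univ.erase (2 : Fin 4) = {0, 1, 3} by decide]
  simp [Finset.prod_insert, mul_assoc]

lemma quarticDeriv_three (φ : Fin 4 → ℂ) :
    quarticDeriv φ 3 = (φ 3 - φ 0) * (φ 3 - φ 1) * (φ 3 - φ 2) := by
  rw [quarticDeriv, show Finset.univ.erase (3 : Fin 4) = {0, 1, 2} by decide]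
  simp [Finset.prod_insert, mul_assoc]

/-- All products of two differences of four points over disjoint pairs are bounded by `P`. -/
def PairProductsLe (φ : Fin 4 → ℂ) (P : ℝ) : Prop :=
  ∀ e : Equiv.Perm (Fin 4), ‖φ (e 0) - φ (e 1)‖ * ‖φ (e 2) - φ (e 3)‖ ≤ P

/-- The point `φ 0` has distance about `Z` from the three other points, which are very close to
each other. -/
structure IsolatedPoint (φ : Fin 4 → ℂ) (P Z : ℝ) : Prop where
  lower : ∀ j, j ≠ 0 → Z / 2 ≤ ‖φ 0 - φ j‖
  upper : ∀ j, j ≠ 0 → ‖φ 0 - φ j‖ ≤ Z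
  close : ∀ i j, i ≠ 0 → j ≠ 0 → ‖φ i - φ j‖ ≤ 3 * P / Z

lemma PairProductsLe.comp {φ : Fin 4 → ℂ} {P : ℝ} (h : PairProductsLe φ P)
    (e : Equiv.Perm (Fin 4)) : PairProductsLe (φ ∘ e) P := fun e' => h (e'.trans e)

lemma isolatedPoint_of_le {φ : Fin 4 → ℂ} {P Z : ℝ} (hZ0 : 0 < Z) (hP0 : 0 ≤ P) (hPZ : 4 * P ≤ Z ^ 2)
    (h : PairProductsLe φ P) (hmax : ∀ i j, ‖φ i - φ j‖ ≤ Z) (h01 : ‖φ 0 - φ 1‖ = Z)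
    (h02 : Z / 2 ≤ ‖φ 0 - φ 2‖) : IsolatedPoint φ P Z := by
  have h1 := h 1
  have h2 := h (Equiv.swap 1 2)
  have e1 : (Equiv.swap 1 2 : Equiv.Perm (Fin 4)) 0 = 0 := by decide
  have e2 : (Equiv.swap 1 2 : Equiv.Perm (Fin 4)) 1 = 2 := by decide
  have e3 : (Equiv.swap 1 2 : Equiv.Perm (Fin 4)) 2 = 1 := by decide
  have e4 : (Equiv.swap 1 2 : Equiv.Perm (Fin 4)) 3 = 3 := by decide
  rw [e1, e2, e3, e4] at h2
  simp only [Equiv.Perm.coe_one, id_eq] at h1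
  rw [h01] at h1
  have h23 : ‖φ 2 - φ 3‖ ≤ P / Z := by rw [le_div_iff₀ hZ0]; linarith
  have h13 : ‖φ 1 - φ 3‖ ≤ 2 * P / Z := by
    rw [le_div_iff₀ hZ0]
    nlinarith [mul_le_mul_of_nonneg_right h02 (norm_nonneg (φ 1 - φ 3))]
  have h12 : ‖φ 1 - φ 2‖ ≤ 3 * P / Z := by
    have := norm_sub_le (φ 1 - φ 3) (φ 2 - φ 3)
    rw [sub_sub_sub_cancel_right] at this
    calc _ ≤ 2 * P / Z + P / Z := by linarith
      _ = _ := by ring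
  have h03 : Z / 2 ≤ ‖φ 0 - φ 3‖ := by
    have := norm_sub_le (φ 0 - φ 3) (φ 1 - φ 3)
    rw [sub_sub_sub_cancel_right, h01] at this
    have h4 : 2 * P / Z ≤ Z / 2 := by
      rw [div_le_div_iff₀ hZ0 (by norm_num)]
      nlinarith
    linarith
  have hle : 2 * P / Z ≤ 3 * P / Z := by gcongr; norm_num
  have hle' : P / Z ≤ 3 * P / Z := by
    gcongr
    linarith
  have h0 : 0 ≤ 3 * P / Z := by positivity
  refine ⟨fun j hj => ?_, fun j _ => hmax 0 j, fun i j hi hj => ?_⟩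
  · fin_cases j
    · exact absurd rfl hj
    · simp only [Fin.mk_one, h01]
      linarith
    · exact h02
    · exact h03
  · fin_cases i <;> fin_cases j <;>
      first
      | exact absurd rfl hi
      | exact absurd rfl hj
      | simp only [Fin.mk_one, Fin.reduceFinMk, sub_self, norm_zero]
    all_goals
      first
      | linarith
      | (rw [norm_sub_rev]; linarith)

/-- Four points one of whose mutual distances is large: up to a permutation, the first one is
isolated. -/
lemma exists_isolatedPoint {φ : Fin 4 → ℂ} {P Z : ℝ} (hP0 : 0 ≤ P) (hZ0 : 0 < Z)
    (hPZ : 4 * P ≤ Z ^ 2) (h : PairProductsLe φ P) (hmax : ∀ i j, ‖φ i - φ j‖ ≤ Z)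
    (hex : ∃ i j, ‖φ i - φ j‖ = Z) :
    ∃ e : Equiv.Perm (Fin 4), IsolatedPoint (φ ∘ e) P Z := by
  obtain ⟨i, j, hij⟩ := hex
  have hne : i ≠ j := by
    rintro rfl
    rw [sub_self, norm_zero] at hij
    exact hZ0.ne hij
  obtain ⟨e, he0, he1⟩ : ∃ e : Equiv.Perm (Fin 4), e 0 = i ∧ e 1 = j := by
    clear hij
    revert i j
    decide
  have h01 : ‖(φ ∘ e) 0 - (φ ∘ e) 1‖ = Z := by
    simp only [Function.comp, he0, he1, hij]
  rcases le_or_gt (Z / 2) ‖(φ ∘ e) 0 - (φ ∘ e) 2‖ with h02 | h02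
  · exact ⟨e, isolatedPoint_of_le hZ0 hP0 hPZ (h.comp e) (fun _ _ => hmax _ _) h01 h02⟩
  · refine ⟨(Equiv.swap 0 1).trans e, isolatedPoint_of_le hZ0 hP0 hPZ (h.comp _)
      (fun _ _ => hmax _ _) ?_ ?_⟩
    · simpa [norm_sub_rev] using h01
    · have e2 : (Equiv.swap 0 1 : Equiv.Perm (Fin 4)) 2 = 2 := by decide
      have h1 := norm_sub_le ((φ ∘ e) 0 - (φ ∘ e) 2) ((φ ∘ e) 1 - (φ ∘ e) 2)
      rw [sub_sub_sub_cancel_right, h01] at h1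
      simp only [Function.comp, Equiv.trans_apply, Equiv.swap_apply_left, e2] at h1 h02 ⊢
      linarith

lemma prod_norm_quarticDeriv (φ : Fin 4 → ℂ) :
    ∏ j, ‖quarticDeriv φ j‖ = ((‖φ 0 - φ 1‖ * ‖φ 2 - φ 3‖) * (‖φ 0 - φ 2‖ * ‖φ 1 - φ 3‖) *
      (‖φ 0 - φ 3‖ * ‖φ 1 - φ 2‖)) ^ 2 := by
  rw [Fin.prod_univ_four, quarticDeriv_zero, quarticDeriv_one, quarticDeriv_two,
    quarticDeriv_three]
  simp only [norm_mul]
  rw [norm_sub_rev (φ 1) (φ 0), norm_sub_rev (φ 2) (φ 0), norm_sub_rev (φ 3) (φ 0),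
    norm_sub_rev (φ 2) (φ 1), norm_sub_rev (φ 3) (φ 1), norm_sub_rev (φ 3) (φ 2)]
  ring

lemma PairProductsLe.two {φ : Fin 4 → ℂ} {P : ℝ} (h : PairProductsLe φ P) :
    ‖φ 0 - φ 1‖ * ‖φ 2 - φ 3‖ ≤ P ∧ ‖φ 0 - φ 2‖ * ‖φ 1 - φ 3‖ ≤ P ∧
      ‖φ 0 - φ 3‖ * ‖φ 1 - φ 2‖ ≤ P := by
  refine ⟨h 1, ?_, ?_⟩
  · exact h (Equiv.swap 1 2)
  · obtain ⟨e, h0, h1, h2, h3⟩ : ∃ e : Equiv.Perm (Fin 4), e 0 = 0 ∧ e 1 = 3 ∧ e 2 = 1 ∧ e 3 = 2 := by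
      decide
    have := h e
    rwa [h0, h1, h2, h3] at this

lemma prod_norm_quarticDeriv_le {φ : Fin 4 → ℂ} {P : ℝ} (h : PairProductsLe φ P) :
    ∏ j, ‖quarticDeriv φ j‖ ≤ P ^ 6 := by
  rw [prod_norm_quarticDeriv]
  obtain ⟨h1, h2, h3⟩ := h.two
  have hP : 0 ≤ P := le_trans (by positivity) h1
  calc _ ≤ (P * P * P) ^ 2 := by gcongr
    _ = P ^ 6 := by ring

lemma one_le_mul_sq_of_sq {x y z P : ℝ} (hx : 0 ≤ x) (hy : 0 ≤ y) (hz : 0 ≤ z) (hyP : y ≤ P)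
    (hzP : z ≤ P) (h : 1 ≤ (x * y * z) ^ 2) : 1 ≤ x * P ^ 2 := by
  have h1 : 1 ≤ x * y * z := by
    by_contra hlt
    have h0 : 0 ≤ x * y * z := by positivity
    nlinarith
  have hP0 : 0 ≤ P := hy.trans hyP
  calc 1 ≤ x * y * z := h1
    _ ≤ x * P * P := by gcongr
    _ = x * P ^ 2 := by ring

/-- The derivative is small at the roots which are not isolated. -/
lemma IsolatedPoint.norm_quarticDeriv_mul_le {φ : Fin 4 → ℂ} {P Z : ℝ} (hP0 : 0 ≤ P) (hZ0 : 0 < Z)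
    (hZ : IsolatedPoint φ P Z) {j : Fin 4} (hj : j ≠ 0) : ‖quarticDeriv φ j‖ * Z ≤ 9 * P ^ 2 := by
  have key : ∀ {x y z : ℂ}, ‖x‖ ≤ Z → ‖y‖ ≤ 3 * P / Z → ‖z‖ ≤ 3 * P / Z →
      ‖x * y * z‖ * Z ≤ 9 * P ^ 2 := by
    intro x y z hx hy hz
    rw [norm_mul, norm_mul]
    calc ‖x‖ * ‖y‖ * ‖z‖ * Z ≤ Z * (3 * P / Z) * (3 * P / Z) * Z := by gcongr
      _ = 9 * P ^ 2 := by field_simp; ring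
  have hu : ∀ j, j ≠ 0 → ‖φ j - φ 0‖ ≤ Z := fun j hj => by
    rw [norm_sub_rev]
    exact hZ.upper j hj
  fin_cases j
  · exact absurd rfl hj
  · simp only [Fin.mk_one, quarticDeriv_one]
    exact key (hu 1 hj) (hZ.close _ _ hj (by decide)) (hZ.close _ _ hj (by decide))
  · simp only [Fin.reduceFinMk, quarticDeriv_two]
    exact key (hu 2 hj) (hZ.close _ _ hj (by decide)) (hZ.close _ _ hj (by decide))
  · simp only [Fin.reduceFinMk, quarticDeriv_three]
    exact key (hu 3 hj) (hZ.close _ _ hj (by decide)) (hZ.close _ _ hj (by decide))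

/-- Upper and lower bounds for the derivative at the roots. -/
lemma norm_quarticDeriv_bounds {φ : Fin 4 → ℂ} {P Z : ℝ} (hP1 : 1 ≤ P) (hZ0 : 0 < Z)
    (h : PairProductsLe φ P) (hZ : IsolatedPoint φ P Z) (hd : 1 ≤ ∏ j, ‖quarticDeriv φ j‖) :
    (Z / 2) ^ 3 ≤ ‖quarticDeriv φ 0‖ ∧ ‖quarticDeriv φ 0‖ ≤ Z ^ 3 ∧
      ∀ j, j ≠ 0 → 1 ≤ ‖quarticDeriv φ j‖ * (2 * P ^ 4 * Z) ∧ ‖quarticDeriv φ j‖ * Z ≤ 9 * P ^ 2 := by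
  rw [prod_norm_quarticDeriv] at hd
  obtain ⟨h1, h2, h3⟩ := h.two
  have hl := hZ.lower
  have hu := hZ.upper
  have l1 := hl 1 (by decide)
  have l2 := hl 2 (by decide)
  have l3 := hl 3 (by decide)
  have u1 := hu 1 (by decide)
  have u2 := hu 2 (by decide)
  have u3 := hu 3 (by decide)
  have k1 := one_le_mul_sq_of_sq (by positivity) (by positivity) (by positivity) h2 h3 hd
  have k2 := one_le_mul_sq_of_sq (x := ‖φ 0 - φ 2‖ * ‖φ 1 - φ 3‖) (by positivity) (by positivity)
    (by positivity) h1 h3 (by convert hd using 2; ring)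
  have k3 := one_le_mul_sq_of_sq (x := ‖φ 0 - φ 3‖ * ‖φ 1 - φ 2‖) (by positivity) (by positivity)
    (by positivity) h1 h2 (by convert hd using 2; ring)
  have key : ∀ {x y z a b : ℝ}, 0 ≤ y → 0 ≤ z → Z / 2 ≤ x → 0 ≤ a → 0 ≤ b → a ≤ Z →
      b ≤ Z → 1 ≤ a * y * P ^ 2 → 1 ≤ b * z * P ^ 2 → 1 ≤ x * y * z * (2 * P ^ 4 * Z) := by
    intro x y z a b hy hz hx ha hb haZ hbZ hay hbz
    have e1 : 1 ≤ Z * y * P ^ 2 := hay.trans (by gcongr)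
    have e2 : 1 ≤ Z * z * P ^ 2 := hbz.trans (by gcongr)
    have e3 : 1 ≤ (Z * y * P ^ 2) * (Z * z * P ^ 2) := one_le_mul_of_one_le_of_one_le e1 e2
    calc 1 ≤ (Z / 2) * y * z * (2 * P ^ 4 * Z) := by
          refine e3.trans (le_of_eq ?_)
          ring
      _ ≤ _ := by gcongr
  refine ⟨?_, ?_, fun j hj => ?_⟩
  · rw [quarticDeriv_zero, norm_mul, norm_mul, pow_succ, pow_two]
    gcongr
  · rw [quarticDeriv_zero, norm_mul, norm_mul, pow_succ, pow_two]
    gcongr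
  · refine ⟨?_, hZ.norm_quarticDeriv_mul_le (by linarith) hZ0 hj⟩
    fin_cases j
    · exact absurd rfl hj
    · simp only [Fin.mk_one]
      rw [quarticDeriv_one, norm_mul, norm_mul, norm_sub_rev (φ 1) (φ 0)]
      exact key (a := ‖φ 0 - φ 3‖) (b := ‖φ 0 - φ 2‖) (norm_nonneg _) (norm_nonneg _) l1
        (norm_nonneg _) (norm_nonneg _) u3 u2 k3 k2
    · simp only [Fin.reduceFinMk]
      rw [quarticDeriv_two, norm_mul, norm_mul, norm_sub_rev (φ 2) (φ 0), norm_sub_rev (φ 2) (φ 1)]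
      exact key (a := ‖φ 0 - φ 3‖) (b := ‖φ 0 - φ 1‖) (norm_nonneg _) (norm_nonneg _) l2
        (norm_nonneg _) (norm_nonneg _) u3 u1 k3 k1
    · simp only [Fin.reduceFinMk]
      rw [quarticDeriv_three, norm_mul, norm_mul, norm_sub_rev (φ 3) (φ 0), norm_sub_rev (φ 3) (φ 1),
        norm_sub_rev (φ 3) (φ 2)]
      exact key (a := ‖φ 0 - φ 2‖) (b := ‖φ 0 - φ 1‖) (norm_nonneg _) (norm_nonneg _) l3
        (norm_nonneg _) (norm_nonneg _) u2 u1 k2 k1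

lemma exp_natCast_le_three_pow (n : ℕ) : Real.exp n ≤ 3 ^ n := by
  rw [← Real.exp_one_pow]
  gcongr
  linarith [Real.exp_one_lt_d9]

lemma natCast_le_three_pow (n : ℕ) : (n : ℝ) ≤ 3 ^ n := by
  exact_mod_cast (Nat.lt_pow_self (by norm_num : 1 < 3)).le

lemma norm_bounds_of_norm_sub_mul_le {z : ℂ} {u : ℝ} {Q : ℕ} (hQ : 2 ≤ Q)
    (hu : 0 < u) (h : ‖z - (u : ℂ)‖ * Q ≤ u) :
    u * Real.exp (-(2 / Q)) ≤ ‖z‖ ∧ ‖z‖ ≤ u * (3 / 2) := by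
  have hQ' : (2 : ℝ) ≤ Q := by exact_mod_cast hQ
  have hQ0 : (0 : ℝ) < Q := by linarith
  have hn : ‖(u : ℂ)‖ = u := by rw [Complex.norm_real, Real.norm_of_nonneg hu.le]
  have h1 : ‖z - u‖ ≤ u * (1 / Q) := by
    rw [mul_one_div, le_div_iff₀ hQ0]
    exact h
  have hx : (1 : ℝ) / Q ≤ 1 / 2 := one_div_le_one_div_of_le (by norm_num) hQ'
  have hx0 : (0 : ℝ) < 1 / Q := by positivity
  constructor
  · have h2 := norm_sub_norm_le (u : ℂ) z
    rw [norm_sub_rev, hn] at h2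
    have h3 : Real.exp (-(2 / Q)) ≤ 1 - 1 / Q := by
      rw [Real.exp_neg, inv_le_comm₀ (Real.exp_pos _) (by linarith)]
      refine le_trans ?_ (Real.add_one_le_exp _)
      rw [inv_le_iff_one_le_mul₀ (by linarith)]
      rw [show (2 : ℝ) / Q = 2 * (1 / Q) by ring]
      nlinarith
    nlinarith [mul_le_mul_of_nonneg_left h3 hu.le]
  · have h2 := norm_sub_norm_le z (u : ℂ)
    rw [hn] at h2
    nlinarith

/-- The norm of `D / z ^ r`, when `z` is close to the real power `‖D‖ ^ (b / B)` and `r` is close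
to `B / b`. -/
lemma norm_mul_inv_pow_le {D z : ℂ} {l : ℝ} {b B Q r : ℕ} (hB1 : 1 ≤ B)
    (hQ : 2 ≤ Q) (hD : ‖D‖ = Real.exp l) (hl : l ≤ 3 * (B + 1)) (hr : r * b ≤ B)
    (hr' : B ≤ (r + 1) * b)
    (hz : ‖z - (Real.exp ((b : ℝ) / B * l) : ℝ)‖ * Q ≤ Real.exp ((b : ℝ) / B * l)) :
    ‖D * z⁻¹ ^ r‖ ≤ 3 ^ (6 * b + 2 * (r / Q + 1)) := by
  obtain ⟨h1, -⟩ := norm_bounds_of_norm_sub_mul_le hQ (Real.exp_pos _) hz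
  rw [← Real.exp_add] at h1
  have hB' : (1 : ℝ) ≤ B := by exact_mod_cast hB1
  have hB0 : (0 : ℝ) < B := by linarith
  have hQ0 : (0 : ℝ) < Q := by
    have : (2 : ℝ) ≤ Q := by exact_mod_cast hQ
    linarith
  have h2 : ‖z⁻¹‖ ≤ Real.exp (-((b : ℝ) / B * l + -(2 / Q))) := by
    rw [norm_inv, Real.exp_neg]
    exact inv_anti₀ (Real.exp_pos _) h1
  have hr1 : (r : ℝ) * b ≤ B := by exact_mod_cast hr
  have hr2 : (B : ℝ) ≤ (r + 1) * b := by exact_mod_cast hr'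
  have h3 : l * (1 - r * (b / B)) ≤ 6 * b := by
    have e1 : 0 ≤ 1 - r * ((b : ℝ) / B) := by
      rw [← mul_div_assoc, sub_nonneg, div_le_one hB0]
      exact hr1
    have e2 : 1 - r * ((b : ℝ) / B) ≤ b / B := by
      have : 1 ≤ (r + 1) * ((b : ℝ) / B) := by
        rw [← mul_div_assoc, one_le_div hB0]
        exact hr2
      linarith
    calc l * (1 - r * (b / B)) ≤ 3 * (B + 1) * (1 - r * (b / B)) := by gcongr
      _ ≤ 3 * (B + 1) * (b / B) := by gcongr
      _ ≤ 3 * (B + B) * (b / B) := by gcongr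
      _ = 6 * b := by field_simp; ring
  have h4 : (r : ℝ) / Q ≤ (r / Q : ℕ) + 1 := by
    rw [div_le_iff₀ hQ0]
    exact_mod_cast (Nat.lt_div_mul_add (a := r) (b := Q) (by omega)).le.trans (by rw [add_mul, one_mul])
  calc ‖D * z⁻¹ ^ r‖ ≤ Real.exp l * Real.exp (-((b : ℝ) / B * l + -(2 / Q))) ^ r := by
        rw [norm_mul, hD, norm_pow]
        gcongr
    _ = Real.exp (l * (1 - r * (b / B)) + 2 * (r / Q)) := by
        rw [← Real.exp_nat_mul, ← Real.exp_add]
        congr 1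
        ring
    _ ≤ Real.exp ((6 * b + 2 * (r / Q + 1) : ℕ) : ℝ) := by
        apply Real.exp_le_exp.2
        push_cast
        linarith
    _ ≤ _ := exp_natCast_le_three_pow _

/-- A complex number close to `exp v` is the exponential of a number close to `v`. -/
lemma exists_exp_eq_of_norm_sub_le {z : ℂ} {v : ℝ} {Q : ℕ} (hQ : 2 ≤ Q)
    (hz : ‖z - (Real.exp v : ℝ)‖ * Q ≤ Real.exp v) :
    ∃ κ : ℂ, ‖κ‖ * Q ≤ 3 / 2 ∧ z = Complex.exp (v + κ) := by
  have hQ' : (2 : ℝ) ≤ Q := by exact_mod_cast hQ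
  have hQ0 : (0 : ℝ) < Q := by linarith
  set u := Real.exp v with hu
  have hu0 : 0 < u := Real.exp_pos _
  have huc : (u : ℂ) ≠ 0 := by exact_mod_cast hu0.ne'
  have hn : ‖(u : ℂ)‖ = u := by rw [Complex.norm_real, Real.norm_of_nonneg hu0.le]
  have h1 : ‖(z - u) / u‖ * Q ≤ 1 := by
    rw [norm_div, hn, div_mul_eq_mul_div, div_le_one hu0]
    exact hz
  have h2 : ‖(z - u) / u‖ ≤ 1 / 2 := by nlinarith [norm_nonneg ((z - u) / u)]
  refine ⟨Complex.log (1 + (z - u) / u), ?_, ?_⟩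
  · have := Complex.norm_log_one_add_half_le_self h2
    nlinarith [norm_nonneg ((z - u) / u)]
  · have hne : 1 + (z - u) / u ≠ 0 := by
      intro h0
      have : (z - u) / u = -1 := by linear_combination h0
      rw [this] at h2
      norm_num at h2
    rw [Complex.exp_add, Complex.exp_log hne, ← Complex.ofReal_exp, ← hu]
    field_simp
    ring

/-- Logarithms of the derivative at the roots. -/
lemma log_norm_quarticDeriv_bounds {φ : Fin 4 → ℂ} {P Z : ℝ} {B : ℕ} (hP1 : 1 ≤ P)
    (h : PairProductsLe φ P) (hZ : IsolatedPoint φ P Z) (hd : 1 ≤ ∏ j, ‖quarticDeriv φ j‖)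
    (hB : Real.exp B ≤ Z) (hB' : Z ≤ Real.exp (B + 1)) (hZP : 72 * P ^ 4 ≤ Z) :
    (∀ j, quarticDeriv φ j ≠ 0) ∧
    2 * B ≤ Real.log ‖quarticDeriv φ 0‖ ∧ (∀ j, Real.log ‖quarticDeriv φ j‖ ≤ 3 * (B + 1)) ∧
    (∀ j, j ≠ 0 → Real.log ‖quarticDeriv φ j‖ ≤ 0) ∧
    (∀ j, -(2 * (B + 1)) ≤ Real.log ‖quarticDeriv φ j‖) ∧
    |Real.log ‖quarticDeriv φ 1‖ - Real.log ‖quarticDeriv φ 2‖| ≤ 6 * P + 3 := by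
  have hP4 : 1 ≤ P ^ 4 := one_le_pow₀ hP1
  have hP2 : P ^ 2 ≤ P ^ 4 := pow_le_pow_right₀ hP1 (by norm_num)
  have hZ0 : 0 < Z := by linarith
  obtain ⟨h0, h0', hj⟩ := norm_quarticDeriv_bounds hP1 hZ0 h hZ hd
  have hne : ∀ j, quarticDeriv φ j ≠ 0 := by
    intro j hj0
    have : ∏ j, ‖quarticDeriv φ j‖ = 0 := Finset.prod_eq_zero (Finset.mem_univ j) (by simp [hj0])
    linarith
  have hpos : ∀ j, 0 < ‖quarticDeriv φ j‖ := fun j => norm_pos_iff.2 (hne j)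
  have hlogZ : Real.log Z ≤ B + 1 := (Real.log_le_iff_le_exp hZ0).2 hB'
  have hlogZ' : (B : ℝ) ≤ Real.log Z := (Real.le_log_iff_exp_le hZ0).2 hB
  have hB0 : (0 : ℝ) ≤ B := Nat.cast_nonneg B
  have h2 : 2 * (B : ℝ) ≤ Real.log ‖quarticDeriv φ 0‖ := by
    have : Z ^ 2 ≤ ‖quarticDeriv φ 0‖ := by
      refine le_trans ?_ h0
      nlinarith [sq_nonneg Z]
    calc 2 * (B : ℝ) ≤ 2 * Real.log Z := by linarith
      _ = Real.log (Z ^ 2) := by rw [Real.log_pow]; norm_num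
      _ ≤ _ := Real.log_le_log (by positivity) this
  have hneg : ∀ j, j ≠ 0 → Real.log ‖quarticDeriv φ j‖ ≤ 0 := by
    intro j h
    apply Real.log_nonpos (norm_nonneg _)
    have := (hj j h).2
    nlinarith [hpos j]
  have hlow : ∀ j, j ≠ 0 → -(2 * ((B : ℝ) + 1)) ≤ Real.log ‖quarticDeriv φ j‖ := by
    intro j h
    have h1 := (hj j h).1
    have h3 : 1 ≤ ‖quarticDeriv φ j‖ * Z ^ 2 := by
      refine h1.trans ?_
      rw [pow_two Z]
      gcongr
      linarith
    have h4 := Real.log_nonneg h3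
    rw [Real.log_mul (hpos j).ne' (by positivity), Real.log_pow] at h4
    push_cast at h4
    linarith
  have key : ∀ i j, i ≠ 0 → j ≠ 0 →
      Real.log ‖quarticDeriv φ i‖ - Real.log ‖quarticDeriv φ j‖ ≤ 6 * P + 3 := by
    intro i j hi hj'
    rw [← Real.log_div (hpos i).ne' (hpos j).ne']
    have h1 : ‖quarticDeriv φ i‖ / ‖quarticDeriv φ j‖ ≤ 18 * P ^ 6 := by
      rw [div_le_iff₀ (hpos j)]
      have a1 := (hj i hi).2
      have a2 := (hj j hj').1
      have a3 : ‖quarticDeriv φ i‖ * Z ≤ 9 * P ^ 2 * (‖quarticDeriv φ j‖ * (2 * P ^ 4 * Z)) :=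
        a1.trans (le_mul_of_one_le_right (by positivity) a2)
      have a4 : 9 * P ^ 2 * (‖quarticDeriv φ j‖ * (2 * P ^ 4 * Z)) =
        18 * P ^ 6 * ‖quarticDeriv φ j‖ * Z := by ring
      rw [a4] at a3
      exact le_of_mul_le_mul_right a3 hZ0
    refine (Real.log_le_log (div_pos (hpos i) (hpos j)) h1).trans ?_
    rw [Real.log_mul (by norm_num) (by positivity), Real.log_pow]
    have l1 : Real.log 18 ≤ 3 := by
      rw [Real.log_le_iff_le_exp (by norm_num)]
      have : Real.exp 3 = Real.exp 1 ^ 3 := by rw [Real.exp_one_pow]; norm_num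
      rw [this]
      calc (18 : ℝ) ≤ 2.7 ^ 3 := by norm_num
        _ ≤ _ := by gcongr; linarith [Real.exp_one_gt_d9]
    have l2 : Real.log P ≤ P := (Real.log_le_sub_one_of_pos (by linarith)).trans (by linarith)
    push_cast
    linarith
  refine ⟨hne, h2, fun j => ?_, hneg, fun j => ?_, ?_⟩
  · by_cases h : j = 0
    · subst h
      have : Real.log ‖quarticDeriv φ 0‖ ≤ Real.log (Z ^ 3) := Real.log_le_log (hpos 0) h0'
      rw [Real.log_pow] at this
      push_cast at this
      linarith
    · linarith [hneg j h]
  · by_cases h : j = 0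
    · subst h
      linarith
    · exact hlow j h
  · rw [abs_le]
    constructor
    · linarith [key 2 1 (by decide) (by decide)]
    · exact key 1 2 (by decide) (by decide)

/-- The number `θ` whose exponential is the square of a cross-ratio of an isolated point. -/
lemma exists_exp_eq_sq_div_sq {φ : Fin 4 → ℂ} {P Z : ℝ} (hP1 : 1 ≤ P) (hZ : IsolatedPoint φ P Z)
    (hZP : 72 * P ≤ Z) :
    ∃ θ : ℂ, ‖θ‖ * Z ≤ 1 ∧ (φ 0 - φ 1) ^ 2 = (φ 0 - φ 2) ^ 2 * Complex.exp θ := by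
  have hZ0 : 0 < Z := by linarith
  have h1 := hZ.lower 2 (by decide)
  have h2 := hZ.close 2 1 (by decide) (by decide)
  have hpos : 0 < ‖φ 0 - φ 2‖ := by linarith
  have hne : φ 0 - φ 2 ≠ 0 := norm_pos_iff.1 hpos
  have h3 : ‖(φ 2 - φ 1) / (φ 0 - φ 2)‖ * Z ≤ 1 / 12 := by
    rw [norm_div, div_mul_eq_mul_div, div_le_iff₀ hpos]
    rw [le_div_iff₀ hZ0] at h2
    linarith
  have h4 : ‖(φ 2 - φ 1) / (φ 0 - φ 2)‖ ≤ 1 / 2 := by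
    nlinarith [norm_nonneg ((φ 2 - φ 1) / (φ 0 - φ 2))]
  refine ⟨2 * Complex.log (1 + (φ 2 - φ 1) / (φ 0 - φ 2)), ?_, ?_⟩
  · have := Complex.norm_log_one_add_half_le_self h4
    rw [norm_mul, Complex.norm_ofNat]
    nlinarith
  · have h5 : 1 + (φ 2 - φ 1) / (φ 0 - φ 2) ≠ 0 := by
      intro h0
      have : (φ 2 - φ 1) / (φ 0 - φ 2) = -1 := by linear_combination h0
      rw [this] at h4
      norm_num at h4
    rw [two_mul, Complex.exp_add, Complex.exp_log h5]
    field_simp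
    ring

set_option maxHeartbeats 1000000 in
/-- Four conjugate numbers, one of which is isolated, contradict the two-logarithm estimate as soon
as there is a unit which approximates a small power of the different. -/
theorem isolatedPoint_contradiction {R A ι : Type*} [CommRing R] [CommRing A] [Fintype ι]
    (hD : Fintype.card ι ≤ 24) (S : ι → A →+* ℂ) (i₀ : ι)
    (hA : ∀ x : A, x ≠ 0 → 1 ≤ ∏ i, ‖S i x‖) (T : Fin 4 → R →+* A) (ψ : Fin 4 → R →+* ℂ)
    (hT : ∀ i, ∃ e : Equiv.Perm (Fin 4), ∀ j y, S i (T j y) = ψ (e j) y)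
    (hT₀ : ∀ j y, S i₀ (T j y) = ψ j y) (htrans : ∃ i, ∀ y, S i (T 1 y) = ψ 0 y)
    {φ : Fin 4 → ℂ} {x δ : R} {ξ : Rˣ} (hx : ∀ j, ψ j x = φ j)
    (hδ : ∀ j, ψ j δ = quarticDeriv φ j) {P : ℕ} {Z : ℝ} (hP1 : 1 ≤ P) (hφ : PairProductsLe φ P)
    (hZ : IsolatedPoint φ P Z) (hd : 1 ≤ ∏ j, ‖quarticDeriv φ j‖) {b B Q r w : ℕ} (hb : 1 ≤ b)
    (hB : Real.exp B ≤ Z) (hB' : Z ≤ Real.exp (B + 1)) (hZP : 72 * (P : ℝ) ^ 4 ≤ Z)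
    (hPB : 6 * P + 3 ≤ B) (hQ : 2 ≤ Q) (hr : r * b ≤ B) (hr' : B ≤ (r + 1) * b)
    (hξ : ∀ j, ‖ψ j ξ - (Real.exp ((b : ℝ) / B * Real.log ‖quarticDeriv φ j‖) : ℝ)‖ * Q ≤
      Real.exp ((b : ℝ) / B * Real.log ‖quarticDeriv φ j‖))
    (hw : 20000 ≤ w) (hwr : 40000 * w ^ 2 * (2 * P + 6 * b + 2 * (r / Q + 1)) ≤ r)
    (hwρ : 10 * (44000 * w ^ 2 * (2 * P + 6 * b + 2 * (r / Q + 1)) +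
      r * (44000 * w ^ 2 * (12 * b))) ≤ 3 ^ w)
    (hwB : 2 * ((w + 3) * (16000000 * (w ^ 2) ^ 2 * (12 * b) *
      (2 * P + 6 * b + 2 * (r / Q + 1)))) ≤ B) : False := by
  have hP1' : (1 : ℝ) ≤ P := by exact_mod_cast hP1
  have hPP : (P : ℝ) ≤ P ^ 4 := le_self_pow₀ hP1' (by norm_num)
  obtain ⟨hne, hl0, hl3, hlneg, hllow, hl12⟩ :=
    log_norm_quarticDeriv_bounds hP1' hφ hZ hd hB hB' hZP
  obtain ⟨θ, hθ, hθ'⟩ := exists_exp_eq_sq_div_sq hP1' hZ (by linarith)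
  have hZ0 : 0 < Z := (Real.exp_pos _).trans_le hB
  have hB1 : 1 ≤ B := by omega
  have hB1' : (1 : ℝ) ≤ B := by exact_mod_cast hB1
  have hB0 : (0 : ℝ) < B := by linarith
  have hb1' : (1 : ℝ) ≤ b := by exact_mod_cast hb
  have hQ' : (2 : ℝ) ≤ Q := by exact_mod_cast hQ
  set l : Fin 4 → ℝ := fun j => Real.log ‖quarticDeriv φ j‖ with hl
  set s : ℝ := (b : ℝ) / B with hs
  have hs0 : 0 ≤ s := by positivity
  have hs2 : s * (B + 1) ≤ 2 * b := by
    calc s * (B + 1) ≤ s * (B + B) := by gcongr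
      _ = 2 * b := by rw [hs]; field_simp; ring
  have hsB : s * B = b := by rw [hs]; field_simp
  have hrs : r * s ≤ 1 := by
    rw [hs, ← mul_div_assoc, div_le_one hB0]
    exact_mod_cast hr
  have hu6 : ∀ j, s * l j ≤ 6 * b := fun j => by
    calc s * l j ≤ s * (3 * (B + 1)) := by gcongr; exact hl3 j
      _ ≤ 6 * b := by linarith
  have hu4 : ∀ j, -(4 * b) ≤ s * l j := fun j => by
    calc -(4 * (b : ℝ)) ≤ s * (-(2 * (B + 1))) := by linarith
      _ ≤ _ := by gcongr; exact hllow j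
  have hξ1 : ∀ j, Real.exp (s * l j) * Real.exp (-(2 / Q)) ≤ ‖ψ j ξ‖ ∧
      ‖ψ j ξ‖ ≤ Real.exp (s * l j) * (3 / 2) := fun j =>
    norm_bounds_of_norm_sub_mul_le hQ (Real.exp_pos _) (hξ j)
  have hinv : ∀ j, ψ j ((ξ⁻¹ : Rˣ) : R) = (ψ j (ξ : R))⁻¹ := fun j => by
    rw [eq_comm, inv_eq_iff_eq_inv, eq_comm]
    apply inv_eq_of_mul_eq_one_left
    rw [← map_mul, Units.mul_inv, map_one]
  have hξ0 : ∀ j, ψ j (ξ : R) ≠ 0 := fun j =>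
    (ξ.isUnit.map (ψ j)).ne_zero
  have hnorminv : ∀ j, ‖(ψ j (ξ : R))⁻¹‖ ≤ Real.exp (-(s * l j)) * 3 := fun j => by
    rw [norm_inv, Real.exp_neg, inv_le_comm₀ (norm_pos_iff.2 (hξ0 j)) (by positivity), mul_inv, inv_inv]
    refine le_trans ?_ (hξ1 j).1
    gcongr
    rw [Real.exp_neg, inv_le_inv₀ (by norm_num) (Real.exp_pos _)]
    calc Real.exp (2 / Q) ≤ Real.exp 1 := by
          gcongr
          rw [div_le_one (by linarith)]
          exact hQ'
      _ ≤ 3 := by linarith [Real.exp_one_lt_d9]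
  have hinjφ : Function.Injective φ := by
    intro i j hij
    by_contra hne'
    apply hne i
    rw [quarticDeriv]
    exact Finset.prod_eq_zero (Finset.mem_erase.2 ⟨Ne.symm hne', Finset.mem_univ j⟩)
      (sub_eq_zero.2 hij)
  -- the relevant algebraic numbers
  set γ : R := δ * ((ξ⁻¹ : Rˣ) : R) ^ r with hγ
  set α : A := T 1 ξ * T 2 ((ξ⁻¹ : Rˣ) : R) with hα
  set μ : A := -((T 2 x - T 3 x) * (T 0 x - T 1 x)) * T 1 γ with hμ
  set ν : A := (T 1 x - T 3 x) * (T 0 x - T 2 x) * T 2 γ with hν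
  have hγψ : ∀ j, ψ j γ = quarticDeriv φ j * (ψ j (ξ : R))⁻¹ ^ r := fun j => by
    rw [hγ, map_mul, map_pow, hinv, hδ]
  have hγn : ∀ j, ‖ψ j γ‖ ≤ 3 ^ (6 * b + 2 * (r / Q + 1)) := fun j => by
    rw [hγψ]
    exact norm_mul_inv_pow_le hB1 hQ (Real.exp_log (norm_pos_iff.2 (hne j))).symm (hl3 j) hr hr'
      (hξ j)
  have hαn : ∀ i, ‖S i α‖ ≤ 3 ^ (12 * b) := by
    intro i
    obtain ⟨e, he⟩ := hT i
    rw [hα, map_mul, he, he, hinv, norm_mul]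
    calc ‖ψ (e 1) ξ‖ * ‖(ψ (e 2) (ξ : R))⁻¹‖
        ≤ (Real.exp (s * l (e 1)) * (3 / 2)) * (Real.exp (-(s * l (e 2))) * 3) :=
          mul_le_mul (hξ1 _).2 (hnorminv _) (norm_nonneg _) (by positivity)
      _ = Real.exp (s * l (e 1) - s * l (e 2)) * 4.5 := by
          rw [sub_eq_add_neg, Real.exp_add]
          ring
      _ ≤ Real.exp (10 * b) * Real.exp 2 := by
          have h2 : Real.exp 2 = Real.exp 1 ^ 2 := by rw [Real.exp_one_pow]; norm_num
          have := hu6 (e 1)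
          have := hu4 (e 2)
          gcongr
          · linarith
          · rw [h2]
            nlinarith [Real.exp_one_gt_d9]
      _ = Real.exp (10 * b + 2) := by rw [Real.exp_add]
      _ ≤ Real.exp ((12 * b : ℕ) : ℝ) := by
          gcongr
          push_cast
          linarith
      _ ≤ _ := exp_natCast_le_three_pow _
  have hPpow : (P : ℝ) ≤ 3 ^ (2 * P) :=
    (natCast_le_three_pow P).trans (pow_le_pow_right₀ (by norm_num) (by omega))
  have hpair : ∀ (e : Equiv.Perm (Fin 4)) (i j k m : Fin 4), (∃ e' : Equiv.Perm (Fin 4),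
      e' 0 = i ∧ e' 1 = j ∧ e' 2 = k ∧ e' 3 = m) →
      ‖(φ (e i) - φ (e j)) * (φ (e k) - φ (e m))‖ ≤ P := by
    rintro e i j k m ⟨e', rfl, rfl, rfl, rfl⟩
    rw [norm_mul]
    exact (hφ.comp e) e'
  have hμn : ∀ i, ‖S i μ‖ ≤ 3 ^ (2 * P + 6 * b + 2 * (r / Q + 1)) := by
    intro i
    obtain ⟨e, he⟩ := hT i
    simp only [hμ, map_mul, map_neg, map_sub, he, hx]
    rw [norm_mul, norm_neg, add_assoc, pow_add]
    exact mul_le_mul ((hpair e 2 3 0 1 (by decide)).trans hPpow) (hγn _) (norm_nonneg _)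
      (by positivity)
  have hνn : ∀ i, ‖S i ν‖ ≤ 3 ^ (2 * P + 6 * b + 2 * (r / Q + 1)) := by
    intro i
    obtain ⟨e, he⟩ := hT i
    simp only [hν, map_mul, map_sub, he, hx]
    rw [norm_mul, add_assoc, pow_add]
    exact mul_le_mul ((hpair e 1 3 0 2 (by decide)).trans hPpow) (hγn _) (norm_nonneg _)
      (by positivity)
  have hαinj : Function.Injective fun m : ℕ => S i₀ α ^ m := by
    obtain ⟨i, hi⟩ := htrans
    obtain ⟨e, he⟩ := hT i
    have he1 : e 1 = 0 := by
      apply hinjφ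
      rw [← hx, ← hx, ← he, hi]
    have he2 : e 2 ≠ 0 := by
      rw [← he1]
      exact fun h => absurd (e.injective h) (by decide)
    have h1 : 1 < ‖S i α‖ := by
      have hpos : 0 < ‖ψ (e 2) (ξ : R)‖ := norm_pos_iff.2 (hξ0 _)
      rw [hα, map_mul, he, he, hinv, he1, norm_mul, norm_inv, ← div_eq_mul_inv, one_lt_div hpos]
      refine (hξ1 _).2.trans_lt (lt_of_lt_of_le ?_ (hξ1 0).1)
      rw [← Real.exp_add]
      have g1 : s * l (e 2) ≤ 0 := mul_nonpos_of_nonneg_of_nonpos hs0 (hlneg _ he2)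
      have g2 : 2 * b ≤ s * l 0 := by
        calc 2 * (b : ℝ) = s * (2 * B) := by linarith
          _ ≤ _ := by gcongr
      have g3 : (2 : ℝ) / Q ≤ 1 := by
        rw [div_le_one (by linarith)]
        exact hQ'
      calc Real.exp (s * l (e 2)) * (3 / 2) ≤ Real.exp 0 * (3 / 2) := by gcongr
        _ < Real.exp 1 := by
          rw [Real.exp_zero]
          linarith [Real.exp_one_gt_d9]
        _ ≤ _ := by
          gcongr
          linarith
    have h2 : Function.Injective fun m : ℕ => α ^ m := by
      intro m n hmn
      have h3 : ‖S i α‖ ^ m = ‖S i α‖ ^ n := by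
        rw [← norm_pow, ← norm_pow, ← map_pow, ← map_pow]
        exact congrArg _ (congrArg _ hmn)
      exact pow_right_injective₀ (by linarith) h1.ne' h3
    have hSinj : Function.Injective (S i₀) := by
      rw [injective_iff_map_eq_zero]
      intro y hy
      by_contra hy0
      have := hA y hy0
      rw [Finset.prod_eq_zero (Finset.mem_univ i₀) (by rw [hy, norm_zero])] at this
      linarith
    intro m n hmn
    apply h2
    apply hSinj
    simpa only [map_pow] using hmn
  obtain ⟨κ₁, hκ₁, hz₁⟩ := exists_exp_eq_of_norm_sub_le hQ (hξ 1)
  obtain ⟨κ₂, hκ₂, hz₂⟩ := exists_exp_eq_of_norm_sub_le hQ (hξ 2)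
  set lam : ℂ := ((s * (l 1 - l 2) : ℝ) : ℂ) + κ₁ - κ₂ with hlam
  have hexp : S i₀ α = Complex.exp lam := by
    rw [hα, map_mul, hT₀, hT₀, hinv, hz₁, hz₂, ← Complex.exp_neg, ← Complex.exp_add]
    congr 1
    rw [hlam]
    push_cast
    ring
  have hκn : ‖κ₁ - κ₂‖ * Q ≤ 3 := by
    have := norm_sub_le κ₁ κ₂
    nlinarith
  have hlamn : ‖lam‖ ≤ s * (6 * P + 3) + ‖κ₁ - κ₂‖ := by
    rw [hlam, add_sub_assoc]
    refine (norm_add_le _ _).trans ?_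
    gcongr
    rw [Complex.norm_real, Real.norm_eq_abs, abs_mul, abs_of_nonneg hs0]
    gcongr
  have hlam₁ : ‖lam‖ ≤ ((12 * b : ℕ) : ℝ) := by
    have h1 : s * (6 * P + 3) ≤ s * B := by
      gcongr
      exact_mod_cast hPB
    push_cast
    nlinarith [norm_nonneg (κ₁ - κ₂)]
  have h4 : (r : ℝ) ≤ ((r / Q : ℕ) + 1) * Q := by
    exact_mod_cast (Nat.lt_div_mul_add (a := r) (b := Q) (by omega)).le.trans
      (by rw [add_mul, one_mul])
  have hlam₂ : r * ‖lam‖ ≤ 4 * ((2 * P + 6 * b + 2 * (r / Q + 1) : ℕ) : ℝ) := by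
    have h1 : r * ‖lam‖ ≤ (r * s) * (6 * P + 3) + r * ‖κ₁ - κ₂‖ := by
      calc r * ‖lam‖ ≤ r * (s * (6 * P + 3) + ‖κ₁ - κ₂‖) := by gcongr
        _ = _ := by ring
    have h2 : r * ‖κ₁ - κ₂‖ ≤ ((r / Q : ℕ) + 1) * 3 := by
      calc r * ‖κ₁ - κ₂‖ ≤ (((r / Q : ℕ) + 1) * Q) * ‖κ₁ - κ₂‖ := by gcongr
        _ = ((r / Q : ℕ) + 1) * (‖κ₁ - κ₂‖ * Q) := by ring
        _ ≤ _ := by gcongr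
    have h3 : (r * s) * (6 * P + 3) ≤ 1 * (6 * P + 3) := by gcongr
    have h5 : (0 : ℝ) ≤ (r / Q : ℕ) := Nat.cast_nonneg _
    push_cast
    linarith
  have hμν : S i₀ μ = S i₀ ν * Complex.exp (-(r * lam) + θ) := by
    have e1 : Complex.exp (-(r * lam)) = (ψ 1 (ξ : R))⁻¹ ^ r * (ψ 2 (ξ : R)) ^ r := by
      rw [show -((r : ℂ) * lam) = (r : ℕ) * (-lam) by ring, Complex.exp_nat_mul, ← mul_pow,
        Complex.exp_neg, ← hexp, hα, map_mul, hT₀, hT₀, hinv, mul_inv, inv_inv]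
    have e2 : (ψ 2 (ξ : R))⁻¹ ^ r * (ψ 2 (ξ : R)) ^ r = 1 := by
      rw [← mul_pow, inv_mul_cancel₀ (hξ0 2), one_pow]
    rw [Complex.exp_add, e1]
    simp only [hμ, hν, map_mul, map_neg, map_sub, hT₀, hx, hγψ, quarticDeriv_one, quarticDeriv_two]
    linear_combination ((φ 2 - φ 3) * (φ 1 - φ 2) * (φ 1 - φ 3) * (ψ 1 (ξ : R))⁻¹ ^ r) * hθ' -
      (φ 1 - φ 3) * (φ 0 - φ 2) * ((φ 2 - φ 0) * (φ 2 - φ 1) * (φ 2 - φ 3)) *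
      (ψ 1 (ξ : R))⁻¹ ^ r * Complex.exp θ * e2
  have hsub : ∀ i j, i ≠ j → φ i - φ j ≠ 0 := fun i j hij => sub_ne_zero.2 (hinjφ.ne hij)
  have hν0 : S i₀ ν ≠ 0 := by
    simp only [hν, map_mul, map_sub, hT₀, hx, hγψ]
    exact mul_ne_zero (mul_ne_zero (hsub 1 3 (by decide)) (hsub 0 2 (by decide)))
      (mul_ne_zero (hne 2) (pow_ne_zero _ (inv_ne_zero (hξ0 2))))
  have hθn : ‖θ‖ * 3 ^ ((w + 3) * (16000000 * (w ^ 2) ^ 2 * (12 * b) *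
      (2 * P + 6 * b + 2 * (r / Q + 1)))) ≤ 1 := by
    generalize (w + 3) * (16000000 * (w ^ 2) ^ 2 * (12 * b) *
      (2 * P + 6 * b + 2 * (r / Q + 1))) = M at hwB ⊢
    refine le_trans (mul_le_mul_of_nonneg_left (le_trans ?_ hB) (norm_nonneg θ)) hθ
    calc (3 : ℝ) ^ M ≤ (Real.exp 1 ^ 2) ^ M := by
          gcongr
          nlinarith [Real.exp_one_gt_d9]
      _ = Real.exp ((2 * M : ℕ) : ℝ) := by rw [← pow_mul, Real.exp_one_pow]
      _ ≤ _ := Real.exp_le_exp.2 (by exact_mod_cast hwB)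
  exact two_logarithms_contradiction hD S i₀ hA (by omega) (by omega) (by omega) hαn hμn hνn hαinj
    hexp hμν hν0 hlam₁ hlam₂ (by nlinarith) hwr hwρ hθn

lemma pow_le_three_pow {w : ℕ} (hw : 1000000000 ≤ w) : w ^ 148 ≤ 3 ^ w := by
  have h1 : w ≤ 3 ^ (w / 148) := by
    have h2 : w / 148 < 2 ^ (w / 148) := Nat.lt_two_pow_self
    have h3 : w < 148 * (w / 148 + 1) := by omega
    obtain ⟨n, hn⟩ : ∃ n, w / 148 = n + 100 := ⟨w / 148 - 100, by omega⟩
    rw [hn] at h3 ⊢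
    have h4 : n < 3 ^ n := Nat.lt_pow_self (by norm_num)
    have h5 : 148 * 101 ≤ 3 ^ 100 := by norm_num
    rw [pow_add]
    nlinarith
  calc w ^ 148 ≤ (3 ^ (w / 148)) ^ 148 := Nat.pow_le_pow_left h1 _
    _ = 3 ^ (w / 148 * 148) := by rw [← pow_mul]
    _ ≤ 3 ^ w := Nat.pow_le_pow_right (by norm_num) (Nat.div_mul_le_self _ _)

/-- The parameters which are used to apply the two-logarithm estimate. -/
lemma two_logarithms_parameters {w P b B : ℕ} (hw : 1000000000 ≤ w) (hPw : P ≤ w) (hb : 1 ≤ b)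
    (hbw : b ≤ w ^ 65) (hB : w ^ 140 ≤ B) (hB' : B ≤ (w + 1) ^ 140) :
    40000 * w ^ 2 * (2 * P + 6 * b + 2 * (B / b / w ^ 8 + 1)) ≤ B / b ∧
    10 * (44000 * w ^ 2 * (2 * P + 6 * b + 2 * (B / b / w ^ 8 + 1)) +
      B / b * (44000 * w ^ 2 * (12 * b))) ≤ 3 ^ w ∧
    2 * ((w + 3) * (16000000 * (w ^ 2) ^ 2 * (12 * b) *
      (2 * P + 6 * b + 2 * (B / b / w ^ 8 + 1)))) ≤ B := by
  have hr75 : w ^ 75 ≤ B / b := by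
    rw [Nat.le_div_iff_mul_le hb]
    calc w ^ 75 * b ≤ w ^ 75 * w ^ 65 := Nat.mul_le_mul_left _ hbw
      _ = w ^ 140 := by rw [← pow_add]
      _ ≤ B := hB
  have hrb : B / b * b ≤ B := Nat.div_mul_le_self B b
  set r := B / b with hr
  have hq : r / w ^ 8 * w ^ 8 ≤ r := Nat.div_mul_le_self _ _
  set q := r / w ^ 8 with hqd
  clear_value q r
  have hw0 : 0 < w := by omega
  have hw65 : w ≤ w ^ 65 := Nat.le_self_pow (by norm_num) w
  have hh : 2 * P + 6 * b + 2 * (q + 1) ≤ 10 * w ^ 65 + 2 * q := by omega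
  have hwpow : ∀ {c n m : ℕ}, c ≤ w ^ m → c * w ^ n ≤ w ^ (n + m) := fun {c n m} h => by
    rw [pow_add, mul_comm]
    exact Nat.mul_le_mul_left _ h
  have hw2 : 1000000000000000000 ≤ w ^ 2 := by nlinarith
  have h1 : 40000 * w ^ 2 * (2 * P + 6 * b + 2 * (q + 1)) ≤ r := by
    have e1 : 800000 * w ^ 67 ≤ w ^ 75 :=
      (hwpow (m := 8) (by
        calc 800000 ≤ w ^ 1 := by rw [pow_one]; omega
          _ ≤ w ^ 8 := Nat.pow_le_pow_right hw0 (by norm_num))).trans (le_of_eq rfl)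
    have e2 : 160000 * w ^ 2 ≤ w ^ 8 :=
      (hwpow (m := 6) (by
        calc 160000 ≤ w ^ 1 := by rw [pow_one]; omega
          _ ≤ w ^ 6 := Nat.pow_le_pow_right hw0 (by norm_num))).trans (le_of_eq rfl)
    have e3 : 160000 * w ^ 2 * q ≤ r := (Nat.mul_le_mul_right q e2).trans (by rwa [mul_comm])
    have e4 : 40000 * w ^ 2 * (2 * P + 6 * b + 2 * (q + 1)) ≤
        40000 * w ^ 2 * (10 * w ^ 65 + 2 * q) := Nat.mul_le_mul_left _ hh
    have e5 : 2 * (40000 * w ^ 2 * (10 * w ^ 65 + 2 * q)) =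
        800000 * w ^ 67 + 160000 * w ^ 2 * q := by ring
    omega
  refine ⟨h1, ?_, ?_⟩
  · have e1 : 2 * P + 6 * b + 2 * (q + 1) ≤ B := by
      have e2 : r ≤ B := le_trans (Nat.le_mul_of_pos_right r hb) hrb
      refine le_trans (Nat.le_mul_of_pos_left _ (by positivity)) (h1.trans e2)
    have e2 : 44000 * w ^ 2 * (2 * P + 6 * b + 2 * (q + 1)) ≤ 44000 * w ^ 2 * B :=
      Nat.mul_le_mul_left _ e1
    have e3 : r * (44000 * w ^ 2 * (12 * b)) ≤ 44000 * w ^ 2 * 12 * B := by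
      calc r * (44000 * w ^ 2 * (12 * b)) = 44000 * w ^ 2 * 12 * (r * b) := by ring
        _ ≤ _ := Nat.mul_le_mul_left _ hrb
    calc _ ≤ 10 * (44000 * w ^ 2 * B + 44000 * w ^ 2 * 12 * B) := by gcongr
      _ = 5720000 * w ^ 2 * B := by ring
      _ ≤ w ^ (2 + 1) * B := by
        gcongr
        exact hwpow (by rw [pow_one]; omega)
      _ ≤ w ^ (2 + 1) * (w + 1) ^ 140 := by gcongr
      _ ≤ w ^ (2 + 1) * (2 * w) ^ 140 := by
        gcongr
        omega
      _ = 2 ^ 140 * w ^ 143 := by ring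
      _ ≤ w ^ (143 + 5) := hwpow (by
        calc 2 ^ 140 ≤ 1000000000 ^ 5 := by norm_num
          _ ≤ w ^ 5 := Nat.pow_le_pow_left hw 5)
      _ ≤ 3 ^ w := pow_le_three_pow hw
  · have e1 : 2 * ((w + 3) * (16000000 * (w ^ 2) ^ 2 * (12 * b) *
        (2 * P + 6 * b + 2 * (q + 1)))) ≤
        2 * ((2 * w) * (16000000 * (w ^ 2) ^ 2 * (12 * b) * (10 * w ^ 65 + 2 * q))) := by
      gcongr
      omega
    have e2 : 2 * (2 * ((2 * w) * (16000000 * (w ^ 2) ^ 2 * (12 * b) * (10 * w ^ 65 + 2 * q)))) =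
        15360000000 * w ^ 70 * b + 3072000000 * w ^ 5 * (b * q) := by ring
    have e3 : 15360000000 * w ^ 70 * b ≤ B := by
      refine le_trans ?_ hB
      calc 15360000000 * w ^ 70 * b ≤ w ^ (70 + 2) * w ^ 65 := by
            gcongr
            exact hwpow (by omega)
        _ = w ^ 137 := by ring
        _ ≤ w ^ 140 := Nat.pow_le_pow_right hw0 (by norm_num)
    have e4 : 3072000000 * w ^ 5 * (b * q) ≤ B := by
      calc 3072000000 * w ^ 5 * (b * q) ≤ w ^ (5 + 3) * (b * q) := by
            gcongr
            refine hwpow (le_trans (by omega : _ ≤ w ^ 2) (Nat.pow_le_pow_right hw0 (by norm_num)))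
        _ = q * w ^ 8 * b := by ring
        _ ≤ r * b := by gcongr
        _ ≤ B := hrb
    omega

section

open NumberField

lemma exists_pow_le_lt_succ_pow (B : ℕ) {n : ℕ} (hn : n ≠ 0) :
    ∃ w, w ^ n ≤ B ∧ B < (w + 1) ^ n := by
  have hex : ∃ w, B < (w + 1) ^ n := ⟨B, (Nat.lt_succ_self B).trans_le (Nat.le_self_pow hn _)⟩
  classical
  refine ⟨Nat.find hex, ?_, Nat.find_spec hex⟩
  rcases Nat.eq_zero_or_pos (Nat.find hex) with h | h
  · rw [h, zero_pow hn]
    exact Nat.zero_le _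
  · have := Nat.find_min hex (m := Nat.find hex - 1) (by omega)
    rwa [Nat.sub_add_cancel h, not_lt] at this

set_option maxHeartbeats 1000000 in
/-- Bound for the distance of an isolated point, in the presence of suitable number fields. -/
theorem isolatedPoint_lt_of_embeddings (K L : Type*) [Field K] [NumberField K] [Field L]
    [NumberField L] (hK : Module.finrank ℚ K = 4) (hL : Fintype.card (L →+* ℂ) ≤ 24)
    {x δ : 𝓞 K} (τ : Fin 4 → K →+* L) (i₀ : L →+* ℂ) {φ : Fin 4 → ℂ} (hφi : Function.Injective φ)
    (hi₀ : ∀ j, i₀ (τ j x) = φ j)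
    (hσ : ∀ σ : L →+* ℂ, ∃ e : Equiv.Perm (Fin 4), ∀ j, σ (τ j x) = φ (e j))
    (htrans : ∃ σ : L →+* ℂ, σ (τ 1 x) = φ 0)
    (hδ : ∀ (ψ : K →+* ℂ) (j : Fin 4), ψ x = φ j → ψ δ = quarticDeriv φ j)
    (hdisc : |discr K| ≤ (Algebra.norm ℤ δ).natAbs) {P : ℕ} {Z : ℝ} (hP1 : 1 ≤ P)
    (hφ : PairProductsLe φ P) (hZ : IsolatedPoint φ P Z) :
    Z < Real.exp (((10 ^ 9 * (P ^ 6 + 1) ^ 65) ^ 140 : ℕ) : ℝ) := by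
  by_contra! hcon
  have hZ0 : 0 < Z := (Real.exp_pos _).trans_le hcon
  obtain ⟨w₀, hw₀⟩ : ∃ w₀, w₀ = 10 ^ 9 * (P ^ 6 + 1) ^ 65 := ⟨_, rfl⟩
  rw [← hw₀] at hcon
  -- the embeddings of `K`
  set ψ : Fin 4 → K →+* ℂ := fun j => i₀.comp (τ j) with hψ
  have hψx : ∀ j, ψ j x = φ j := hi₀
  have hψinj : Function.Injective ψ := fun i j hij => hφi (by rw [← hψx, ← hψx, hij])
  have hψbij : Function.Bijective ψ := by
    rw [Fintype.bijective_iff_injective_and_card]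
    exact ⟨hψinj, by rw [Fintype.card_fin, Embeddings.card, hK]⟩
  have hψδ : ∀ j, ψ j δ = quarticDeriv φ j := fun j => hδ _ _ (hψx j)
  have huniq : ∀ (σ : K →+* ℂ) j, σ x = φ j → σ = ψ j := by
    intro σ j hσj
    obtain ⟨k, rfl⟩ := hψbij.surjective σ
    rw [hψx] at hσj
    rw [hφi hσj]
  have hprod : ∏ j, ‖quarticDeriv φ j‖ = (Algebra.norm ℤ δ).natAbs := by
    rw [← prod_norm_embeddings, ← hψbij.prod_comp]
    exact Finset.prod_congr rfl fun j _ => by rw [hψδ]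
  have hne : ∀ j, quarticDeriv φ j ≠ 0 := fun j => by
    rw [quarticDeriv, Finset.prod_ne_zero_iff]
    exact fun k hk => sub_ne_zero.2 (hφi.ne (Finset.ne_of_mem_erase hk).symm)
  have hδ0 : δ ≠ 0 := by
    rintro rfl
    apply hne 0
    rw [← hψδ]
    simp
  have hd : 1 ≤ ∏ j, ‖quarticDeriv φ j‖ := by
    have hpos : (0 : ℝ) < ∏ j, ‖quarticDeriv φ j‖ :=
      Finset.prod_pos fun j _ => norm_pos_iff.2 (hne j)
    rw [hprod] at hpos ⊢
    exact_mod_cast hpos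
  have hdN : (Algebra.norm ℤ δ).natAbs ≤ P ^ 6 := by
    have := prod_norm_quarticDeriv_le hφ
    rw [hprod] at this
    exact_mod_cast this
  -- the parameters
  have hPw : 10 ^ 9 * P ≤ w₀ := by
    rw [hw₀]
    gcongr
    calc P ≤ P ^ 6 := Nat.le_self_pow (by norm_num) _
      _ ≤ P ^ 6 + 1 := Nat.le_succ _
      _ ≤ _ := Nat.le_self_pow (by norm_num) _
  set B := ⌊Real.log Z⌋₊ with hBdef
  have hlogZ : (w₀ ^ 140 : ℕ) ≤ Real.log Z := (Real.le_log_iff_exp_le hZ0).2 hcon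
  have hB0 : w₀ ^ 140 ≤ B := Nat.le_floor hlogZ
  have hBZ : Real.exp B ≤ Z := by
    rw [← Real.le_log_iff_exp_le hZ0]
    exact Nat.floor_le (le_trans (Nat.cast_nonneg _) hlogZ)
  have hBZ' : Z ≤ Real.exp (B + 1) := by
    rw [← Real.log_le_iff_le_exp hZ0]
    exact (Nat.lt_floor_add_one _).le
  obtain ⟨w, hwB, hwB'⟩ := exists_pow_le_lt_succ_pow B (n := 140) (by norm_num)
  have hw₀w : w₀ ≤ w := by
    have := lt_of_pow_lt_pow_left₀ 140 (Nat.zero_le _) (hB0.trans_lt hwB')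
    omega
  have hw : 1000000000 ≤ w := by omega
  have hw₀' : 10 ^ 8 * (w ^ 8) ^ 8 * (P ^ 6 + 1) ^ 65 ≤ w ^ 65 := by
    generalize (P ^ 6 + 1) ^ 65 = M at hw₀ ⊢
    calc 10 ^ 8 * (w ^ 8) ^ 8 * M ≤ 10 ^ 9 * (w ^ 8) ^ 8 * M :=
          Nat.mul_le_mul_right _ (Nat.mul_le_mul_right _ (by norm_num))
      _ = w₀ * w ^ 64 := by rw [hw₀]; ring
      _ ≤ w * w ^ 64 := by gcongr
      _ = w ^ 65 := by ring
  have hw65 : w ^ 65 ≤ B := (Nat.pow_le_pow_right (by omega) (by norm_num)).trans hwB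
  have hwleB : w ≤ B := (Nat.le_self_pow (by norm_num) w).trans hwB
  obtain ⟨b, hb1, hb, ξ, hξ⟩ := exists_unit_near_rpow K hK (N := P ^ 6) (Q := w ^ 8) (B := B)
    (Nat.one_le_pow _ _ (by omega)) (hdisc.trans (by exact_mod_cast hdN)) hδ0 hdN
    (hw₀'.trans hw65)
  obtain ⟨h1, h2, h3⟩ := two_logarithms_parameters hw (P := P) (by omega) hb1 (hb.trans hw₀') hwB
    hwB'.le
  have hZP : 72 * (P : ℝ) ^ 4 ≤ Z := by
    have e1 : 72 * P ^ 4 ≤ B := by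
      calc 72 * P ^ 4 ≤ w * w ^ 4 := by
            gcongr <;> omega
        _ = w ^ 5 := by ring
        _ ≤ w ^ 140 := Nat.pow_le_pow_right (by omega) (by norm_num)
        _ ≤ B := hwB
    calc 72 * (P : ℝ) ^ 4 ≤ B := by exact_mod_cast e1
      _ ≤ Real.exp B := by linarith [Real.add_one_le_exp (B : ℝ)]
      _ ≤ Z := hBZ
  refine isolatedPoint_contradiction (R := 𝓞 K) (A := 𝓞 L) (ι := L →+* ℂ) hL
    (fun σ => σ.comp (algebraMap (𝓞 L) L)) i₀ (fun y hy => one_le_prod_norm_embeddings L hy)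
    (fun j => RingOfIntegers.mapRingHom (τ j)) (fun j => (ψ j).comp (algebraMap (𝓞 K) K))
    (fun σ => ?_) (fun j y => rfl) ?_ hψx hψδ hP1 hφ hZ hd hb1 hBZ hBZ' hZP (by omega)
    (Q := w ^ 8) (r := B / b) (w := w) (ξ := ξ) ?_ (Nat.div_mul_le_self B b) ?_ (fun j => ?_) (by omega)
    h1 h2 h3
  · obtain ⟨e, he⟩ := hσ σ
    refine ⟨e, fun j y => ?_⟩
    have := huniq (σ.comp (τ j)) (e j) (he j)
    exact congrArg (fun f : K →+* ℂ => f (y : K)) this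
  · obtain ⟨σ, h⟩ := htrans
    refine ⟨σ, fun y => ?_⟩
    have := huniq (σ.comp (τ 1)) 0 h
    exact congrArg (fun f : K →+* ℂ => f (y : K)) this
  · exact le_trans (by omega) (Nat.le_self_pow (by norm_num) w)
  · rw [add_mul, one_mul]
    exact (Nat.lt_div_mul_add hb1).le
  · have e1 : ‖ψ j δ‖ ^ ((b : ℝ) / B) =
        Real.exp ((b : ℝ) / B * Real.log ‖quarticDeriv φ j‖) := by
      rw [hψδ, Real.rpow_def_of_pos (norm_pos_iff.2 (hne j)), mul_comm]
    have := hξ (ψ j)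
    rw [e1] at this
    exact this

end

section

open NumberField Polynomial IntermediateField

/-- If `p` does not vanish at the algebraic integer `t`, then one of its values at the conjugates
of `t` is not small. -/
lemma exists_aroot_one_le_norm_aeval {t : ℂ} (ht : IsIntegral ℤ t) {p : ℤ[X]} (hp : aeval t p ≠ 0) :
    ∃ t' : ℂ, aeval t' (minpoly ℚ t) = 0 ∧ 1 ≤ ‖aeval t' p‖ := by
  have htQ : IsIntegral ℚ t := ht.tower_top
  have : FiniteDimensional ℚ ℚ⟮t⟯ := adjoin.finiteDimensional htQ
  have : NumberField ℚ⟮t⟯ := { to_charZero := inferInstance, to_finiteDimensional := this }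
  let g : ℚ⟮t⟯ := AdjoinSimple.gen ℚ t
  have hgt : algebraMap ℚ⟮t⟯ ℂ g = t := AdjoinSimple.algebraMap_gen ℚ t
  have hg : IsIntegral ℤ g := by
    rw [← isIntegral_algebraMap_iff (algebraMap ℚ⟮t⟯ ℂ).injective, hgt]
    exact ht
  let x : 𝓞 ℚ⟮t⟯ := ⟨g, hg⟩
  have hx : ∀ σ : ℚ⟮t⟯ →+* ℂ, σ ((aeval x p : 𝓞 ℚ⟮t⟯) : ℚ⟮t⟯) = aeval (σ g) p := by
    intro σ
    rw [aeval_def, aeval_def]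
    refine (hom_eval₂ p _ (σ.comp (algebraMap (𝓞 ℚ⟮t⟯) ℚ⟮t⟯)) x).trans ?_
    congr 1
    exact Subsingleton.elim _ _
  have hx0 : aeval x p ≠ 0 := by
    intro h0
    apply hp
    have h1 := hx (algebraMap ℚ⟮t⟯ ℂ)
    rw [h0, hgt] at h1
    rw [← h1]
    simp
  obtain ⟨σ, hσ⟩ : ∃ σ : ℚ⟮t⟯ →+* ℂ, 1 ≤ ‖σ (aeval x p : 𝓞 ℚ⟮t⟯)‖ := by
    by_contra! hcon
    refine absurd (one_le_prod_norm_embeddings _ hx0) (not_le.2 ?_)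
    classical
    rw [← Finset.mul_prod_erase _ _ (Finset.mem_univ (algebraMap ℚ⟮t⟯ ℂ))]
    exact mul_lt_one_of_nonneg_of_lt_one_left (norm_nonneg _) (hcon _)
      (Finset.prod_le_one (fun σ _ => norm_nonneg _) fun σ _ => (hcon σ).le)
  rw [hx] at hσ
  refine ⟨σ g, ?_, hσ⟩
  have h1 : aeval g (minpoly ℚ t) = 0 := by
    have := aeval_algebraMap_apply ℂ g (minpoly ℚ t)
    rw [hgt, minpoly.aeval, eq_comm, map_eq_zero] at this
    exact this
  have := aeval_algHom_apply (σ : ℚ⟮t⟯ →+* ℂ).toRatAlgHom g (minpoly ℚ t)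
  rw [h1, map_zero] at this
  exact this

/-- The monic quartic with integer coefficients and roots `φ`. -/
lemma aeval_quartic {f : ℤ[X]} {φ : Fin 4 → ℂ}
    (hf : f.map (Int.castRingHom ℂ) = ∏ j, (X - C (φ j))) (z : ℂ) :
    aeval z f = ∏ j, (z - φ j) := by
  rw [aeval_def, ← eval_map, show algebraMap ℤ ℂ = Int.castRingHom ℂ from rfl, hf, eval_prod]
  simp

lemma aeval_derivative_quartic {f : ℤ[X]} {φ : Fin 4 → ℂ}
    (hf : f.map (Int.castRingHom ℂ) = ∏ j, (X - C (φ j))) (j : Fin 4) :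
    aeval (φ j) (derivative f) = quarticDeriv φ j := by
  rw [aeval_def, ← eval_map, ← derivative_map]
  rw [show algebraMap ℤ ℂ = Int.castRingHom ℂ from rfl, hf, derivative_prod_finset, eval_finsetSum,
    Finset.sum_eq_single j]
  · rw [eval_mul, eval_prod]
    simp [quarticDeriv]
  · intro k _ hk
    rw [eval_mul, eval_prod, Finset.prod_eq_zero (Finset.mem_erase.2 ⟨hk.symm, Finset.mem_univ j⟩),
      zero_mul]
    simp
  · simp

end

section

open NumberField Polynomial IntermediateField

lemma quartic_monic {f : ℤ[X]} {φ : Fin 4 → ℂ}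
    (hf : f.map (Int.castRingHom ℂ) = ∏ j, (X - C (φ j))) : f.Monic ∧ f.natDegree = 4 := by
  have hinj : Function.Injective (Int.castRingHom ℂ) := Int.cast_injective
  have h1 : (f.map (Int.castRingHom ℂ)).Monic := by
    rw [hf]
    exact monic_prod_of_monic _ _ fun j _ => monic_X_sub_C _
  refine ⟨monic_of_injective hinj h1, ?_⟩
  rw [← natDegree_map_eq_of_injective hinj, hf, natDegree_prod_of_monic _ _ fun j _ => monic_X_sub_C _]
  simp

/-- If one root of an integer quartic is isolated, then the quartic is the minimal polynomial of
that root. -/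
lemma minpoly_eq_of_isolatedPoint {f : ℤ[X]} {φ : Fin 4 → ℂ}
    (hf : f.map (Int.castRingHom ℂ) = ∏ j, (X - C (φ j))) (hφi : Function.Injective φ) {P Z : ℝ}
    (hP1 : 1 ≤ P) (hZ0 : 0 < Z) (hZP : 9 * P ^ 2 < Z) 
    (hZ : IsolatedPoint φ P Z) : minpoly ℚ (φ 0) = f.map (Int.castRingHom ℚ) := by
  obtain ⟨hmon, hdeg⟩ := quartic_monic hf
  have hroot : ∀ j, aeval (φ j) f = 0 := fun j => by
    rw [aeval_quartic hf]
    exact Finset.prod_eq_zero (Finset.mem_univ j) (sub_self _)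
  have hrootQ : ∀ z : ℂ, aeval z (f.map (Int.castRingHom ℚ)) = aeval z f := fun z =>
    aeval_map_algebraMap (A := ℚ) z f
  have hint : ∀ j, IsIntegral ℤ (φ j) := fun j => ⟨f, hmon, hroot j⟩
  have hne : ∀ j, quarticDeriv φ j ≠ 0 := fun j => by
    rw [quarticDeriv, Finset.prod_ne_zero_iff]
    exact fun k hk => sub_ne_zero.2 (hφi.ne (Finset.ne_of_mem_erase hk).symm)
  have hvan : ∀ j, aeval (φ 0) (minpoly ℚ (φ j)) = 0 := by
    intro j
    obtain ⟨t, ht, ht1⟩ := exists_aroot_one_le_norm_aeval (hint j) (p := derivative f)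
      (by rw [aeval_derivative_quartic hf]; exact hne j)
    have htf : aeval t f = 0 := by
      rw [← hrootQ]
      exact aeval_eq_zero_of_dvd_aeval_eq_zero
        (minpoly.dvd ℚ (φ j) (by rw [hrootQ, hroot])) ht
    rw [aeval_quartic hf, Finset.prod_eq_zero_iff] at htf
    obtain ⟨k, -, hk⟩ := htf
    rw [sub_eq_zero] at hk
    subst hk
    by_cases hk0 : k = 0
    · rwa [hk0] at ht
    · exfalso
      rw [aeval_derivative_quartic hf] at ht1
      have := hZ.norm_quarticDeriv_mul_le (by linarith) hZ0 hk0
      nlinarith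
  have heq : ∀ j, minpoly ℚ (φ 0) = minpoly ℚ (φ j) := fun j =>
    (minpoly.eq_of_irreducible_of_monic (minpoly.irreducible (hint j).tower_top) (hvan j)
      (minpoly.monic (hint j).tower_top)).symm
  have hmQ : (f.map (Int.castRingHom ℚ)).Monic := hmon.map _
  have hd1 : minpoly ℚ (φ 0) ∣ f.map (Int.castRingHom ℚ) :=
    minpoly.dvd ℚ (φ 0) (by rw [hrootQ, hroot])
  have hm0 : (minpoly ℚ (φ 0)).Monic := minpoly.monic (hint 0).tower_top
  have hd2 : f.map (Int.castRingHom ℂ) ∣ (minpoly ℚ (φ 0)).map (algebraMap ℚ ℂ) := by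
    rw [hf]
    refine Finset.prod_dvd_of_coprime
      (fun i _ j _ hij => isCoprime_X_sub_C_of_isUnit_sub (sub_ne_zero.2 (hφi.ne hij)).isUnit)
      fun j _ => ?_
    rw [dvd_iff_isRoot, IsRoot, eval_map_algebraMap, heq j, minpoly.aeval]
  refine (eq_of_monic_of_dvd_of_natDegree_le hm0 hmQ hd1 ?_).symm
  have h1 := natDegree_le_of_dvd hd2 (hm0.map _).ne_zero
  rw [natDegree_map_eq_of_injective (algebraMap ℚ ℂ).injective,
    natDegree_map_eq_of_injective (Int.castRingHom ℂ).injective_int] at h1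
  rwa [natDegree_map_eq_of_injective (Int.castRingHom ℚ).injective_int]

end

section

open NumberField Polynomial IntermediateField

/-- The derivative of the minimal polynomial of a primitive integral element bounds the
discriminant. -/
lemma abs_discr_le_natAbs_norm_aeval_derivative (K : Type*) [Field K] [NumberField K] {x : 𝓞 K}
    (hx : Algebra.adjoin ℚ {(x : K)} = ⊤)
    (h0 : aeval x (derivative (minpoly ℤ x)) ≠ 0) :
    |discr K| ≤ (Algebra.norm ℤ (aeval x (derivative (minpoly ℤ x)))).natAbs := by
  have h1 := aeval_derivative_mem_differentIdeal ℤ ℚ K x hx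
  have h2 := Ideal.absNorm_dvd_norm_of_mem h1
  rw [NumberField.absNorm_differentIdeal (K := K)] at h2
  have h3 := Int.le_of_dvd (by
    rw [Int.natCast_natAbs]
    exact abs_pos.2 (Algebra.norm_ne_zero_iff.2 h0)) ((Int.dvd_natAbs).2 h2)
  rwa [Int.natCast_natAbs] at h3

lemma card_ringHom_le_of_adjoin {L : IntermediateField ℚ ℂ} [NumberField L] {φ : Fin 4 → ℂ}
    (hL : L = adjoin ℚ (Set.range φ)) (hmem : ∀ j, φ j ∈ L)
    (hσ : ∀ σ : L →+* ℂ, ∃ e : Equiv.Perm (Fin 4), ∀ j, σ ⟨φ j, hmem j⟩ = φ (e j)) :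
    Fintype.card (L →+* ℂ) ≤ 24 := by
  choose e he using hσ
  have hinj : Function.Injective e := by
    intro σ σ' h
    have h1 : σ.toRatAlgHom = σ'.toRatAlgHom := by
      refine algHom_ext_of_eq_adjoin ℚ hL fun y hy => ?_
      obtain ⟨j, rfl⟩ := hy
      exact (he σ j).trans (by rw [h]; exact (he σ' j).symm)
    ext y
    exact DFunLike.congr_fun h1 y
  calc Fintype.card (L →+* ℂ) ≤ Fintype.card (Equiv.Perm (Fin 4)) :=
        Fintype.card_le_of_injective e hinj
    _ = 24 := by rw [Fintype.card_perm, Fintype.card_fin]; rfl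

/-- Bound for the distance of an isolated root of a monic quartic. -/
theorem isolatedPoint_lt {f : ℤ[X]} {φ : Fin 4 → ℂ}
    (hf : f.map (Int.castRingHom ℂ) = ∏ j, (X - C (φ j))) (hφi : Function.Injective φ) {P : ℕ}
    {Z : ℝ} (hP1 : 1 ≤ P) (hZP : 9 * (P : ℝ) ^ 2 < Z) (hφ : PairProductsLe φ P)
    (hZ : IsolatedPoint φ P Z) :
    Z < Real.exp (((10 ^ 9 * (P ^ 6 + 1) ^ 65) ^ 140 : ℕ) : ℝ) := by
  have hP1' : (1 : ℝ) ≤ P := by exact_mod_cast hP1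
  have hZ0 : 0 < Z := lt_of_le_of_lt (by positivity) hZP
  obtain ⟨hmon, hdeg⟩ := quartic_monic hf
  have hmin := minpoly_eq_of_isolatedPoint hf hφi hP1' hZ0 hZP hZ
  have hroot : ∀ j, aeval (φ j) f = 0 := fun j => by
    rw [aeval_quartic hf]
    exact Finset.prod_eq_zero (Finset.mem_univ j) (sub_self _)
  have hroot' : ∀ z : ℂ, aeval z f = 0 → ∃ k, z = φ k := fun z hz => by
    rw [aeval_quartic hf, Finset.prod_eq_zero_iff] at hz
    obtain ⟨k, -, hk⟩ := hz
    exact ⟨k, sub_eq_zero.1 hk⟩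
  have hint : ∀ j, IsIntegral ℤ (φ j) := fun j => ⟨f, hmon, hroot j⟩
  set g : ℚ[X] := f.map (Int.castRingHom ℚ) with hg
  have hgmon : g.Monic := hmon.map _
  have hgirr : Irreducible g := hmin ▸ minpoly.irreducible (hint 0).tower_top
  have hgdeg : g.natDegree = 4 := by
    rw [hg, natDegree_map_eq_of_injective (Int.castRingHom ℚ).injective_int, hdeg]
  have hrootQ : ∀ z : ℂ, aeval z g = aeval z f := fun z => aeval_map_algebraMap (A := ℚ) z f
  have hminj : ∀ j, minpoly ℚ (φ j) = g := fun j =>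
    (minpoly.eq_of_irreducible_of_monic hgirr (by rw [hrootQ, hroot]) hgmon).symm
  -- the field generated by one root
  have : Fact (Irreducible g) := ⟨hgirr⟩
  let K := AdjoinRoot g
  have hKfin : FiniteDimensional ℚ K := hgmon.finite_adjoinRoot
  have : CharZero K := algebraRat.charZero K
  have : NumberField K := { to_charZero := inferInstance, to_finiteDimensional := hKfin }
  have hK : Module.finrank ℚ K = 4 := by
    rw [(AdjoinRoot.powerBasis hgirr.ne_zero).finrank, AdjoinRoot.powerBasis_dim, hgdeg]
  have hrootK : aeval (AdjoinRoot.root g) f = 0 := by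
    rw [← aeval_map_algebraMap ℚ (AdjoinRoot.root g) f]
    exact AdjoinRoot.aeval_eq g |>.trans AdjoinRoot.mk_self
  let x : 𝓞 K := ⟨AdjoinRoot.root g, f, hmon, hrootK⟩
  have hxK : (x : K) = AdjoinRoot.root g := rfl
  have hminx : minpoly ℤ x = f := by
    apply map_injective (Int.castRingHom ℚ) Int.cast_injective
    have h1 := minpoly.isIntegrallyClosed_eq_field_fractions ℚ K (RingOfIntegers.isIntegral x)
    have h2 : minpoly ℚ (algebraMap (𝓞 K) K x) = g := by
      have := AdjoinRoot.minpoly_root hgirr.ne_zero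
      rw [hgmon.leadingCoeff, inv_one, C_1, mul_one] at this
      exact this
    rw [h2] at h1
    exact h1.symm
  have htop : Algebra.adjoin ℚ {(x : K)} = ⊤ := AdjoinRoot.adjoinRoot_eq_top
  -- the splitting field
  let L : IntermediateField ℚ ℂ := adjoin ℚ (Set.range φ)
  have hLfin : FiniteDimensional ℚ L := by
    refine finiteDimensional_adjoin fun y hy => ?_
    obtain ⟨j, rfl⟩ := hy
    exact (hint j).tower_top
  have : NumberField L := { to_charZero := inferInstance, to_finiteDimensional := hLfin }
  have hmem : ∀ j, φ j ∈ L := fun j => subset_adjoin ℚ _ ⟨j, rfl⟩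
  let t : Fin 4 → L := fun j => ⟨φ j, hmem j⟩
  have ht : ∀ j, aeval (t j) f = 0 := fun j => by
    apply (algebraMap L ℂ).injective
    rw [← aeval_algebraMap_apply, map_zero]
    exact hroot j
  have hσroot : ∀ σ : L →+* ℂ, ∀ j, aeval (σ (t j)) f = 0 := fun σ j => by
    have := aeval_algHom_apply σ.toIntAlgHom (t j) f
    rw [ht, map_zero] at this
    exact this
  have hσ : ∀ σ : L →+* ℂ, ∃ e : Equiv.Perm (Fin 4), ∀ j, σ (t j) = φ (e j) := by
    intro σ
    choose k hk using fun j => hroot' _ (hσroot σ j)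
    have hki : Function.Injective k := by
      intro i j hij
      have h1 : σ (t i) = σ (t j) := by rw [hk, hk, hij]
      exact hφi (congrArg Subtype.val (σ.injective h1))
    exact ⟨Equiv.ofBijective k (Finite.injective_iff_bijective.1 hki), hk⟩
  have htg : ∀ j, (g.eval₂ (algebraMap ℚ L) (t j)) = 0 := fun j => by
    rw [← aeval_def, hg]
    exact (aeval_map_algebraMap ℚ (t j) f).trans (ht j)
  let τ : Fin 4 → K →+* L := fun j => AdjoinRoot.lift (algebraMap ℚ L) (t j) (htg j)
  have hτ : ∀ j, τ j x = t j := fun j => AdjoinRoot.lift_root (htg j)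
  have htrans : ∃ σ : L →+* ℂ, σ (t 1) = φ 0 := by
    have hmint : minpoly ℚ (t 1) = g := by
      rw [← hminj 1]
      exact (minpoly.algebraMap_eq (algebraMap L ℂ).injective (t 1)).symm
    obtain ⟨ψ, hψ⟩ := exists_algHom_of_splits_of_aeval (F := ℚ) (E := L) (K := ℂ) (x := t 1)
      (y := φ 0) (fun s => ⟨Algebra.IsIntegral.isIntegral s, IsAlgClosed.splits _⟩)
      (by rw [hmint, hrootQ, hroot])
    exact ⟨ψ, hψ⟩
  have hδ : ∀ (ψ : K →+* ℂ) (j : Fin 4), ψ x = φ j →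
      ψ (aeval x (derivative f) : 𝓞 K) = quarticDeriv φ j := by
    intro ψ j hj
    rw [← aeval_derivative_quartic hf, ← hj, aeval_def, aeval_def]
    refine (hom_eval₂ (derivative f) _ (ψ.comp (algebraMap (𝓞 K) K)) x).trans ?_
    congr 1
    exact Subsingleton.elim _ _
  have hne : quarticDeriv φ 0 ≠ 0 := by
    rw [quarticDeriv, Finset.prod_ne_zero_iff]
    exact fun k hk => sub_ne_zero.2 (hφi.ne (Finset.ne_of_mem_erase hk).symm)
  have h0 : aeval x (derivative f) ≠ 0 := by
    intro h0
    apply hne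
    have hx0 : ((algebraMap L ℂ).comp (τ 0)) (x : K) = φ 0 := by
      rw [RingHom.comp_apply, hτ]
      rfl
    rw [← hδ _ 0 hx0, h0]
    simp
  refine isolatedPoint_lt_of_embeddings K L hK
    (card_ringHom_le_of_adjoin rfl hmem hσ) (x := x) (δ := aeval x (derivative f)) τ
    (algebraMap L ℂ) hφi (fun j => by rw [hτ]; rfl) (fun σ => ?_) ?_ hδ ?_ hP1 hφ hZ
  · simpa only [hτ] using hσ σ
  · simpa only [hτ] using htrans
  · have := abs_discr_le_natAbs_norm_aeval_derivative K htop (by rwa [hminx])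
    rwa [hminx] at this

/-- Bound for the mutual distances of the roots of a monic quartic with integer coefficients, in
terms of the products of these distances over disjoint pairs. -/
theorem norm_sub_lt_of_pairProductsLe {f : ℤ[X]} {φ : Fin 4 → ℂ}
    (hf : f.map (Int.castRingHom ℂ) = ∏ j, (X - C (φ j))) (hφi : Function.Injective φ) {P : ℕ}
    (hP1 : 1 ≤ P) (hφ : PairProductsLe φ P) (i j : Fin 4) :
    ‖φ i - φ j‖ < Real.exp (((10 ^ 9 * (P ^ 6 + 1) ^ 65) ^ 140 : ℕ) : ℝ) := by
  obtain ⟨⟨i₀, j₀⟩, -, hmax⟩ := Finset.exists_max_image (Finset.univ : Finset (Fin 4 × Fin 4))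
    (fun p => ‖φ p.1 - φ p.2‖) Finset.univ_nonempty
  refine (hmax (i, j) (Finset.mem_univ _)).trans_lt ?_
  set Z := ‖φ i₀ - φ j₀‖ with hZ
  have hP1' : (1 : ℝ) ≤ P := by exact_mod_cast hP1
  rcases lt_or_ge (9 * (P : ℝ) ^ 2) Z with h | h
  · have hZ0 : 0 < Z := lt_of_le_of_lt (by positivity) h
    obtain ⟨e, he⟩ := exists_isolatedPoint (P := P) (by linarith) hZ0
      (by nlinarith [mul_le_mul_of_nonneg_left hP1' (by linarith : (0 : ℝ) ≤ P)]) hφ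
      (fun i j => hmax (i, j) (Finset.mem_univ _)) ⟨i₀, j₀, rfl⟩
    refine isolatedPoint_lt (f := f) (φ := φ ∘ e) ?_ (hφi.comp e.injective) hP1 h (hφ.comp e) he
    rw [hf]
    exact (Equiv.prod_comp e fun j => X - C (φ j)).symm
  · refine h.trans_lt ?_
    have h1 : 9 * P ^ 2 ≤ (10 ^ 9 * (P ^ 6 + 1) ^ 65) ^ 140 := by
      have h2 : P ≤ (P ^ 6 + 1) ^ 65 :=
        (Nat.le_self_pow (by norm_num) P).trans
          ((Nat.le_succ _).trans (Nat.le_self_pow (by norm_num) _))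
      generalize (P ^ 6 + 1) ^ 65 = M at h2 ⊢
      calc 9 * P ^ 2 ≤ (10 ^ 9 * M) ^ 2 := by nlinarith
        _ ≤ _ := Nat.pow_le_pow_right (by omega) (by norm_num)
    have h3 : (9 * (P : ℝ) ^ 2) ≤ (((10 ^ 9 * (P ^ 6 + 1) ^ 65) ^ 140 : ℕ) : ℝ) := by
      exact_mod_cast h1
    exact h3.trans_lt (by linarith [Real.add_one_le_exp (((10 ^ 9 * (P ^ 6 + 1) ^ 65) ^ 140 : ℕ) : ℝ)])

end

section

open Polynomial

lemma pairProductsLe_of_three {φ : Fin 4 → ℂ} {P : ℝ} (h1 : ‖(φ 0 - φ 1) * (φ 2 - φ 3)‖ ≤ P)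
    (h2 : ‖(φ 0 - φ 2) * (φ 1 - φ 3)‖ ≤ P) (h3 : ‖(φ 0 - φ 3) * (φ 1 - φ 2)‖ ≤ P) :
    PairProductsLe φ P := by
  rw [norm_mul] at h1 h2 h3
  intro e
  let D : Sym2 (Fin 4) → ℝ := Sym2.lift ⟨fun i j => ‖φ i - φ j‖, fun i j => norm_sub_rev _ _⟩
  change D s(e 0, e 1) * D s(e 2, e 3) ≤ P
  change D s(0, 1) * D s(2, 3) ≤ P at h1
  change D s(0, 2) * D s(1, 3) ≤ P at h2
  change D s(0, 3) * D s(1, 2) ≤ P at h3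
  have key : ∀ e : Equiv.Perm (Fin 4),
      (s(e 0, e 1) = s(0, 1) ∧ s(e 2, e 3) = s(2, 3)) ∨
      (s(e 0, e 1) = s(2, 3) ∧ s(e 2, e 3) = s(0, 1)) ∨
      (s(e 0, e 1) = s(0, 2) ∧ s(e 2, e 3) = s(1, 3)) ∨
      (s(e 0, e 1) = s(1, 3) ∧ s(e 2, e 3) = s(0, 2)) ∨
      (s(e 0, e 1) = s(0, 3) ∧ s(e 2, e 3) = s(1, 2)) ∨
      (s(e 0, e 1) = s(1, 2) ∧ s(e 2, e 3) = s(0, 3)) := by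
    decide
  rcases key e with ⟨u, v⟩ | ⟨u, v⟩ | ⟨u, v⟩ | ⟨u, v⟩ | ⟨u, v⟩ | ⟨u, v⟩ <;> rw [u, v]
  · exact h1
  · rwa [mul_comm]
  · exact h2
  · rwa [mul_comm]
  · exact h3
  · rwa [mul_comm]

/-- Square roots of three complex numbers, with a prescribed product. -/
lemma exists_sq_eq_mul_eq {u v w Y : ℂ} (h : Y ^ 2 = u * v * w) :
    ∃ β₁ β₂ β₃ : ℂ, β₁ ^ 2 = u ∧ β₂ ^ 2 = v ∧ β₃ ^ 2 = w ∧ β₁ * β₂ * β₃ = Y := by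
  obtain ⟨x, hx⟩ := IsAlgClosed.exists_pow_nat_eq u (n := 2) (by norm_num)
  obtain ⟨y, hy⟩ := IsAlgClosed.exists_pow_nat_eq v (n := 2) (by norm_num)
  obtain ⟨z, hz⟩ := IsAlgClosed.exists_pow_nat_eq w (n := 2) (by norm_num)
  have h1 : (x * y * z) ^ 2 = Y ^ 2 := by
    rw [h, ← hx, ← hy, ← hz]
    ring
  rcases sq_eq_sq_iff_eq_or_eq_neg.1 h1 with h2 | h2
  · exact ⟨x, y, z, hx, hy, hz, h2⟩
  · exact ⟨-x, y, z, by rw [neg_sq, hx], hy, hz, by linear_combination -h2⟩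

/-- Bounds for the integer points on a cubic in Weierstrass form, in terms of the differences of
the roots. -/
lemma weierstrass_bound {X₀ Y₀ B C₀ D₀ : ℤ} (hXY : Y₀ ^ 2 = X₀ ^ 3 + B * X₀ ^ 2 + C₀ * X₀ + D₀)
    {α₁ α₂ α₃ : ℂ} (h12 : α₁ ≠ α₂) (h13 : α₁ ≠ α₃) (h23 : α₂ ≠ α₃)
    (hB : (B : ℂ) = -(α₁ + α₂ + α₃)) (hC : (C₀ : ℂ) = α₁ * α₂ + α₁ * α₃ + α₂ * α₃)
    (hD : (D₀ : ℂ) = -(α₁ * α₂ * α₃)) {P : ℕ} (hP1 : 1 ≤ P) (hP12 : 4 * ‖α₁ - α₂‖ ≤ P)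
    (hP13 : 4 * ‖α₁ - α₃‖ ≤ P) (hP23 : 4 * ‖α₂ - α₃‖ ≤ P) :
    ‖(X₀ : ℂ) - α₁‖ ≤ Real.exp (((10 ^ 9 * (P ^ 6 + 1) ^ 65) ^ 140 : ℕ) : ℝ) ^ 2 ∧
      ‖(Y₀ : ℂ)‖ ≤ Real.exp (((10 ^ 9 * (P ^ 6 + 1) ^ 65) ^ 140 : ℕ) : ℝ) ^ 3 := by
  have hXYc : (Y₀ : ℂ) ^ 2 = (X₀ - α₁) * (X₀ - α₂) * (X₀ - α₃) := by
    have : (Y₀ : ℂ) ^ 2 = X₀ ^ 3 + B * X₀ ^ 2 + C₀ * X₀ + D₀ := by exact_mod_cast hXY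
    rw [this, hB, hC, hD]
    ring
  obtain ⟨β₁, β₂, β₃, h1, h2, h3, hY⟩ := exists_sq_eq_mul_eq hXYc
  have e12 : (β₁ - β₂) * (β₁ + β₂) = α₂ - α₁ := by linear_combination h1 - h2
  have e13 : (β₁ - β₃) * (β₁ + β₃) = α₃ - α₁ := by linear_combination h1 - h3
  have e23 : (β₂ - β₃) * (β₂ + β₃) = α₃ - α₂ := by linear_combination h2 - h3
  have n12 := mul_ne_zero_iff.1 (e12 ▸ sub_ne_zero.2 h12.symm)
  have n13 := mul_ne_zero_iff.1 (e13 ▸ sub_ne_zero.2 h13.symm)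
  have n23 := mul_ne_zero_iff.1 (e23 ▸ sub_ne_zero.2 h23.symm)
  let φ : Fin 4 → ℂ := ![β₁ + β₂ + β₃, β₁ - β₂ - β₃, -β₁ + β₂ - β₃, -β₁ - β₂ + β₃]
  have φ0 : φ 0 = β₁ + β₂ + β₃ := rfl
  have φ1 : φ 1 = β₁ - β₂ - β₃ := rfl
  have φ2 : φ 2 = -β₁ + β₂ - β₃ := rfl
  have φ3 : φ 3 = -β₁ - β₂ + β₃ := rfl
  let f : ℤ[X] := X ^ 4 - C (2 * (3 * X₀ + B)) * X ^ 2 - C (8 * Y₀) * X +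
    C ((3 * X₀ + B) ^ 2 - 4 * (3 * X₀ ^ 2 + 2 * B * X₀ + C₀))
  have hf : f.map (Int.castRingHom ℂ) = ∏ j, (X - C (φ j)) := by
    have s1 : ((3 * X₀ + B : ℤ) : ℂ) = β₁ ^ 2 + β₂ ^ 2 + β₃ ^ 2 := by
      push_cast
      rw [hB, h1, h2, h3]
      ring
    have s2 : ((3 * X₀ ^ 2 + 2 * B * X₀ + C₀ : ℤ) : ℂ) =
        β₁ ^ 2 * β₂ ^ 2 + β₁ ^ 2 * β₃ ^ 2 + β₂ ^ 2 * β₃ ^ 2 := by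
      push_cast
      rw [hB, hC, h1, h2, h3]
      ring
    have t1 : (Int.castRingHom ℂ) (2 * (3 * X₀ + B)) = 2 * (β₁ ^ 2 + β₂ ^ 2 + β₃ ^ 2) := by
      rw [eq_intCast, Int.cast_mul, s1, Int.cast_ofNat]
    have t2 : (Int.castRingHom ℂ) (8 * Y₀) = 8 * (β₁ * β₂ * β₃) := by
      rw [eq_intCast, Int.cast_mul, hY, Int.cast_ofNat]
    have t3 : (Int.castRingHom ℂ) ((3 * X₀ + B) ^ 2 - 4 * (3 * X₀ ^ 2 + 2 * B * X₀ + C₀)) =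
        (β₁ ^ 2 + β₂ ^ 2 + β₃ ^ 2) ^ 2 -
          4 * (β₁ ^ 2 * β₂ ^ 2 + β₁ ^ 2 * β₃ ^ 2 + β₂ ^ 2 * β₃ ^ 2) := by
      rw [eq_intCast, Int.cast_sub, Int.cast_mul, Int.cast_pow, s1, s2, Int.cast_ofNat]
    rw [Polynomial.map_add, Polynomial.map_sub, Polynomial.map_sub, Polynomial.map_mul,
      Polynomial.map_mul, Polynomial.map_pow, Polynomial.map_pow, map_X, map_C, map_C, map_C, t1, t2, t3,
      Fin.prod_univ_four, φ0, φ1, φ2, φ3]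
    simp only [C_add, C_sub, C_mul, C_neg, C_pow, Polynomial.C_ofNat]
    ring
  have hφi : Function.Injective φ := by
    have i01 : φ 0 ≠ φ 1 := fun h => n23.2 (by linear_combination (1 / 2) * (h - φ0 + φ1))
    have i02 : φ 0 ≠ φ 2 := fun h => n13.2 (by linear_combination (1 / 2) * (h - φ0 + φ2))
    have i03 : φ 0 ≠ φ 3 := fun h => n12.2 (by linear_combination (1 / 2) * (h - φ0 + φ3))
    have i12 : φ 1 ≠ φ 2 := fun h => n12.1 (by linear_combination (1 / 2) * (h - φ1 + φ2))
    have i13 : φ 1 ≠ φ 3 := fun h => n13.1 (by linear_combination (1 / 2) * (h - φ1 + φ3))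
    have i23 : φ 2 ≠ φ 3 := fun h => n23.1 (by linear_combination (1 / 2) * (h - φ2 + φ3))
    intro i j hij
    fin_cases i <;> fin_cases j <;> first
      | rfl
      | exact absurd hij i01
      | exact absurd hij i02
      | exact absurd hij i03
      | exact absurd hij i12
      | exact absurd hij i13
      | exact absurd hij i23
      | exact absurd hij.symm i01
      | exact absurd hij.symm i02
      | exact absurd hij.symm i03
      | exact absurd hij.symm i12
      | exact absurd hij.symm i13
      | exact absurd hij.symm i23
  have hφ : PairProductsLe φ P := by
    apply pairProductsLe_of_three
    · rw [φ0, φ1, φ2, φ3, show (β₁ + β₂ + β₃ - (β₁ - β₂ - β₃)) *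
        (-β₁ + β₂ - β₃ - (-β₁ - β₂ + β₃)) = -(4 * (α₂ - α₃)) by linear_combination 4 * e23, norm_neg,
        norm_mul, Complex.norm_ofNat]
      exact hP23
    · rw [φ0, φ1, φ2, φ3, show (β₁ + β₂ + β₃ - (-β₁ + β₂ - β₃)) *
        (β₁ - β₂ - β₃ - (-β₁ - β₂ + β₃)) = -(4 * (α₁ - α₃)) by linear_combination 4 * e13, norm_neg,
        norm_mul, Complex.norm_ofNat]
      exact hP13
    · rw [φ0, φ1, φ2, φ3, show (β₁ + β₂ + β₃ - (-β₁ - β₂ + β₃)) *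
        (β₁ - β₂ - β₃ - (-β₁ + β₂ - β₃)) = -(4 * (α₁ - α₂)) by linear_combination 4 * e12, norm_neg,
        norm_mul, Complex.norm_ofNat]
      exact hP12
  have hbd := norm_sub_lt_of_pairProductsLe hf hφi hP1 hφ
  generalize Real.exp (((10 ^ 9 * (P ^ 6 + 1) ^ 65) ^ 140 : ℕ) : ℝ) = E at hbd ⊢
  have key : ∀ {β : ℂ} (i j k l : Fin 4), 4 * β = (φ i - φ j) + (φ k - φ l) → ‖β‖ ≤ E := by
    intro β i j k l h
    have h5 : ‖4 * β‖ ≤ E + E := by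
      rw [h]
      exact (norm_add_le _ _).trans (add_le_add (hbd _ _).le (hbd _ _).le)
    rw [norm_mul, Complex.norm_ofNat] at h5
    linarith [norm_nonneg β]
  have b1 : ‖β₁‖ ≤ E := key 0 2 1 3 (by rw [φ0, φ1, φ2, φ3]; ring)
  have b2 : ‖β₂‖ ≤ E := key 0 1 2 3 (by rw [φ0, φ1, φ2, φ3]; ring)
  have b3 : ‖β₃‖ ≤ E := key 0 1 3 2 (by rw [φ0, φ1, φ2, φ3]; ring)
  constructor
  · rw [← h1, norm_pow]
    gcongr
  · rw [← hY, norm_mul, norm_mul, pow_succ, pow_two]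
    have : 0 ≤ E := (norm_nonneg _).trans b1
    gcongr

end

/-- Roots of an integral cubic are bounded by three times its height. -/
lemma norm_root_le {a b c d H : ℤ} (ha : a ≠ 0) (hb : |b| ≤ H) (hc : |c| ≤ H) (hd : |d| ≤ H)
    (hH : 1 ≤ H) {r : ℂ} (hr : (a : ℂ) * r ^ 3 + b * r ^ 2 + c * r + d = 0) : ‖r‖ ≤ 3 * H := by
  have hH' : (1 : ℝ) ≤ H := by exact_mod_cast hH
  rcases le_or_gt ‖r‖ 1 with h1 | h1
  · linarith
  have cast_le : ∀ {m : ℤ}, |m| ≤ H → ‖(m : ℂ)‖ ≤ H := fun h => by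
    rw [Complex.norm_intCast]
    exact_mod_cast h
  have ha' : (1 : ℝ) ≤ ‖(a : ℂ)‖ := by
    rw [Complex.norm_intCast]
    exact_mod_cast Int.one_le_abs ha
  have h2 : ‖(a : ℂ) * r ^ 3‖ ≤ H * ‖r‖ ^ 2 + H * ‖r‖ + H := by
    rw [show (a : ℂ) * r ^ 3 = -(b * r ^ 2 + c * r + d) by linear_combination hr, norm_neg]
    refine (norm_add₃_le).trans ?_
    rw [norm_mul, norm_mul, norm_pow]
    have := cast_le hb
    have := cast_le hc
    have := cast_le hd
    gcongr
  rw [norm_mul, norm_pow] at h2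
  have h3 : ‖r‖ ^ 2 * ‖r‖ ≤ ‖r‖ ^ 2 * (3 * H) := by
    have h4 : ‖r‖ ^ 3 ≤ ‖(a : ℂ)‖ * ‖r‖ ^ 3 := le_mul_of_one_le_left (by positivity) ha'
    nlinarith [mul_nonneg (sub_nonneg.2 h1.le) (by linarith : (0 : ℝ) ≤ H), sq_nonneg ‖r‖]
  exact le_of_mul_le_mul_left h3 (by positivity)

lemma four_mul_exponent_le {h k : ℕ} (hh : 1 ≤ h) (hk : 109481 ≤ k) :
    4 * (10 ^ 9 * ((24 * h ^ 2) ^ 6 + 1) ^ 65) ^ 140 ≤ (10 ^ 6 * h) ^ k := by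
  have h24 : 24 * h ^ 2 + 1 ≤ (10 ^ 6 * h) ^ 2 := by nlinarith
  have h9 : 10 ^ 9 ≤ (10 ^ 6 * h) ^ 2 := by nlinarith
  have h4 : 4 ≤ 10 ^ 6 * h := by linarith
  generalize 10 ^ 6 * h = G at h24 h9 h4 ⊢
  have h6 : (24 * h ^ 2) ^ 6 + 1 ≤ G ^ 12 :=
    calc (24 * h ^ 2) ^ 6 + 1 ≤ (24 * h ^ 2 + 1) ^ 6 :=
        Nat.pow_lt_pow_left (Nat.lt_succ_self _) (by norm_num)
      _ ≤ (G ^ 2) ^ 6 := Nat.pow_le_pow_left h24 6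
      _ = G ^ 12 := by rw [← pow_mul]
  calc _ ≤ G * (G ^ 2 * (G ^ 12) ^ 65) ^ 140 :=
        Nat.mul_le_mul h4 (Nat.pow_le_pow_left (Nat.mul_le_mul h9 (Nat.pow_le_pow_left h6 65)) 140)
    _ = G ^ (1 + (2 + 12 * 65) * 140) := by rw [pow_add, pow_mul, pow_add, pow_one, pow_mul]
    _ ≤ G ^ k := Nat.pow_le_pow_right (by linarith) hk

lemma exponent_ge (h : ℕ) : 3 * h ^ 2 + 2 ≤ (10 ^ 9 * ((24 * h ^ 2) ^ 6 + 1) ^ 65) ^ 140 := by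
  rcases Nat.eq_zero_or_pos h with rfl | hh
  · norm_num
  calc 3 * h ^ 2 + 2 ≤ (24 * h ^ 2) ^ 6 + 1 := by
        have := Nat.le_self_pow (n := 6) (by norm_num) (24 * h ^ 2)
        nlinarith
    _ ≤ ((24 * h ^ 2) ^ 6 + 1) ^ 65 := Nat.le_self_pow (by norm_num) _
    _ ≤ 10 ^ 9 * ((24 * h ^ 2) ^ 6 + 1) ^ 65 := Nat.le_mul_of_pos_left _ (by norm_num)
    _ ≤ _ := Nat.le_self_pow (by norm_num) _

lemma exp_cube_add_lt {W t : ℝ} (hW : 2 ≤ W) (ht : t ≤ W) :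
    Real.exp W ^ 3 + t < Real.exp (4 * W) := by
  have h1 : 1 + W ≤ Real.exp W := by linarith [Real.add_one_le_exp W]
  have h2 : Real.exp (4 * W) = Real.exp W ^ 4 := by rw [← Real.exp_nat_mul]; norm_num
  rw [h2]
  generalize Real.exp W = E at *
  have h3 : E ≤ E ^ 3 := le_self_pow₀ (by linarith) (by norm_num)
  nlinarith

lemma max_abs_le {a x y : ℤ} (ha : a ≠ 0) {α : ℂ} {E t : ℝ} (hE : 1 ≤ E) (hα : ‖α‖ ≤ t)
    (hx : ‖((a * x : ℤ) : ℂ) - α‖ ≤ E ^ 2) (hy : ‖((a * y : ℤ) : ℂ)‖ ≤ E ^ 3) :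
    ((max |x| |y| : ℤ) : ℝ) ≤ E ^ 3 + t := by
  have habs : ∀ {m : ℤ}, ((|m| : ℤ) : ℝ) ≤ ‖((a * m : ℤ) : ℂ)‖ := by
    intro m
    rw [Complex.norm_intCast, ← Int.cast_abs, Int.cast_le, abs_mul]
    exact le_mul_of_one_le_left (abs_nonneg _) (Int.one_le_abs ha)
  rw [Int.cast_max]
  refine max_le (habs.trans ?_) (habs.trans ?_)
  · have h6 : ‖((a * x : ℤ) : ℂ)‖ ≤ ‖((a * x : ℤ) : ℂ) - α‖ + ‖α‖ := by
      simpa using norm_add_le (((a * x : ℤ) : ℂ) - α) α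
    have h7 : E ^ 2 ≤ E ^ 3 := pow_le_pow_right₀ hE (by norm_num)
    linarith
  · linarith [norm_nonneg α]

lemma max_abs_lt {a x y : ℤ} {N h k : ℕ} (hN : 4 * N ≤ (10 ^ 6 * h) ^ k) (hN2 : 3 * h ^ 2 + 2 ≤ N)
    (ha : a ≠ 0) {α : ℂ} (hα : ‖α‖ ≤ 3 * h ^ 2)
    (hxy : ‖((a * x : ℤ) : ℂ) - α‖ ≤ Real.exp N ^ 2 ∧ ‖((a * y : ℤ) : ℂ)‖ ≤ Real.exp N ^ 3) :
    ((max |x| |y| : ℤ) : ℝ) < Real.exp (((10 : ℝ) ^ 6 * ((h : ℤ) : ℝ)) ^ k) := by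
  have hNr : 4 * (N : ℝ) ≤ ((10 : ℝ) ^ 6 * ((h : ℤ) : ℝ)) ^ k := by exact_mod_cast hN
  have hN3r : 3 * (h : ℝ) ^ 2 + 2 ≤ N := by exact_mod_cast hN2
  have hlt : Real.exp N ^ 3 + 3 * (h : ℝ) ^ 2 < Real.exp (4 * N) :=
    exp_cube_add_lt (by nlinarith [sq_nonneg (h : ℝ)]) (by linarith)
  exact (max_abs_le ha (Real.one_le_exp (Nat.cast_nonneg _)) hα hxy.1 hxy.2).trans_lt
    (hlt.trans_le (Real.exp_le_exp.2 hNr))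

/-- **Baker's effective bound for elliptic equations (1967).**
Let `a, b, c, d` be rational integers with `a ≠ 0` such that the cubic
`a X³ + b X² + c X + d` has three distinct complex zeroes, and let
`H = max {|a|, |b|, |c|, |d|}`. Then all rational integers `x`, `y` with
`y² = a x³ + b x² + c x + d` satisfy `max {|x|, |y|} < exp((10⁶ H)^1000000)`. -/
theorem baker_elliptic_bound (a b c d : ℤ) (ha : a ≠ 0)
    (hroots : ∃ r₁ r₂ r₃ : ℂ, r₁ ≠ r₂ ∧ r₁ ≠ r₃ ∧ r₂ ≠ r₃ ∧
      ∀ z : ℂ, (a : ℂ) * z ^ 3 + (b : ℂ) * z ^ 2 + (c : ℂ) * z + (d : ℂ) =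
        (a : ℂ) * (z - r₁) * (z - r₂) * (z - r₃))
    (H : ℤ) (hH : H = max (max |a| |b|) (max |c| |d|))
    (x y : ℤ) (hxy : y ^ 2 = a * x ^ 3 + b * x ^ 2 + c * x + d) :
    ((max |x| |y| : ℤ) : ℝ) < Real.exp (((10 : ℝ) ^ 6 * (H : ℝ)) ^ 1000000) := by
  obtain ⟨r₁, r₂, r₃, h12, h13, h23, hr⟩ := hroots
  have haH : |a| ≤ H := hH ▸ (le_max_left _ _).trans (le_max_left _ _)
  have hbH : |b| ≤ H := hH ▸ (le_max_right _ _).trans (le_max_left _ _)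
  have hcH : |c| ≤ H := hH ▸ (le_max_left _ _).trans (le_max_right _ _)
  have hdH : |d| ≤ H := hH ▸ (le_max_right _ _).trans (le_max_right _ _)
  clear hH
  have hH1 : 1 ≤ H := (Int.one_le_abs ha).trans haH
  lift H to ℕ using by linarith
  have hH1n : 1 ≤ H := by exact_mod_cast hH1
  have ha0 : (a : ℂ) ≠ 0 := by exact_mod_cast ha
  have z0 := hr 0
  have z1 := hr 1
  have z2 := hr (-1)
  have root : ∀ {r : ℂ}, (a : ℂ) * (r - r₁) * (r - r₂) * (r - r₃) = 0 → ‖(a : ℂ) * r‖ ≤ 3 * H ^ 2 := by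
    intro r h
    have h1 := norm_root_le ha hbH hcH hdH hH1 ((hr r).trans h)
    have h2 : ‖(a : ℂ)‖ ≤ H := by
      rw [Complex.norm_intCast]
      exact_mod_cast haH
    rw [norm_mul]
    calc ‖(a : ℂ)‖ * ‖r‖ ≤ H * (3 * (H : ℤ)) := by gcongr
      _ = 3 * (H : ℝ) ^ 2 := by rw [Int.cast_natCast]; ring
  have n1 : ‖(a : ℂ) * r₁‖ ≤ 3 * H ^ 2 := root (by ring)
  have n2 : ‖(a : ℂ) * r₂‖ ≤ 3 * H ^ 2 := root (by ring)
  have n3 : ‖(a : ℂ) * r₃‖ ≤ 3 * H ^ 2 := root (by ring)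
  have diff : ∀ {u v : ℂ}, ‖u‖ ≤ 3 * H ^ 2 → ‖v‖ ≤ 3 * H ^ 2 →
      4 * ‖u - v‖ ≤ ((24 * H ^ 2 : ℕ) : ℝ) := by
    intro u v hu hv
    push_cast
    linarith [norm_sub_le u v]
  refine max_abs_lt (four_mul_exponent_le hH1n (by norm_num)) (exponent_ge H) ha n1 ?_
  exact weierstrass_bound (B := b) (C₀ := a * c) (D₀ := a ^ 2 * d)
    (α₂ := a * r₂) (α₃ := a * r₃) (by linear_combination a ^ 2 * hxy)
    ((mul_right_injective₀ ha0).ne h12) ((mul_right_injective₀ ha0).ne h13)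
    ((mul_right_injective₀ ha0).ne h23) (by linear_combination (1 / 2) * z1 + (1 / 2) * z2 - z0)
    (by push_cast; linear_combination a * ((1 / 2) * z1 - (1 / 2) * z2))
    (by push_cast; linear_combination a ^ 2 * z0) (by nlinarith)
    (diff n1 n2) (diff n1 n3) (diff n2 n3)
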